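/- (Robin's criterion) The Riemann hypothesis is true if and only if the inequality σ(n) < e^γ · n · log(log(n)) holds for every integer n ≥ 5041. -/

import Mathlib

namespace Robin
open Set Filter Topology MeasureTheory

/-- The fractional part function cut off to `(1, ∞)`. -/
noncomputable def fractCut : ℝ → ℂ := indicator (Ioi 1) fun t ↦ ((Int.fract t : ℝ) : ℂ)

/-- The half-plane `re s > a`. -/
def rightHalf (a : ℝ) : Set ℂ := {s | a < s.re}

lemma isOpen_rightHalf (a : ℝ) : IsOpen (rightHalf a) :=
  isOpen_lt continuous_const Complex.continuous_re

lemma convex_rightHalf (a : ℝ) : Convex ℝ (rightHalf a) := convex_halfSpace_re_gt a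

lemma isPreconnected_rightHalf (a : ℝ) : IsPreconnected (rightHalf a) :=
  (convex_rightHalf a).isPreconnected

/-- `∫_1^∞ {t} t^{-s-1} dt`. -/
noncomputable def fractInt (s : ℂ) : ℂ := mellin fractCut (-s)

lemma measurable_fractCut : Measurable fractCut := by
  unfold fractCut
  refine Measurable.indicator ?_ measurableSet_Ioi
  exact Complex.measurable_ofReal.comp measurable_fract

lemma norm_fractCut_le (t : ℝ) : ‖fractCut t‖ ≤ 1 := by
  unfold fractCut
  by_cases h : t ∈ Ioi (1:ℝ)
  · rw [indicator_of_mem h, Complex.norm_real, Real.norm_of_nonneg (Int.fract_nonneg t)]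
    exact (Int.fract_lt_one t).le
  · rw [indicator_of_notMem h]; simp

lemma locallyIntegrableOn_fractCut : LocallyIntegrableOn fractCut (Ioi 0) := by
  have : LocallyIntegrable (fun _ : ℝ ↦ (1:ℝ)) := locallyIntegrable_const 1
  refine (this.mono measurable_fractCut.aestronglyMeasurable ?_).locallyIntegrableOn _
  filter_upwards with t
  simpa using norm_fractCut_le t

lemma fractCut_isBigO_top : fractCut =O[atTop] (· ^ (-(0:ℝ))) := by
  simp only [neg_zero, Real.rpow_zero]
  exact Asymptotics.isBigO_of_le _ fun t ↦ by simpa using norm_fractCut_le t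

lemma isBigO_zero_of_indicator_Ioi {f : ℝ → ℂ} (b : ℝ) :
    (indicator (Ioi 1) f) =O[𝓝[>] 0] (· ^ (-b)) := by
  have : (indicator (Ioi 1) f) =ᶠ[𝓝[>] (0:ℝ)] fun _ ↦ (0:ℂ) := by
    have : Iio (1:ℝ) ∈ 𝓝[>] (0:ℝ) := mem_nhdsWithin_of_mem_nhds (Iio_mem_nhds one_pos)
    filter_upwards [this] with t ht
    exact indicator_of_notMem (by simpa using le_of_lt ht) _
  exact this.trans_isBigO (Asymptotics.isBigO_zero _ _)

lemma mellin_indicator_Ioi (f : ℝ → ℂ) (s : ℂ) :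
    mellin (indicator (Ioi 1) f) (-s) = ∫ t in Ioi (1:ℝ), f t * (t:ℂ) ^ (-(s + 1)) := by
  have : ∀ t : ℝ, (t:ℂ) ^ (-s - 1) • (indicator (Ioi 1) f) t =
      indicator (Ioi 1) (fun t : ℝ ↦ f t * (t:ℂ) ^ (-(s + 1))) t := by
    intro t
    by_cases h : t ∈ Ioi (1:ℝ)
    · simp only [indicator_of_mem h, smul_eq_mul, neg_add, ← sub_eq_add_neg]; ring
    · simp [indicator_of_notMem h]
  simp only [mellin, this]
  rw [setIntegral_indicator measurableSet_Ioi,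
    inter_eq_right.mpr (Ioi_subset_Ioi zero_le_one)]

lemma mellinConvergent_indicator_Ioi {f : ℝ → ℂ} {s : ℂ}
    (h : MellinConvergent (indicator (Ioi 1) f) (-s)) :
    IntegrableOn (fun t : ℝ ↦ f t * (t:ℂ) ^ (-(s + 1))) (Ioi 1) := by
  have := h.mono_set (Ioi_subset_Ioi (zero_le_one (α := ℝ)))
  refine this.congr_fun (fun t ht ↦ ?_) measurableSet_Ioi
  simp only [indicator_of_mem ht, smul_eq_mul, neg_add, ← sub_eq_add_neg]; ring

lemma differentiableAt_fractInt {s : ℂ} (hs : 0 < s.re) : DifferentiableAt ℂ fractInt s := by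
  have h := mellin_differentiableAt_of_isBigO_rpow (s := -s) (a := 0) (b := -s.re - 1)
    locallyIntegrableOn_fractCut
    fractCut_isBigO_top (by simpa using hs) (isBigO_zero_of_indicator_Ioi _)
    (by simp)
  exact h.comp s differentiable_neg.differentiableAt

lemma fractInt_integrable {s : ℂ} (hs : 0 < s.re) :
    IntegrableOn (fun t : ℝ ↦ ((Int.fract t : ℝ) : ℂ) * (t:ℂ) ^ (-(s + 1))) (Ioi 1) :=
  mellinConvergent_indicator_Ioi <| mellinConvergent_of_isBigO_rpow (a := 0) (b := -s.re - 1)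
    locallyIntegrableOn_fractCut
    fractCut_isBigO_top (by simpa using hs) (isBigO_zero_of_indicator_Ioi _) (by simp)

lemma norm_fractInt_le {s : ℂ} (hs : 0 < s.re) : ‖fractInt s‖ ≤ 1 / s.re := by
  rw [fractInt, fractCut, mellin_indicator_Ioi]
  have hI : ∫ t in Ioi (1:ℝ), t ^ (-(s.re + 1)) = 1 / s.re := by
    rw [integral_Ioi_rpow_of_lt (by linarith) one_pos]
    simp
  rw [← hI]
  refine norm_integral_le_of_norm_le (integrableOn_Ioi_rpow_of_lt (by linarith) one_pos) ?_
  refine (ae_restrict_mem measurableSet_Ioi).mono fun t ht ↦ ?_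
  have ht0 : 0 < t := one_pos.trans ht
  rw [norm_mul, Complex.norm_cpow_eq_rpow_re_of_pos ht0, Complex.norm_real,
    Real.norm_of_nonneg (Int.fract_nonneg t)]
  simp only [Complex.neg_re, Complex.add_re, Complex.one_re]
  exact mul_le_of_le_one_left (Real.rpow_nonneg ht0.le _) (Int.fract_lt_one t).le

lemma integral_cpow_Ioi_one {s : ℂ} (hs : 1 < s.re) :
    ∫ t in Ioi (1:ℝ), (t:ℂ) * (t:ℂ) ^ (-(s + 1)) = 1 / (s - 1) := by
  have h := integral_Ioi_cpow_of_lt (a := -s) (c := 1) (by simpa using hs) one_pos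
  have h1 : s - 1 ≠ 0 := fun h0 ↦ by
    have := congrArg Complex.re h0; simp at this; linarith
  have h2 : -s + 1 ≠ 0 := by rw [neg_add_eq_sub, ← neg_sub]; exact neg_ne_zero.mpr h1
  calc _ = ∫ t in Ioi (1:ℝ), (t:ℂ) ^ (-s) := by
        refine setIntegral_congr_fun measurableSet_Ioi fun t ht ↦ ?_
        have ht0 : (t:ℂ) ≠ 0 := Complex.ofReal_ne_zero.mpr (one_pos.trans ht).ne'
        nth_rw 1 [← Complex.cpow_one (t:ℂ)]
        rw [← Complex.cpow_add _ _ ht0]; congr 1; ring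
    _ = _ := by
        rw [h, Complex.ofReal_one, Complex.one_cpow, div_eq_div_iff h2 h1]; ring

lemma riemannZeta_eq_fractInt {s : ℂ} (hs : 1 < s.re) :
    riemannZeta s = s / (s - 1) - s * fractInt s := by
  have h0 : s ≠ 0 := fun h ↦ by rw [h] at hs; simp at hs; linarith
  have key := LSeries_eq_mul_integral (fun _ ↦ (1:ℂ)) (r := 1) zero_le_one hs
    (LSeriesSummable_one_iff.mpr hs) (by
      refine Asymptotics.isBigO_of_le _ fun n ↦ ?_
      simp)
  have hz : LSeries (fun _ ↦ (1:ℂ)) s = riemannZeta s := by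
    rw [← LSeries_one_eq_riemannZeta hs]; rfl
  rw [← hz, key, fractInt, fractCut, mellin_indicator_Ioi]
  have hi2 : IntegrableOn (fun t : ℝ ↦ (t:ℂ) * (t:ℂ) ^ (-(s + 1))) (Ioi 1) := by
    have := integrableOn_Ioi_cpow_of_lt (a := -s) (c := 1) (by simpa using hs) one_pos
    refine this.congr_fun (fun t ht ↦ ?_) measurableSet_Ioi
    have ht0 : (t:ℂ) ≠ 0 := Complex.ofReal_ne_zero.mpr (one_pos.trans ht).ne'
    simp only
    nth_rw 2 [← Complex.cpow_one (t:ℂ)]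
    rw [← Complex.cpow_add _ _ ht0]; congr 1; ring
  have : ∫ t in Ioi (1:ℝ), (∑ k ∈ Finset.Icc 1 ⌊t⌋₊, (1:ℂ)) * (t:ℂ) ^ (-(s + 1)) =
      1 / (s - 1) - ∫ t in Ioi (1:ℝ), ((Int.fract t : ℝ) : ℂ) * (t:ℂ) ^ (-(s + 1)) := by
    rw [← integral_cpow_Ioi_one hs, ← integral_sub hi2 (fractInt_integrable (by linarith))]
    refine setIntegral_congr_fun measurableSet_Ioi fun t ht ↦ ?_
    have ht0 : 0 ≤ t := (one_pos.trans ht).le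
    have : ((⌊t⌋₊ : ℝ):ℂ) = (t:ℂ) - ((Int.fract t : ℝ) : ℂ) := by
      rw [← Complex.ofReal_sub, natCast_floor_eq_intCast_floor ht0, Int.self_sub_fract]
    simp only [Finset.sum_const, Nat.card_Icc, add_tsub_cancel_right, nsmul_eq_mul, mul_one]
    rw [← sub_mul, ← this]; simp
  rw [this]; ring

/-- `(s - 1) ζ(s) = s (1 - (s - 1) ∫_1^∞ {t} t^{-s-1} dt)` for `re s > 0`. -/
lemma riemannZeta₁_eq {s : ℂ} (hs : 0 < s.re) :
    riemannZeta₁ s = s * (1 - (s - 1) * fractInt s) := by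
  have hA : AnalyticOnNhd ℂ riemannZeta₁ (rightHalf 0) :=
    (differentiable_riemannZeta₁.differentiableOn).analyticOnNhd (isOpen_rightHalf 0)
  have hB : AnalyticOnNhd ℂ (fun s ↦ s * (1 - (s - 1) * fractInt s)) (rightHalf 0) := by
    refine DifferentiableOn.analyticOnNhd (fun s hs ↦ ?_) (isOpen_rightHalf 0)
    have := differentiableAt_fractInt hs
    exact (by fun_prop : DifferentiableAt ℂ (fun s ↦ s * (1 - (s - 1) * fractInt s)) s)
      |>.differentiableWithinAt
  refine hA.eqOn_of_preconnected_of_eventuallyEq hB (isPreconnected_rightHalf 0)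
    (show (2:ℂ) ∈ rightHalf 0 by simp [rightHalf]) ?_ hs
  filter_upwards [(isOpen_rightHalf 1).mem_nhds (show (2:ℂ) ∈ rightHalf 1 by simp [rightHalf])]
    with z hz
  have hz1 : z - 1 ≠ 0 := fun h0 ↦ by
    have := congrArg Complex.re h0; simp [rightHalf] at this hz; linarith
  have e : riemannZeta z = (z - 1)⁻¹ * riemannZeta₁ z :=
    riemannZeta_eq_inv_sub_mul (sub_ne_zero.mp hz1)
  have : riemannZeta₁ z = (z - 1) * riemannZeta z := by
    rw [e]; field_simp
  rw [this, riemannZeta_eq_fractInt hz]; field_simp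

lemma norm_riemannZeta₁_le {s : ℂ} (hs : 0 < s.re) :
    ‖riemannZeta₁ s‖ ≤ ‖s‖ * (1 + ‖s - 1‖ / s.re) := by
  rw [riemannZeta₁_eq hs, norm_mul]
  gcongr
  refine (norm_sub_le _ _).trans ?_
  rw [norm_one, norm_mul]
  have := norm_fractInt_le hs
  rw [div_eq_mul_one_div ‖s - 1‖]
  gcongr

lemma riemannZeta₁_eq_mul {s : ℂ} (hs : s ≠ 1) :
    riemannZeta₁ s = (s - 1) * riemannZeta s := by
  have : s - 1 ≠ 0 := sub_ne_zero.mpr hs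
  rw [riemannZeta_eq_inv_sub_mul hs]; field_simp

lemma exists_fractInt_real {x : ℝ} (hx : 0 < x) :
    ∃ r : ℝ, fractInt x = r ∧ 0 ≤ r ∧ r ≤ 1 / x := by
  refine ⟨∫ t in Ioi (1:ℝ), Int.fract t * t ^ (-(x + 1)), ?_, ?_, ?_⟩
  · rw [fractInt, fractCut, mellin_indicator_Ioi, ← integral_complex_ofReal]
    refine setIntegral_congr_fun measurableSet_Ioi fun t ht ↦ ?_
    have ht0 : 0 ≤ t := (one_pos.trans ht).le
    simp only [Complex.ofReal_mul, Complex.ofReal_cpow ht0]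
    push_cast; rfl
  · refine setIntegral_nonneg measurableSet_Ioi fun t ht ↦ ?_
    exact mul_nonneg (Int.fract_nonneg t) (Real.rpow_nonneg (one_pos.trans ht).le _)
  · have hI : ∫ t in Ioi (1:ℝ), t ^ (-(x + 1)) = 1 / x := by
      rw [integral_Ioi_rpow_of_lt (by linarith) one_pos]
      simp
    rw [← hI]
    refine integral_mono_of_nonneg ?_ (integrableOn_Ioi_rpow_of_lt (by linarith) one_pos) ?_
    · refine (ae_restrict_mem measurableSet_Ioi).mono fun t ht ↦ ?_
      exact mul_nonneg (Int.fract_nonneg t) (Real.rpow_nonneg (one_pos.trans ht).le _)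
    · refine (ae_restrict_mem measurableSet_Ioi).mono fun t ht ↦ ?_
      exact mul_le_of_le_one_left (Real.rpow_nonneg (one_pos.trans ht).le _)
        (Int.fract_lt_one t).le

/-- `(x - 1) ζ(x)` is positive for real `x > 0`. -/
lemma exists_riemannZeta₁_real {x : ℝ} (hx : 0 < x) :
    ∃ r : ℝ, 0 < r ∧ riemannZeta₁ x = r := by
  obtain ⟨r, hr, h0, h1⟩ := exists_fractInt_real hx
  refine ⟨x * (1 - (x - 1) * r), ?_, ?_⟩
  · refine mul_pos hx ?_
    rw [le_div_iff₀ hx] at h1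
    nlinarith
  · rw [riemannZeta₁_eq (by simpa using hx), hr]; push_cast; ring

lemma norm_riemannZeta_ge {s : ℂ} (hs : 2 ≤ s.re) : 1 / 4 ≤ ‖riemannZeta s‖ := by
  have h1 : 1 < s.re := by linarith
  have hsum : Summable fun n : ℕ ↦ 1 / ((n:ℂ) + 1) ^ s := by
    have := (Complex.summable_one_div_nat_cpow (p := s)).mpr h1
    exact_mod_cast (summable_nat_add_iff 1).mpr this
  have hsum2 : HasSum (fun n : ℕ ↦ 1 / ((n:ℝ) + 1) ^ 2) (Real.pi ^ 2 / 6) := by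
    have := (hasSum_nat_add_iff' 1).mpr hasSum_zeta_two
    simpa using this
  have e := zeta_eq_tsum_one_div_nat_add_one_cpow h1
  rw [hsum.tsum_eq_zero_add] at e
  have h3 := (hasSum_nat_add_iff' 1).mpr hsum2
  simp only [Finset.range_one, Finset.sum_singleton, Nat.cast_zero, zero_add, one_pow, div_one,
    Nat.cast_add, Nat.cast_one] at h3
  have hb : ‖∑' n : ℕ, 1 / (((n + 1 : ℕ):ℂ) + 1) ^ s‖ ≤ Real.pi ^ 2 / 6 - 1 := by
    refine tsum_of_norm_bounded h3 fun n ↦ ?_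
    have hn : ((n + 1 : ℕ):ℂ) + 1 = ((n + 1 + 1 : ℝ) : ℂ) := by push_cast; ring
    have hp : (0:ℝ) < n + 1 + 1 := by positivity
    rw [hn, norm_div, norm_one, Complex.norm_cpow_eq_rpow_re_of_pos hp]
    refine one_div_le_one_div_of_le (by positivity) ?_
    rw [← Real.rpow_natCast]
    exact Real.rpow_le_rpow_of_exponent_le (by linarith) (by exact_mod_cast hs)
  rw [e]
  have hpi := Real.pi_lt_d2
  have hpi0 := Real.pi_pos
  have := norm_sub_le_norm_add (1 / (((0:ℕ):ℂ) + 1) ^ s)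
    (∑' n : ℕ, 1 / (((n + 1 : ℕ):ℂ) + 1) ^ s)
  simp only [Nat.cast_zero, zero_add, Complex.one_cpow, div_one, norm_one] at this
  simp only [Nat.cast_zero, zero_add, Complex.one_cpow, div_one]
  nlinarith

end Robin

namespace Robin
open Set Filter Topology MeasureTheory

/-- A holomorphic function without zeros on a disc has a holomorphic logarithm there. -/
lemma exists_eq_mul_exp_of_ball {G : ℂ → ℂ} {c : ℂ} {R : ℝ} (hR : 0 < R)
    (hG : DifferentiableOn ℂ G (Metric.ball c R)) (h0 : ∀ z ∈ Metric.ball c R, G z ≠ 0) :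
    ∃ L : ℂ → ℂ, DifferentiableOn ℂ L (Metric.ball c R) ∧ L c = 0 ∧
      ∀ z ∈ Metric.ball c R, G z = G c * Complex.exp (L z) := by
  have hd : DifferentiableOn ℂ (fun z ↦ deriv G z / G z) (Metric.ball c R) :=
    (hG.deriv Metric.isOpen_ball).div hG h0
  obtain ⟨g, hg⟩ := hd.isExactOn_ball
  have hc : c ∈ Metric.ball c R := Metric.mem_ball_self hR
  have hg' : ∀ z ∈ Metric.ball c R, HasDerivAt g (deriv G z / G z) z := hg
  have hGd : ∀ z ∈ Metric.ball c R, HasDerivAt G (deriv G z) z := fun z hz ↦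
    (hG.differentiableAt (Metric.isOpen_ball.mem_nhds hz)).hasDerivAt
  have hder : ∀ z ∈ Metric.ball c R,
      HasDerivAt (fun z ↦ G z * Complex.exp (-(g z - g c))) 0 z := by
    intro z hz
    have h := (hGd z hz).mul ((((hg' z hz).sub_const (g c)).neg).cexp)
    have e : G z * (deriv G z / G z) = deriv G z := mul_div_cancel₀ _ (h0 z hz)
    exact h.congr_deriv (by linear_combination (-Complex.exp (-(g z - g c))) * e)
  refine ⟨fun z ↦ g z - g c, fun z hz ↦ ((hg' z hz).sub_const _).differentiableAt.differentiableWithinAt,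
    sub_self _, fun z hz ↦ ?_⟩
  have hconst := Metric.isOpen_ball.is_const_of_deriv_eq_zero (𝕜 := ℂ)
    (convex_ball c R).isPreconnected
    (fun w hw ↦ (hder w hw).differentiableAt.differentiableWithinAt)
    (fun w hw ↦ (hder w hw).deriv) hz hc
  simp only [sub_self, neg_zero, Complex.exp_zero, mul_one] at hconst
  rw [← hconst, mul_assoc, ← Complex.exp_add]
  simp

/-- A quantitative lower bound for a holomorphic function without zeros on a disc. -/
lemma norm_center_le_of_ne_zero {G : ℂ → ℂ} {c z : ℂ} {R M : ℝ} (hR : 0 < R) (hM : 1 < M)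
    (hG : DifferentiableOn ℂ G (Metric.ball c R)) (h0 : ∀ z ∈ Metric.ball c R, G z ≠ 0)
    (hb : ∀ z ∈ Metric.ball c R, ‖G z‖ ≤ M * ‖G c‖) (hz : z ∈ Metric.ball c R) :
    ‖G c‖ ≤ ‖G z‖ * Real.exp (2 * Real.log M * ‖z - c‖ / (R - ‖z - c‖)) := by
  obtain ⟨L, hL, hLc, hLG⟩ := exists_eq_mul_exp_of_ball hR hG h0
  have hGc := h0 c (Metric.mem_ball_self hR)
  have hGc' : 0 < ‖G c‖ := norm_pos_iff.mpr hGc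
  have hmap : ∀ w ∈ Metric.ball (0:ℂ) R, c + w ∈ Metric.ball c R := fun w hw ↦ by
    simpa [Metric.mem_ball, dist_eq_norm] using hw
  have key := Complex.borelCaratheodory_zero (f := fun w ↦ L (c + w)) (Real.log_pos hM)
    (hL.comp (by fun_prop) hmap) (fun w hw ↦ ?_) hR
    (z := z - c) (by simpa [Metric.mem_ball, dist_eq_norm] using hz) (by simpa using hLc)
  · simp only [add_sub_cancel] at key
    have h1 := hLG z hz
    rw [h1, norm_mul, Complex.norm_exp, mul_assoc, ← Real.exp_add]
    refine le_mul_of_one_le_right hGc'.le (Real.one_le_exp ?_)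
    have := (abs_le.mp (Complex.abs_re_le_norm (L z))).1
    linarith
  · have h1 := hb _ (hmap w hw)
    rw [hLG _ (hmap w hw), norm_mul, Complex.norm_exp, mul_comm] at h1
    have h2 := le_of_mul_le_mul_right h1 hGc'
    exact (Real.le_log_iff_exp_le (by linarith)).mpr h2

lemma riemannZeta₁_ne_zero_of_re (hRH : RiemannHypothesis) {s : ℂ} (hs : 1 / 2 < s.re) :
    riemannZeta₁ s ≠ 0 := by
  intro h
  by_cases h1 : s = 1
  · rw [h1, riemannZeta₁_one] at h; exact one_ne_zero h
  · have h2 : riemannZeta s = 0 := by rw [riemannZeta_eq_inv_sub_mul h1, h, mul_zero]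
    have := hRH s h2 (fun ⟨n, hn⟩ ↦ ?_) h1
    · linarith
    · rw [hn] at hs
      have h3 : (-2 * ((n:ℂ) + 1)).re = -2 * ((n:ℝ) + 1) := by simp
      rw [h3] at hs
      have : (0:ℝ) ≤ n := n.cast_nonneg
      linarith

lemma norm_inv_riemannZeta₁_le (hRH : RiemannHypothesis) {h : ℝ} (hh : 0 < h) (hh1 : h ≤ 1) :
    ∀ w : ℂ, 1 / 2 + h ≤ w.re →
      ‖riemannZeta₁ w‖⁻¹ ≤ 4 * (12 * (‖w‖ + 5) ^ 2) ^ (6 / h) := by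
  intro w hw
  set c : ℂ := w + (3 / 2 : ℝ) with hc
  have hcre : c.re = w.re + 3 / 2 := by simp [hc]
  set R : ℝ := 3 / 2 + h / 2 with hRdef
  have hball : ∀ z ∈ Metric.ball c R, 1 / 2 < z.re ∧ ‖z‖ ≤ ‖w‖ + 4 := by
    intro z hz
    rw [Metric.mem_ball, dist_eq_norm] at hz
    have h1 := (abs_le.mp (Complex.abs_re_le_norm (z - c))).1
    rw [Complex.sub_re, hcre] at h1
    refine ⟨by linarith, ?_⟩
    have h2 : z = (z - c) + (w + (3 / 2 : ℝ)) := by rw [hc]; ring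
    have h3 : ‖((3 / 2 : ℝ) : ℂ)‖ = 3 / 2 := by rw [Complex.norm_real]; norm_num
    calc ‖z‖ ≤ ‖z - c‖ + (‖w‖ + ‖((3 / 2 : ℝ) : ℂ)‖) := by
          conv_lhs => rw [h2]
          exact (norm_add_le _ _).trans (by gcongr; exact norm_add_le _ _)
      _ ≤ _ := by rw [h3]; linarith
  have hcge : 1 / 4 ≤ ‖riemannZeta₁ c‖ := by
    have hc1 : c ≠ 1 := fun h ↦ by rw [h, Complex.one_re] at hcre; linarith
    rw [riemannZeta₁_eq_mul hc1, norm_mul]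
    have h1 := norm_riemannZeta_ge (s := c) (by linarith)
    have h2 : 1 ≤ ‖c - 1‖ := by
      have := Complex.re_le_norm (c - 1)
      rw [Complex.sub_re, hcre, Complex.one_re] at this
      linarith
    nlinarith
  have hw0 := norm_nonneg w
  have hM : 1 < 12 * (‖w‖ + 5) ^ 2 := by nlinarith
  have key := norm_center_le_of_ne_zero (G := riemannZeta₁) (c := c) (z := w) (R := R)
    (by rw [hRdef]; positivity) hM differentiable_riemannZeta₁.differentiableOn
    (fun z hz ↦ riemannZeta₁_ne_zero_of_re hRH (hball z hz).1) (fun z hz ↦ ?_) ?_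
  · have h3 : ‖w - c‖ = 3 / 2 := by
      rw [hc, sub_add_cancel_left, norm_neg, Complex.norm_real]; norm_num
    rw [h3] at key
    have h4 : 2 * Real.log (12 * (‖w‖ + 5) ^ 2) * (3 / 2) / (R - 3 / 2) =
        Real.log (12 * (‖w‖ + 5) ^ 2) * (6 / h) := by
      rw [hRdef, add_sub_cancel_left]; field_simp; ring
    rw [h4, ← Real.rpow_def_of_pos (by linarith)] at key
    have hpos : 0 < ‖riemannZeta₁ w‖ :=
      norm_pos_iff.mpr (riemannZeta₁_ne_zero_of_re hRH (by linarith))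
    rw [inv_le_iff_one_le_mul₀ hpos]
    nlinarith
  · obtain ⟨h1, h2⟩ := hball z hz
    have h3 : ‖z - 1‖ ≤ ‖w‖ + 5 := (norm_sub_le _ _).trans (by rw [norm_one]; linarith)
    have h5 : ‖z - 1‖ / z.re ≤ 2 * (‖w‖ + 5) := by
      rw [div_le_iff₀ (by linarith)]
      nlinarith [norm_nonneg (z - 1)]
    calc ‖riemannZeta₁ z‖ ≤ ‖z‖ * (1 + ‖z - 1‖ / z.re) := norm_riemannZeta₁_le (by linarith)
      _ ≤ (‖w‖ + 4) * (1 + 2 * (‖w‖ + 5)) := by gcongr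
      _ ≤ 12 * (‖w‖ + 5) ^ 2 * (1 / 4) := by nlinarith
      _ ≤ _ := by gcongr
  · rw [Metric.mem_ball, dist_eq_norm, hc, sub_add_cancel_left, norm_neg, Complex.norm_real, hRdef]
    norm_num
    exact hh

end Robin

namespace Robin
open Set Filter Topology MeasureTheory

/-- The Riemann xi function, normalised by `xi 0 = xi 1 = 1`. -/
noncomputable def xi (s : ℂ) : ℂ := s * (s - 1) * completedRiemannZeta₀ s + 1

lemma differentiable_xi : Differentiable ℂ xi := by
  unfold xi
  have := differentiable_completedZeta₀
  fun_prop

lemma xi_one_sub (s : ℂ) : xi (1 - s) = xi s := by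
  rw [xi, xi, completedRiemannZeta₀_one_sub]; ring

lemma xi_eq {s : ℂ} (hs : 0 < s.re) : xi s = s * riemannZeta₁ s * Complex.Gammaℝ s := by
  have h0 : s ≠ 0 := fun h ↦ by rw [h] at hs; simp at hs
  by_cases h1 : s = 1
  · rw [h1, riemannZeta₁_one, Complex.Gammaℝ_one, xi]; ring
  · have h2 : s - 1 ≠ 0 := sub_ne_zero.mpr h1
    have h3 : 1 - s ≠ 0 := sub_ne_zero.mpr (Ne.symm h1)
    have h4 := Complex.Gammaℝ_ne_zero_of_re_pos hs
    rw [riemannZeta₁_eq_mul h1, riemannZeta_def_of_ne_zero h0, completedRiemannZeta_eq, xi]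
    have h5 : completedRiemannZeta₀ s - 1 / s - 1 / (1 - s) =
      completedRiemannZeta₀ s - 1 / s + 1 / (s - 1) := by
      rw [← neg_sub s 1, div_neg]; ring
    rw [h5]
    field_simp
    ring

lemma Gammaℝ_conj (s : ℂ) :
    Complex.Gammaℝ ((starRingEnd ℂ) s) = (starRingEnd ℂ) (Complex.Gammaℝ s) := by
  have e1 : -(starRingEnd ℂ) s / 2 = (starRingEnd ℂ) (-s / 2) := by simp [map_ofNat]
  have e2 : (starRingEnd ℂ) s / 2 = (starRingEnd ℂ) (s / 2) := by simp [map_ofNat]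
  have e3 : (Real.pi : ℂ).arg ≠ Real.pi := by
    rw [Complex.arg_ofReal_of_nonneg Real.pi_pos.le]; exact Real.pi_pos.ne
  rw [Complex.Gammaℝ_def, Complex.Gammaℝ_def, map_mul, e1, e2, Complex.Gamma_conj,
    Complex.cpow_conj _ _ e3, Complex.conj_ofReal]

lemma riemannZeta₁_conj (s : ℂ) :
    riemannZeta₁ ((starRingEnd ℂ) s) = (starRingEnd ℂ) (riemannZeta₁ s) := by
  by_cases h1 : s = 1
  · simp [h1, riemannZeta₁_one]
  · have h2 : (starRingEnd ℂ) s ≠ 1 := fun h ↦ h1 (by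
      rw [← Complex.conj_conj s, h, map_one])
    rw [riemannZeta₁_eq_mul h1, riemannZeta₁_eq_mul h2, riemannZeta_conj]; simp

lemma xi_conj {s : ℂ} (hs : 0 < s.re) : xi ((starRingEnd ℂ) s) = (starRingEnd ℂ) (xi s) := by
  rw [xi_eq hs, xi_eq (by simpa using hs), Gammaℝ_conj, riemannZeta₁_conj]; simp

lemma xi_ne_zero (hRH : RiemannHypothesis) {s : ℂ} (hs : 1 / 2 < s.re) : xi s ≠ 0 := by
  have hs0 : 0 < s.re := by linarith
  rw [xi_eq hs0]
  refine mul_ne_zero (mul_ne_zero (fun h ↦ ?_) (riemannZeta₁_ne_zero_of_re hRH hs))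
    (Complex.Gammaℝ_ne_zero_of_re_pos hs0)
  rw [h] at hs0; simp at hs0

lemma exists_norm_Gammaℝ_le {h a : ℝ} (hh : 0 < h) (ha : 0 < a) :
    ∃ C, 0 < C ∧ ∀ s : ℂ, a ≤ s.re →
      ‖Complex.Gammaℝ s‖ ≤ C * ‖Complex.Gammaℝ (s + 2 * h)‖ := by
  have hGh : 0 < Real.Gamma h := Real.Gamma_pos_of_pos hh
  set B : ℝ := ∫ x in (0:ℝ)..1, x ^ (a / 2 - 1) * (1 - x) ^ (h - 1) with hB
  have h_int : IntervalIntegrable (fun x : ℝ ↦ x ^ (a / 2 - 1) * (1 - x) ^ (h - 1)) volume 0 1 := by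
    have := (Complex.betaIntegral_convergent (u := (a / 2 : ℝ)) (v := h)
      (by simpa using ha) (by simpa using hh)).norm
    refine this.congr_ae ?_
    rw [Set.uIoc_of_le zero_le_one]
    have : ∀ᵐ x : ℝ, x ≠ 1 := by simp [ae_iff, measure_singleton]
    filter_upwards [ae_restrict_mem measurableSet_Ioc, ae_restrict_of_ae this] with x hx hx1
    have hx1 : 0 < 1 - x := sub_pos.mpr (lt_of_le_of_ne hx.2 hx1)
    have e : (1:ℂ) - x = ((1 - x : ℝ) : ℂ) := by push_cast; rfl
    rw [norm_mul, Complex.norm_cpow_eq_rpow_re_of_pos hx.1, e,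
      Complex.norm_cpow_eq_rpow_re_of_pos hx1]
    simp
  have hB0 : 0 ≤ B := intervalIntegral.integral_nonneg zero_le_one fun x hx ↦
    mul_nonneg (Real.rpow_nonneg hx.1 _) (Real.rpow_nonneg (by linarith [hx.2]) _)
  refine ⟨Real.pi ^ h * (B + 1) / Real.Gamma h, by positivity, fun s hs ↦ ?_⟩
  have hs2 : 0 < (s / 2).re := by
    rw [show s / 2 = s / ((2:ℝ):ℂ) by simp, Complex.div_ofReal_re]; linarith
  have hs2' : a / 2 ≤ (s / 2).re := by
    rw [show s / 2 = s / ((2:ℝ):ℂ) by simp, Complex.div_ofReal_re]; linarith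
  have hbeta : ‖Complex.betaIntegral (s / 2) h‖ ≤ B := by
    rw [Complex.betaIntegral, hB]
    refine intervalIntegral.norm_integral_le_of_norm_le zero_le_one ?_ h_int
    have : ∀ᵐ x : ℝ, x ≠ 1 := by simp [ae_iff, measure_singleton]
    filter_upwards [this] with x hx1 hx
    have hx1 : 0 < 1 - x := sub_pos.mpr (lt_of_le_of_ne hx.2 hx1)
    have e : (1:ℂ) - x = ((1 - x : ℝ) : ℂ) := by push_cast; rfl
    rw [norm_mul, Complex.norm_cpow_eq_rpow_re_of_pos hx.1, e,
      Complex.norm_cpow_eq_rpow_re_of_pos hx1]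
    simp only [Complex.sub_re, Complex.ofReal_re]
    refine mul_le_mul_of_nonneg_right (Real.rpow_le_rpow_of_exponent_ge hx.1 hx.2 ?_)
      (Real.rpow_nonneg hx1.le _)
    rw [Complex.one_re]
    linarith
  have hmul := Complex.Gamma_mul_Gamma_eq_betaIntegral (s := s / 2) (t := h) hs2 (by simpa using hh)
  have hmul' := congrArg norm hmul
  rw [norm_mul, norm_mul, Complex.Gamma_ofReal, Complex.norm_real,
    Real.norm_of_nonneg hGh.le] at hmul'
  rw [Complex.Gammaℝ_def, Complex.Gammaℝ_def, norm_mul, norm_mul,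
    Complex.norm_cpow_eq_rpow_re_of_pos Real.pi_pos, Complex.norm_cpow_eq_rpow_re_of_pos Real.pi_pos]
  have e1 : (s + 2 * h) / 2 = s / 2 + h := by ring
  have e2 : (-s / 2).re = -(s / 2).re := by rw [neg_div, Complex.neg_re]
  have e3 : (-(s + 2 * h) / 2).re = -(s / 2).re - h := by
    rw [neg_div, e1, Complex.neg_re, Complex.add_re, Complex.ofReal_re]; ring
  rw [e1, e2, e3, Real.rpow_sub Real.pi_pos]
  have hp : 0 < Real.pi ^ (-(s / 2).re) := Real.rpow_pos_of_pos Real.pi_pos _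
  have hp2 : 0 < Real.pi ^ h := Real.rpow_pos_of_pos Real.pi_pos _
  calc _ = Real.pi ^ (-(s / 2).re) * (‖Complex.Gamma (s / 2)‖ * Real.Gamma h) / Real.Gamma h := by
        field_simp
    _ = Real.pi ^ (-(s / 2).re) * (‖Complex.Gamma (s / 2 + h)‖ *
          ‖Complex.betaIntegral (s / 2) h‖) / Real.Gamma h := by rw [hmul']
    _ ≤ Real.pi ^ (-(s / 2).re) * (‖Complex.Gamma (s / 2 + h)‖ * (B + 1)) / Real.Gamma h := by
        gcongr; linarith
    _ = _ := by field_simp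

end Robin

namespace Robin
open Set Filter Topology MeasureTheory

lemma norm_xi_sub_le (hRH : RiemannHypothesis) {h : ℝ} (hh : 0 < h) (hh1 : h ≤ 1 / 8) {s : ℂ}
    (hs : 1 / 2 ≤ s.re) : ‖xi (s - h)‖ ≤ ‖xi (s + h)‖ := by
  set g : ℂ → ℂ := fun z ↦ xi (1 / 2 + z - h) / xi (1 / 2 + z + h) with hg
  obtain ⟨C, hC, hCb⟩ := exists_norm_Gammaℝ_le (h := h) (a := 1 / 4) hh (by norm_num)
  have hre1 : ∀ z : ℂ, (1 / 2 + z - h).re = 1 / 2 + z.re - h := fun z ↦ by simp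
  have hre2 : ∀ z : ℂ, (1 / 2 + z + h).re = 1 / 2 + z.re + h := fun z ↦ by simp
  have hden : ∀ z : ℂ, 0 ≤ z.re → xi (1 / 2 + z + h) ≠ 0 := fun z hz ↦
    xi_ne_zero hRH (by rw [hre2]; linarith)
  have hform : ∀ z : ℂ, 0 ≤ z.re → ‖g z‖ ≤ C * (‖1 / 2 + z - h‖ * ‖1 / 2 + z + h‖⁻¹ *
      (‖riemannZeta₁ (1 / 2 + z - h)‖ * ‖riemannZeta₁ (1 / 2 + z + h)‖⁻¹)) := by
    intro z hz
    have h1 := hCb (1 / 2 + z - h) (by rw [hre1]; linarith)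
    rw [show (1 / 2 + z - h + 2 * h : ℂ) = 1 / 2 + z + h by ring] at h1
    have hG : 0 < ‖Complex.Gammaℝ (1 / 2 + z + h)‖ := norm_pos_iff.mpr
      (Complex.Gammaℝ_ne_zero_of_re_pos (by rw [hre2]; linarith))
    have h2 : 0 < ‖1 / 2 + z + h‖ := norm_pos_iff.mpr fun h0 ↦ by
      have := hre2 z; rw [h0, Complex.zero_re] at this; linarith
    have h3 : 0 < ‖riemannZeta₁ (1 / 2 + z + h)‖ := norm_pos_iff.mpr
      (riemannZeta₁_ne_zero_of_re hRH (by rw [hre2]; linarith))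
    change ‖xi (1 / 2 + z - h) / xi (1 / 2 + z + h)‖ ≤ _
    rw [xi_eq (s := 1 / 2 + z - h) (by rw [hre1]; linarith),
      xi_eq (s := 1 / 2 + z + h) (by rw [hre2]; linarith), norm_div, norm_mul,
      norm_mul, norm_mul, norm_mul, div_le_iff₀ (by positivity)]
    calc _ ≤ ‖1 / 2 + z - h‖ * ‖riemannZeta₁ (1 / 2 + z - h)‖ *
          (C * ‖Complex.Gammaℝ (1 / 2 + z + h)‖) := by gcongr
      _ = _ := by
        generalize ‖1 / 2 + z + (h:ℂ)‖ = a at h2 ⊢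
        generalize ‖riemannZeta₁ (1 / 2 + z + (h:ℂ))‖ = b at h3 ⊢
        generalize ‖1 / 2 + z - (h:ℂ)‖ = a'
        generalize ‖riemannZeta₁ (1 / 2 + z - (h:ℂ))‖ = b'
        field_simp
  have hnh : ‖(h:ℂ)‖ = h := by rw [Complex.norm_real, Real.norm_of_nonneg hh.le]
  have hN1 : ∀ z : ℂ, ‖1 / 2 + z - h‖ ≤ ‖z‖ + 1 := fun z ↦ by
    refine (norm_sub_le _ _).trans ?_
    have := norm_add_le (1 / 2 : ℂ) z
    have h2 : ‖(1 / 2 : ℂ)‖ = 1 / 2 := by norm_num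
    rw [h2] at this
    rw [hnh]; linarith
  have hN2 : ∀ z : ℂ, ‖1 / 2 + z + h‖ ≤ ‖z‖ + 1 := fun z ↦ by
    refine (norm_add_le _ _).trans ?_
    have := norm_add_le (1 / 2 : ℂ) z
    have h2 : ‖(1 / 2 : ℂ)‖ = 1 / 2 := by norm_num
    rw [h2] at this
    rw [hnh]; linarith
  set k : ℝ := 6 / h with hk
  have hk0 : 0 < k := by positivity
  have hpoly : ∀ z : ℂ, 0 ≤ z.re →
      ‖g z‖ ≤ C * 8 * Real.exp (23 * (k + 2)) * Real.exp (2 * (k + 2) * ‖z‖) := by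
    intro z hz
    refine (hform z hz).trans ?_
    set N : ℝ := ‖z‖ + 10 with hN
    have hN10 : 10 ≤ N := by linarith [norm_nonneg z]
    have h1 : ‖1 / 2 + z - h‖ ≤ N := (hN1 z).trans (by linarith)
    have h2 : ‖1 / 2 + z + h‖⁻¹ ≤ 2 := by
      have h2 : 1 / 2 ≤ ‖1 / 2 + z + h‖ := by
        have := Complex.re_le_norm (1 / 2 + z + h); rw [hre2] at this; linarith
      calc _ ≤ (1 / 2 : ℝ)⁻¹ := by gcongr
        _ = 2 := by norm_num
    have h3 : ‖riemannZeta₁ (1 / 2 + z - h)‖ ≤ N * (1 + 4 * N) := by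
      refine (norm_riemannZeta₁_le (by rw [hre1]; linarith)).trans ?_
      have h3 : ‖1 / 2 + z - h - 1‖ / (1 / 2 + z - h).re ≤ 4 * N := by
        rw [div_le_iff₀ (by rw [hre1]; linarith), hre1]
        have := norm_sub_le (1 / 2 + z - h : ℂ) 1
        rw [norm_one] at this
        have := hN1 z
        nlinarith
      exact mul_le_mul h1 (by linarith) (by
        have : 0 ≤ (1 / 2 + z - h).re := by rw [hre1]; linarith
        positivity) (by linarith)
    have h4 : ‖riemannZeta₁ (1 / 2 + z + h)‖⁻¹ ≤ 4 * (12 * N ^ 2) ^ k := by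
      refine (norm_inv_riemannZeta₁_le hRH hh (by linarith) _ (by rw [hre2]; linarith)).trans ?_
      gcongr
      linarith [hN2 z]
    have h5 : 12 * N ^ 2 ≤ Real.exp (3 + 2 * N) := by
      rw [Real.exp_add, two_mul, Real.exp_add, sq]
      have h6 : N ≤ Real.exp N := by linarith [Real.add_one_le_exp N]
      have h7 : 12 ≤ Real.exp 3 := by
        have := Real.exp_one_gt_d9
        have h8 : Real.exp 3 = Real.exp 1 ^ 3 := by rw [← Real.exp_nat_mul]; norm_num
        rw [h8]
        calc (12:ℝ) ≤ 2.7 ^ 3 := by norm_num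
          _ ≤ _ := by gcongr; linarith
      gcongr
    calc _ ≤ C * (N * 2 * (N * (1 + 4 * N) * (4 * (12 * N ^ 2) ^ k))) := by gcongr
      _ = C * 8 * (N ^ 2 * (1 + 4 * N)) * (12 * N ^ 2) ^ k := by ring
      _ ≤ C * 8 * (12 * N ^ 2) ^ 2 * (12 * N ^ 2) ^ k := by
        gcongr
        nlinarith [mul_nonneg (show 0 ≤ N by linarith) (sq_nonneg N)]
      _ = C * 8 * (12 * N ^ 2) ^ (k + 2) := by
        rw [Real.rpow_add (by positivity)]; norm_num; ring
      _ ≤ C * 8 * (Real.exp (3 + 2 * N)) ^ (k + 2) := by gcongr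
      _ = _ := by
        rw [← Real.exp_mul, mul_assoc _ (Real.exp _) (Real.exp _), ← Real.exp_add, hN]; ring_nf
  have hreal : ∀ x : ℝ, 2 ≤ x → ‖g x‖ ≤ C * 16 := by
    intro x hx
    refine (hform x (by simp; linarith)).trans ?_
    have e1 : (1 / 2 + x - h : ℂ) = ((1 / 2 + x - h : ℝ) : ℂ) := by push_cast; rfl
    have e2 : (1 / 2 + x + h : ℂ) = ((1 / 2 + x + h : ℝ) : ℂ) := by push_cast; rfl
    have h3 := norm_riemannZeta₁_le (s := ((1 / 2 + x - h : ℝ) : ℂ))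
      (by rw [Complex.ofReal_re]; linarith)
    have h4 := norm_riemannZeta_ge (s := ((1 / 2 + x + h : ℝ) : ℂ))
      (by rw [Complex.ofReal_re]; linarith)
    have hne : ((1 / 2 + x + h : ℝ) : ℂ) ≠ 1 := by
      norm_cast; intro h0; linarith
    rw [e1, e2, riemannZeta₁_eq_mul hne, norm_mul, ← Complex.ofReal_one, ← Complex.ofReal_sub]
    rw [← Complex.ofReal_one, ← Complex.ofReal_sub, Complex.norm_real, Complex.norm_real,
      Complex.ofReal_re,
      Real.norm_of_nonneg (by linarith), Real.norm_of_nonneg (by linarith)] at h3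
    rw [Complex.norm_real, Complex.norm_real, Complex.norm_real, Real.norm_of_nonneg (by linarith),
      Real.norm_of_nonneg (by linarith), Real.norm_of_nonneg (by linarith)]
    set z1 := ‖riemannZeta₁ ((1 / 2 + x - h : ℝ) : ℂ)‖
    set z2 := ‖riemannZeta ((1 / 2 + x + h : ℝ) : ℂ)‖
    have h5 : z1 ≤ 2 * (1 / 2 + x + h) := by
      have : (1 / 2 + x - h - 1) / (1 / 2 + x - h) ≤ 1 := by
        rw [div_le_one (by linarith)]; linarith
      nlinarith
    gcongr
    rw [mul_comm, ← div_eq_mul_inv, ← div_eq_mul_inv, div_mul_div_comm,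
      div_le_iff₀ (by apply mul_pos; apply mul_pos <;> linarith; linarith)]
    have hp : 0 ≤ (1 / 2 + x + h - 1) := by linarith
    calc z1 * (1 / 2 + x - h) ≤ (2 * (1 / 2 + x + h)) * (1 / 2 + x + h) :=
          mul_le_mul h5 (by linarith) (by linarith) (by linarith)
      _ ≤ 16 * ((1 / 2 + x + h - 1) * (1 / 4) * (1 / 2 + x + h)) := by nlinarith
      _ ≤ _ := by gcongr
  have him : ∀ x : ℝ, ‖g (x * Complex.I)‖ ≤ 1 := by
    intro x
    have e : (1 / 2 + x * Complex.I - h : ℂ) =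
        1 - (starRingEnd ℂ) (1 / 2 + x * Complex.I + h) := by
      simp [map_ofNat]; ring
    rw [hg]
    simp only
    rw [e, xi_one_sub, xi_conj (by rw [hre2]; simp; linarith), norm_div, RCLike.norm_conj]
    exact div_self_le_one _
  have hdiff : DiffContOnCl ℂ g {z | 0 < z.re} := by
    refine DifferentiableOn.diffContOnCl fun z hz ↦ ?_
    have hz' : 0 ≤ z.re := by
      have : closure {z : ℂ | 0 < z.re} = {z | 0 ≤ z.re} := Complex.closure_setOfPred_lt_re 0
      rw [this] at hz; exact hz
    refine DifferentiableAt.differentiableWithinAt (DifferentiableAt.div ?_ ?_ (hden z hz'))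
    · exact differentiable_xi.differentiableAt.comp z (by fun_prop)
    · exact differentiable_xi.differentiableAt.comp z (by fun_prop)
  have hfin := PhragmenLindelof.right_half_plane_of_bounded_on_real (C := 1) (z := s - 1 / 2) hdiff
    ⟨1, by norm_num, 2 * (k + 2), ?_⟩ ?_ him (by simpa using hs)
  · rw [hg] at hfin
    simp only at hfin
    rw [show (1 / 2 + (s - 1 / 2) : ℂ) = s by ring, norm_div] at hfin
    have : 0 < ‖xi (s + h)‖ := norm_pos_iff.mpr (xi_ne_zero hRH (by simp; linarith))
    rwa [div_le_one this] at hfin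
  · refine Asymptotics.IsBigO.of_bound (C * 8 * Real.exp (23 * (k + 2))) ?_
    rw [eventually_inf_principal]
    refine Eventually.of_forall fun z hz ↦ ?_
    rw [Real.norm_of_nonneg (Real.exp_pos _).le, Real.rpow_one]
    exact hpoly z (le_of_lt hz)
  · exact isBoundedUnder_of_eventually_le (a := C * 16)
      ((eventually_ge_atTop 2).mono fun x hx ↦ hreal x hx)

end Robin

namespace Robin
open Set Filter Topology MeasureTheory

/-- The logarithmic derivative of `xi`. -/
noncomputable def xiLog (s : ℂ) : ℂ := deriv xi s / xi s

lemma re_xiLog_nonneg (hRH : RiemannHypothesis) {s : ℂ} (hs : 1 / 2 < s.re) :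
    0 ≤ (xiLog s).re := by
  have hd : HasDerivAt xi (deriv xi s) s := differentiable_xi.differentiableAt.hasDerivAt
  have hd1 : HasDerivAt (fun h : ℝ ↦ xi (s + h)) (deriv xi s) 0 := by
    have h1 : HasDerivAt (fun h : ℝ ↦ s + (h:ℂ)) 1 0 :=
      Complex.ofRealCLM.hasDerivAt.const_add s
    have h2 : HasDerivAt xi (deriv xi s) (s + ((0:ℝ):ℂ)) := by simpa using hd
    simpa [Function.comp_def] using h2.comp (0:ℝ) h1
  have hd2 : HasDerivAt (fun h : ℝ ↦ xi (s - h)) (-deriv xi s) 0 := by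
    have h1 : HasDerivAt (fun h : ℝ ↦ s - (h:ℂ)) (-1) 0 :=
      Complex.ofRealCLM.hasDerivAt.const_sub s
    have h2 : HasDerivAt xi (deriv xi s) (s - ((0:ℝ):ℂ)) := by simpa using hd
    simpa [Function.comp_def] using h2.comp (0:ℝ) h1
  have hder := hd1.norm_sq.sub hd2.norm_sq
  have hnn : 0 ≤ 2 * inner ℝ (xi (s + (0:ℝ))) (deriv xi s) -
      2 * inner ℝ (xi (s - (0:ℝ))) (-deriv xi s) := by
    have ht := hder.tendsto_slope.mono_left (nhdsGT_le_nhdsNE (0:ℝ))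
    refine ge_of_tendsto ht ?_
    filter_upwards [Ioc_mem_nhdsGT (show (0:ℝ) < 1 / 8 by norm_num)] with h hh
    rw [slope_def_field]
    have := norm_xi_sub_le hRH hh.1 hh.2 hs.le
    simp only [Pi.sub_apply, Complex.ofReal_zero, add_zero, sub_zero, sub_self]
    refine div_nonneg ?_ hh.1.le
    nlinarith [norm_nonneg (xi (s - h))]
  simp only [Complex.ofReal_zero, add_zero, sub_zero, inner_neg_right] at hnn
  rw [Complex.inner] at hnn
  rw [xiLog, div_eq_mul_inv, Complex.inv_def, ← mul_assoc, Complex.re_mul_ofReal]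
  refine mul_nonneg ?_ (inv_nonneg.mpr (Complex.normSq_nonneg _))
  linarith

lemma norm_sub_le_norm_add {F : ℂ} {c : ℝ} (hc : 0 ≤ c) (hF : 0 ≤ F.re) : ‖F - c‖ ≤ ‖F + c‖ := by
  rw [← sq_le_sq₀ (norm_nonneg _) (norm_nonneg _), Complex.sq_norm, Complex.sq_norm,
    Complex.normSq_apply, Complex.normSq_apply]
  simp
  nlinarith [mul_nonneg hc hF]

/-- The Schwarz–Pick inequality for a function of positive real part in a half-plane. -/
lemma schwarz_pick_half_plane {F : ℂ → ℂ} {c k : ℝ} (hc : 0 < c) (hk : 0 < k)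
    (hF : DifferentiableOn ℂ F {z | 0 < z.re}) (hF0 : ∀ z, 0 < z.re → 0 ≤ (F z).re)
    (hFk : F k = c) {z : ℂ} (hz : 0 < z.re) :
    ‖(F z - c) * (z + k)‖ ≤ ‖(F z + c) * (z - k)‖ := by
  have hadd : ∀ z : ℂ, 0 < z.re → F z + c ≠ 0 := fun z hz h ↦ by
    have := congrArg Complex.re h
    rw [Complex.add_re, Complex.ofReal_re, Complex.zero_re] at this
    linarith [hF0 z hz]
  set T : ℂ → ℂ := fun w ↦ k * (1 + w) / (1 - w) with hT
  have hT1 : ∀ w ∈ Metric.ball (0:ℂ) 1, 1 - w ≠ 0 := fun w hw h ↦ by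
    rw [sub_eq_zero] at h; rw [← h] at hw; simp at hw
  have hTre : ∀ w ∈ Metric.ball (0:ℂ) 1, 0 < (T w).re := by
    intro w hw
    have h1 := hT1 w hw
    rw [mem_ball_zero_iff] at hw
    have h2 : 0 < Complex.normSq (1 - w) := Complex.normSq_pos.mpr h1
    rw [hT]
    simp only
    rw [mul_div_assoc, Complex.re_ofReal_mul, Complex.div_re, ← add_div]
    refine mul_pos hk (div_pos ?_ h2)
    have h3 : ‖w‖ ^ 2 < 1 := by nlinarith [norm_nonneg w]
    rw [Complex.sq_norm, Complex.normSq_apply] at h3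
    simp
    nlinarith
  set G : ℂ → ℂ := fun w ↦ (F (T w) - c) / (F (T w) + c) with hG
  have hTd : DifferentiableOn ℂ T (Metric.ball 0 1) :=
    DifferentiableOn.div (by fun_prop) (by fun_prop) hT1
  have hFT : DifferentiableOn ℂ (fun w ↦ F (T w)) (Metric.ball 0 1) := hF.comp hTd hTre
  have hGd : DifferentiableOn ℂ G (Metric.ball 0 1) :=
    (hFT.sub_const _).div (hFT.add_const _) fun w hw ↦ hadd _ (hTre w hw)
  have hGm : MapsTo G (Metric.ball 0 1) (Metric.closedBall 0 1) := by
    intro w hw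
    rw [mem_closedBall_zero_iff, hG, norm_div]
    exact div_le_one_of_le₀ (norm_sub_le_norm_add hc.le (hF0 _ (hTre w hw))) (norm_nonneg _)
  have hG0 : G 0 = 0 := by simp [hG, hT, hFk]
  have hzk : z + k ≠ 0 := fun h ↦ by
    have := congrArg Complex.re h
    rw [Complex.add_re, Complex.ofReal_re, Complex.zero_re] at this
    linarith
  have hw : ‖(z - k) / (z + k)‖ < 1 := by
    rw [norm_div, div_lt_one (norm_pos_iff.mpr hzk), ← sq_lt_sq₀ (norm_nonneg _) (norm_nonneg _),
      Complex.sq_norm, Complex.sq_norm, Complex.normSq_apply, Complex.normSq_apply]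
    simp
    nlinarith [mul_pos hk hz]
  have key := Complex.norm_le_norm_of_mapsTo_ball hGd hGm hG0 hw
  have hTz : T ((z - k) / (z + k)) = z := by
    have hk0 : (k:ℂ) ≠ 0 := Complex.ofReal_ne_zero.mpr hk.ne'
    have e1 : 1 + (z - k) / (z + k) = 2 * z / (z + k) := by field_simp; ring
    have e2 : 1 - (z - k) / (z + k) = 2 * k / (z + k) := by field_simp; ring
    rw [hT]; simp only; rw [e1, e2]; field_simp
  rw [hG] at key
  simp only [hTz] at key
  rw [norm_div, norm_div, div_le_div_iff₀ (norm_pos_iff.mpr (hadd z hz))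
    (norm_pos_iff.mpr hzk)] at key
  rw [norm_mul, norm_mul]
  linarith

lemma re_inv_nonneg {w : ℂ} (h : 0 ≤ w.re) : 0 ≤ (w⁻¹).re := by
  rw [Complex.inv_re]; exact div_nonneg h (Complex.normSq_nonneg _)

lemma re_richards_nonneg {F : ℂ → ℂ} {c k : ℝ} (hc : 0 < c) (hk : 0 < k)
    (hF : DifferentiableOn ℂ F {z | 0 < z.re}) (hF0 : ∀ z, 0 < z.re → 0 ≤ (F z).re)
    (hFk : F k = c) {z : ℂ} (hz : 0 < z.re) (hzk : z ≠ k) :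
    0 ≤ ((z * c - k * F z) / (z ^ 2 - k ^ 2)).re := by
  have hsp := schwarz_pick_half_plane hc hk hF hF0 hFk hz
  have hQ : F z + c ≠ 0 := fun h ↦ by
    have := congrArg Complex.re h
    rw [Complex.add_re, Complex.ofReal_re, Complex.zero_re] at this
    linarith [hF0 z hz]
  have hn : z + k ≠ 0 := fun h ↦ by
    have := congrArg Complex.re h
    rw [Complex.add_re, Complex.ofReal_re, Complex.zero_re] at this
    linarith
  have hm : z - k ≠ 0 := sub_ne_zero.mpr hzk
  have hmQ : (F z + c) * (z - k) ≠ 0 := mul_ne_zero hQ hm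
  set q : ℂ := (F z - c) * (z + k) / ((F z + c) * (z - k)) with hq
  have hq1 : ‖q‖ ≤ 1 := by
    rw [hq, norm_div]; exact div_le_one_of_le₀ hsp (norm_nonneg _)
  have hqm : q * ((F z + c) * (z - k)) = (F z - c) * (z + k) := by
    rw [hq]; field_simp
  have hmn : z ^ 2 - k ^ 2 = (z + k) * (z - k) := by ring
  by_cases hq0 : q = 1
  · rw [hq0] at hqm
    have : z * c - k * F z = 0 := by linear_combination (1 / 2 : ℂ) * hqm
    rw [this]; simp
  · have h1q : 1 - q ≠ 0 := sub_ne_zero.mpr (Ne.symm hq0)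
    set W : ℂ := z + k * ((1 + q) / (1 - q)) with hW
    have hre : 0 ≤ ((1 + q) / (1 - q)).re := by
      rw [Complex.div_re, ← add_div]
      refine div_nonneg ?_ (Complex.normSq_nonneg _)
      have h3 : ‖q‖ ^ 2 ≤ 1 := by nlinarith [norm_nonneg q]
      rw [Complex.sq_norm, Complex.normSq_apply] at h3
      simp
      nlinarith
    have hWre : 0 < W.re := by
      rw [hW, Complex.add_re, Complex.re_ofReal_mul]
      have := mul_nonneg hk.le hre
      linarith
    have hW0 : W ≠ 0 := fun h ↦ by rw [h, Complex.zero_re] at hWre; exact lt_irrefl _ hWre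
    have key : (z * c - k * F z) / (z ^ 2 - k ^ 2) = c * W⁻¹ := by
      rw [hmn, ← div_eq_mul_inv, div_eq_div_iff (mul_ne_zero hn hm) hW0]
      have hW' : W * (1 - q) = z * (1 - q) + k * (1 + q) := by
        rw [hW]; field_simp
      refine mul_right_cancel₀ h1q ?_
      rw [mul_assoc, hW']
      clear_value q
      linear_combination (k:ℂ) * hqm
    rw [key, Complex.re_ofReal_mul]
    exact mul_nonneg hc.le (re_inv_nonneg hWre.le)

end Robin

namespace Robin
open Set Filter Topology MeasureTheory

/-- **Carathéodory's coefficient inequality**: Taylor coefficients of a holomorphic function with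
nonnegative real part. -/
lemma norm_iteratedDeriv_le_of_re_nonneg {f : ℂ → ℂ} {c : ℂ} {r : ℝ} {n : ℕ} (hn : n ≠ 0)
    (hr : 0 < r) (hf : DiffContOnCl ℂ f (Metric.ball c r))
    (h0 : ∀ z ∈ Metric.sphere c r, 0 ≤ (f z).re) :
    ‖iteratedDeriv n f c‖ ≤ n.factorial * (2 * (f c).re / r ^ n) := by
  have hfc : ContinuousOn f (Metric.sphere c |r|) := by
    rw [abs_of_pos hr]
    exact hf.continuousOn.mono (by rw [closure_ball _ hr.ne']; exact Metric.sphere_subset_closedBall)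
  have hzc : ∀ z ∈ Metric.sphere c |r|, z - c ≠ 0 := fun z hz h ↦ by
    rw [mem_sphere_iff_norm, h, norm_zero, abs_of_pos hr] at hz
    exact hr.ne hz
  have hi0 : CircleIntegrable f c r := hfc.circleIntegrable'
  have hcpow : ContinuousOn (fun z : ℂ ↦ ((z - c)⁻¹) ^ n) (Metric.sphere c |r|) :=
    ContinuousOn.pow (ContinuousOn.inv₀ (by fun_prop) hzc) n
  have hi1 : CircleIntegrable (fun z ↦ ((z - c)⁻¹) ^ n * f z) c r :=
    (hcpow.mul hfc).circleIntegrable'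
  have hi2 : CircleIntegrable (fun z ↦ ((z - c)⁻¹) ^ n * (starRingEnd ℂ) (f z)) c r :=
    (hcpow.mul (Complex.continuous_conj.comp_continuousOn hfc)).circleIntegrable'
  have hcoef : iteratedDeriv n f c =
      n.factorial * Real.circleAverage (fun z ↦ ((z - c)⁻¹) ^ n * f z) c r := by
    rw [Real.circleAverage_eq_circleIntegral hr.ne']
    have h1 := DiffContOnCl.circleIntegral_one_div_sub_center_pow_smul hr n hf
    have h2 : (∮ z in C(c, r), (z - c)⁻¹ • (((z - c)⁻¹) ^ n * f z)) =
        ∮ z in C(c, r), (1 / (z - c) ^ (n + 1)) • f z := by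
      congr 1; ext z; rw [smul_eq_mul, smul_eq_mul, ← mul_assoc, ← pow_succ', one_div, inv_pow]
    rw [h2, h1, smul_eq_mul, smul_eq_mul]
    have : (n.factorial : ℂ) ≠ 0 := Nat.cast_ne_zero.mpr n.factorial_ne_zero
    have h3 : (2 * Real.pi * Complex.I : ℂ) ≠ 0 := by simp [Real.pi_ne_zero]
    field_simp
  have hmv : Real.circleAverage (fun z ↦ (z - c) ^ n * f z) c r = 0 := by
    have : DiffContOnCl ℂ (fun z ↦ (z - c) ^ n * f z) (Metric.ball c |r|) := by
      rw [abs_of_pos hr]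
      have : DiffContOnCl ℂ (fun z : ℂ ↦ (z - c) ^ n) (Metric.ball c r) :=
        Differentiable.diffContOnCl (by fun_prop)
      exact this.smul hf
    rw [this.circleAverage]
    simp [hn]
  have hconj : Real.circleAverage (fun z ↦ ((z - c)⁻¹) ^ n * (starRingEnd ℂ) (f z)) c r = 0 := by
    have h1 : Real.circleAverage (fun z ↦ ((z - c)⁻¹) ^ n * (starRingEnd ℂ) (f z)) c r =
        Real.circleAverage (fun z ↦ ((r ^ 2) ^ n)⁻¹ • (starRingEnd ℂ) ((z - c) ^ n * f z)) c r := by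
      refine Real.circleAverage_congr_sphere fun z hz ↦ ?_
      have hz0 := hzc z hz
      rw [mem_sphere_iff_norm, abs_of_pos hr] at hz
      have : (z - c)⁻¹ = (starRingEnd ℂ) (z - c) * ((r ^ 2 : ℝ) : ℂ)⁻¹ := by
        rw [Complex.inv_def, Complex.normSq_eq_norm_sq, hz, Complex.ofReal_inv]
      simp only [this]
      rw [Complex.real_smul, map_mul, map_pow]
      push_cast
      rw [mul_pow, inv_pow]
      ring
    have hi3 : CircleIntegrable (fun z ↦ (z - c) ^ n * f z) c r :=
      (ContinuousOn.mul (by fun_prop) hfc).circleIntegrable'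
    rw [h1, Real.circleAverage_fun_smul]
    have := ContinuousLinearMap.circleAverage_comp_comm (Complex.conjCLE : ℂ →L[ℝ] ℂ) hi3
    rw [hmv, map_zero] at this
    have h4 : Real.circleAverage (fun z ↦ (starRingEnd ℂ) ((z - c) ^ n * f z)) c r = 0 := this
    rw [h4, smul_zero]
  have hre : Real.circleAverage (fun z ↦ (f z).re) c r = (f c).re := by
    have := ContinuousLinearMap.circleAverage_comp_comm Complex.reCLM hi0
    rw [(show DiffContOnCl ℂ f (Metric.ball c |r|) by rwa [abs_of_pos hr]).circleAverage] at this
    exact this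
  have hsum : Real.circleAverage (fun z ↦ ((z - c)⁻¹) ^ n * f z) c r =
      Real.circleAverage (fun z ↦ ((z - c)⁻¹) ^ n * (2 * (f z).re : ℝ)) c r := by
    rw [← add_zero (Real.circleAverage (fun z ↦ ((z - c)⁻¹) ^ n * f z) c r), ← hconj,
      ← Real.circleAverage_fun_add hi1 hi2]
    congr 1; ext z
    rw [← mul_add, Complex.add_conj]
  have hbound : ‖Real.circleAverage (fun z ↦ ((z - c)⁻¹) ^ n * (2 * (f z).re : ℝ)) c r‖ ≤
      2 * (f c).re / r ^ n := by
    rw [← hre, Real.circleAverage_def, Real.circleAverage_def, norm_smul, smul_eq_mul,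
      Real.norm_of_nonneg (by positivity)]
    have h1 : ‖∫ θ in (0:ℝ)..2 * Real.pi, ((circleMap c r θ - c)⁻¹) ^ n *
        ((2 * (f (circleMap c r θ)).re : ℝ) : ℂ)‖ ≤
        ∫ θ in (0:ℝ)..2 * Real.pi, (2 / r ^ n) * (f (circleMap c r θ)).re := by
      refine intervalIntegral.norm_integral_le_of_norm_le Real.two_pi_pos.le
        (Eventually.of_forall fun θ _ ↦ ?_) ?_
      · have := h0 (circleMap c r θ) (circleMap_mem_sphere c hr.le θ)
        rw [norm_mul, norm_pow, norm_inv, circleMap_sub_center, norm_circleMap_zero,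
          abs_of_pos hr, Complex.norm_real, Real.norm_of_nonneg (by positivity)]
        apply le_of_eq; rw [inv_pow]; ring
      · have : CircleIntegrable (fun z ↦ (f z).re) c r :=
          (Complex.continuous_re.comp_continuousOn hfc).circleIntegrable'
        exact IntervalIntegrable.const_mul this _
    rw [intervalIntegral.integral_const_mul] at h1
    calc _ ≤ (2 * Real.pi)⁻¹ * _ := mul_le_mul_of_nonneg_left h1 (by positivity)
      _ = _ := by ring
  rw [hcoef, norm_mul, Complex.norm_natCast, hsum]
  gcongr

end Robin

namespace Robin

open Set Filter Topology MeasureTheory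

/-- The Laplace transform of a real function on the positive half-line. -/
noncomputable def lap (a : ℝ → ℝ) (z : ℂ) : ℂ :=
  ∫ u in Ioi (0 : ℝ), (a u : ℂ) * Complex.exp (-z * u)

/-- The Laplace integral of `a` converges absolutely to the right of `σ₀`. -/
def LapInt (a : ℝ → ℝ) (σ₀ : ℝ) : Prop :=
  ∀ σ > σ₀, IntegrableOn (fun u ↦ a u * Real.exp (-σ * u)) (Ioi 0)

lemma norm_ofReal_mul_cexp (x u : ℝ) (z : ℂ) :
    ‖(x : ℂ) * Complex.exp (-z * u)‖ = |x| * Real.exp (-z.re * u) := by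
  rw [norm_mul, Complex.norm_real, Complex.norm_exp, Real.norm_eq_abs]
  simp

lemma IntegrableOn.aesm_of_mul_exp {a : ℝ → ℝ} {σ : ℝ} {s : Set ℝ}
    (h : IntegrableOn (fun u ↦ a u * Real.exp (-σ * u)) s) :
    AEStronglyMeasurable a (volume.restrict s) := by
  have h2 : AEStronglyMeasurable (fun u : ℝ ↦ Real.exp (σ * u)) (volume.restrict s) := by
    fun_prop
  refine (h.aestronglyMeasurable.mul h2).congr (Eventually.of_forall fun u ↦ ?_)
  simp [mul_assoc, ← Real.exp_add]

lemma integrableOn_lap_of {a : ℝ → ℝ} {z : ℂ}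
    (ha : IntegrableOn (fun u ↦ a u * Real.exp (-z.re * u)) (Ioi 0)) :
    IntegrableOn (fun u : ℝ ↦ (a u : ℂ) * Complex.exp (-z * u)) (Ioi 0) := by
  have h1 : AEStronglyMeasurable (fun u : ℝ ↦ (a u : ℂ)) (volume.restrict (Ioi 0)) :=
    Complex.continuous_ofReal.comp_aestronglyMeasurable (IntegrableOn.aesm_of_mul_exp ha)
  refine Integrable.mono ha (h1.mul (by fun_prop)) (Eventually.of_forall fun u ↦ ?_)
  rw [norm_ofReal_mul_cexp, norm_mul, Real.norm_eq_abs, Real.norm_eq_abs, Real.abs_exp]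

lemma LapInt.integrableOn {a : ℝ → ℝ} {σ₀ : ℝ} (ha : LapInt a σ₀) {z : ℂ} (hz : σ₀ < z.re) :
    IntegrableOn (fun u : ℝ ↦ (a u : ℂ) * Complex.exp (-z * u)) (Ioi 0) :=
  integrableOn_lap_of (ha _ hz)

lemma LapInt.mono {a : ℝ → ℝ} {σ₀ σ₁ : ℝ} (ha : LapInt a σ₀) (h : σ₀ ≤ σ₁) : LapInt a σ₁ :=
  fun σ hσ ↦ ha σ (h.trans_lt hσ)

lemma LapInt.add {a b : ℝ → ℝ} {σ₀ : ℝ} (ha : LapInt a σ₀) (hb : LapInt b σ₀) :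
    LapInt (fun u ↦ a u + b u) σ₀ := fun σ hσ ↦
  ((ha σ hσ).add (hb σ hσ)).congr_fun (fun _ _ ↦ (add_mul _ _ _).symm) measurableSet_Ioi

lemma LapInt.sub {a b : ℝ → ℝ} {σ₀ : ℝ} (ha : LapInt a σ₀) (hb : LapInt b σ₀) :
    LapInt (fun u ↦ a u - b u) σ₀ := fun σ hσ ↦
  ((ha σ hσ).sub (hb σ hσ)).congr_fun (fun _ _ ↦ (sub_mul _ _ _).symm) measurableSet_Ioi

lemma LapInt.const_mul {a : ℝ → ℝ} {σ₀ : ℝ} (ha : LapInt a σ₀) (c : ℝ) :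
    LapInt (fun u ↦ c * a u) σ₀ := fun σ hσ ↦
  IntegrableOn.congr_fun (Integrable.const_mul (ha σ hσ) c) (fun _ _ ↦ (mul_assoc _ _ _).symm)
    measurableSet_Ioi

lemma lap_add {a b : ℝ → ℝ} {σ₀ : ℝ} (ha : LapInt a σ₀) (hb : LapInt b σ₀) {z : ℂ}
    (hz : σ₀ < z.re) : lap (fun u ↦ a u + b u) z = lap a z + lap b z := by
  simp only [lap, Complex.ofReal_add, add_mul]
  exact integral_add (ha.integrableOn hz) (hb.integrableOn hz)

lemma lap_sub {a b : ℝ → ℝ} {σ₀ : ℝ} (ha : LapInt a σ₀) (hb : LapInt b σ₀) {z : ℂ}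
    (hz : σ₀ < z.re) : lap (fun u ↦ a u - b u) z = lap a z - lap b z := by
  simp only [lap, Complex.ofReal_sub, sub_mul]
  exact integral_sub (ha.integrableOn hz) (hb.integrableOn hz)

lemma lap_const_mul (a : ℝ → ℝ) (c : ℝ) (z : ℂ) : lap (fun u ↦ c * a u) z = c * lap a z := by
  simp only [lap, Complex.ofReal_mul, mul_assoc]
  exact integral_const_mul _ _

lemma lap_congr {a b : ℝ → ℝ} (h : ∀ u, 0 < u → a u = b u) (z : ℂ) : lap a z = lap b z :=
  setIntegral_congr_fun measurableSet_Ioi fun u hu ↦ by simp only [h u hu]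

lemma LapInt.congr {a b : ℝ → ℝ} {σ₀ : ℝ} (ha : LapInt a σ₀) (h : ∀ u, 0 < u → a u = b u) :
    LapInt b σ₀ := fun σ hσ ↦
  (ha σ hσ).congr_fun (fun u hu ↦ by simp only [h u hu]) measurableSet_Ioi

lemma LapInt.of_le {a b : ℝ → ℝ} {σ₀ : ℝ} (ha : LapInt a σ₀)
    (hm : AEStronglyMeasurable b (volume.restrict (Ioi 0)))
    (h : ∀ u, 0 < u → |b u| ≤ |a u|) : LapInt b σ₀ := fun σ hσ ↦ by
  refine Integrable.mono (ha σ hσ) (hm.mul (by fun_prop)) ?_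
  filter_upwards [ae_restrict_mem measurableSet_Ioi] with u hu
  rw [norm_mul, norm_mul, Real.norm_eq_abs, Real.norm_eq_abs]
  gcongr
  exact h u hu

lemma lap_ofReal (a : ℝ → ℝ) (s : ℝ) :
    lap a s = ((∫ u in Ioi (0 : ℝ), a u * Real.exp (-s * u) : ℝ) : ℂ) := by
  rw [lap, ← integral_complex_ofReal]
  congr 1 with u
  push_cast
  rfl

lemma mul_exp_le {δ u : ℝ} (hδ : 0 < δ) : u ≤ Real.exp (δ * u) / δ := by
  rw [le_div_iff₀ hδ]
  nlinarith [Real.add_one_le_exp (δ * u)]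

lemma LapInt.mul_id {a : ℝ → ℝ} {σ₀ : ℝ} (ha : LapInt a σ₀) : LapInt (fun u ↦ u * a u) σ₀ := by
  intro σ hσ
  obtain ⟨τ, h1, h2⟩ := exists_between hσ
  have hδ : 0 < σ - τ := by linarith
  have hm := IntegrableOn.aesm_of_mul_exp (ha σ hσ)
  refine Integrable.mono ((ha τ h1).const_mul (1 / (σ - τ)))
    ((AEStronglyMeasurable.mul (by fun_prop) hm).mul (by fun_prop)) ?_
  filter_upwards [ae_restrict_mem measurableSet_Ioi] with u hu
  have hu : 0 < u := hu
  have h3 := mul_exp_le (u := u) hδ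
  simp only [norm_mul, Real.norm_eq_abs, Real.abs_exp, abs_of_pos hu,
    abs_of_pos (one_div_pos.2 hδ)]
  have h4 : Real.exp (-τ * u) = Real.exp ((σ - τ) * u) * Real.exp (-σ * u) := by
    rw [← Real.exp_add]; ring_nf
  rw [h4]
  calc u * |a u| * Real.exp (-σ * u)
      ≤ (Real.exp ((σ - τ) * u) / (σ - τ)) * |a u| * Real.exp (-σ * u) := by gcongr
    _ = _ := by ring

lemma LapInt.pow_mul {a : ℝ → ℝ} {σ₀ : ℝ} (ha : LapInt a σ₀) (n : ℕ) :
    LapInt (fun u ↦ u ^ n * a u) σ₀ := by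
  induction n with
  | zero => simpa using ha
  | succ n ih => exact ih.mul_id.congr fun u _ ↦ by ring

lemma hasDerivAt_lap {a : ℝ → ℝ} {σ₀ : ℝ} (ha : LapInt a σ₀) {z : ℂ} (hz : σ₀ < z.re) :
    HasDerivAt (lap a) (-lap (fun u ↦ u * a u) z) z := by
  obtain ⟨τ, h1, h2⟩ := exists_between hz
  have hs : {w : ℂ | τ < w.re} ∈ 𝓝 z :=
    (isOpen_lt continuous_const Complex.continuous_re).mem_nhds h2
  have hm : AEStronglyMeasurable (fun u : ℝ ↦ (a u : ℂ)) (volume.restrict (Ioi 0)) :=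
    Complex.continuous_ofReal.comp_aestronglyMeasurable
      (IntegrableOn.aesm_of_mul_exp (ha _ hz))
  have key := hasDerivAt_integral_of_dominated_loc_of_deriv_le (μ := volume.restrict (Ioi (0:ℝ)))
    (F := fun (w : ℂ) (u : ℝ) ↦ (a u : ℂ) * Complex.exp (-w * u))
    (F' := fun (w : ℂ) (u : ℝ) ↦ -((u * a u : ℝ) : ℂ) * Complex.exp (-w * u))
    (bound := fun u ↦ ‖u * a u * Real.exp (-τ * u)‖) (x₀ := z) hs
    (Eventually.of_forall fun w ↦ hm.mul (by fun_prop)) (ha.integrableOn hz) ?_ ?_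
    ((ha.mul_id τ h1).norm) ?_
  · refine key.2.congr_deriv ?_
    simp only [lap, neg_mul, integral_neg]
  · have := (ha.mul_id.integrableOn hz).aestronglyMeasurable.neg
    refine this.congr (Eventually.of_forall fun u ↦ ?_)
    simp
  · filter_upwards [ae_restrict_mem measurableSet_Ioi] with u hu w hw
    have hu : 0 < u := hu
    have hw : τ < w.re := hw
    rw [neg_mul, norm_neg, norm_ofReal_mul_cexp, norm_mul, Real.norm_eq_abs, Real.norm_eq_abs,
      Real.abs_exp]
    gcongr
  · refine Eventually.of_forall fun u w _ ↦ ?_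
    have h3 : HasDerivAt (fun w : ℂ ↦ -w * u) (-1 * u) w :=
      ((hasDerivAt_id w).neg).mul_const _
    refine (h3.cexp.const_mul (a u : ℂ)).congr_deriv ?_
    push_cast
    ring

lemma iteratedDeriv_lap {a : ℝ → ℝ} {σ₀ : ℝ} (ha : LapInt a σ₀) (n : ℕ) {z : ℂ}
    (hz : σ₀ < z.re) :
    iteratedDeriv n (lap a) z = (-1) ^ n * lap (fun u ↦ u ^ n * a u) z := by
  induction n generalizing z with
  | zero => simp
  | succ n ih =>
    rw [iteratedDeriv_succ]
    have hs : {w : ℂ | σ₀ < w.re} ∈ 𝓝 z :=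
      (isOpen_lt continuous_const Complex.continuous_re).mem_nhds hz
    have h1 : iteratedDeriv n (lap a) =ᶠ[𝓝 z] fun w ↦ (-1) ^ n * lap (fun u ↦ u ^ n * a u) w := by
      filter_upwards [hs] with w hw using ih hw
    rw [h1.deriv_eq, ((hasDerivAt_lap (ha.pow_mul n) hz).const_mul _).deriv,
      lap_congr (b := fun u ↦ u ^ (n + 1) * a u) fun u _ ↦ by ring]
    ring

lemma differentiableOn_lap {a : ℝ → ℝ} {σ₀ : ℝ} (ha : LapInt a σ₀) :
    DifferentiableOn ℂ (lap a) {z | σ₀ < z.re} := fun _ hz ↦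
  (hasDerivAt_lap ha hz).differentiableAt.differentiableWithinAt

lemma lapInt_one : LapInt (fun _ ↦ 1) 0 := fun σ hσ ↦ by
  simpa using integrableOn_exp_mul_Ioi (by linarith : -σ < 0) 0

lemma lap_one {z : ℂ} (hz : 0 < z.re) : lap (fun _ ↦ 1) z = 1 / z := by
  have := integral_exp_mul_complex_Ioi (a := -z) (by simpa using hz) 0
  simp only [lap, Complex.ofReal_one, one_mul]
  rw [this]
  simp [div_neg, neg_div]

lemma lapInt_of_bound {a : ℝ → ℝ} (hm : AEStronglyMeasurable a (volume.restrict (Ioi 0)))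
    {C : ℝ} {n : ℕ} (h : ∀ u, 0 < u → |a u| ≤ C * (1 + u) ^ n) : LapInt a 0 := by
  have hL : ∀ n : ℕ, LapInt (fun u ↦ (1 + u) ^ n) 0 := by
    intro n
    induction n with
    | zero => simpa using lapInt_one
    | succ n ih => exact (ih.add ih.mul_id).congr fun u _ ↦ by ring
  refine ((hL n).const_mul C).of_le hm fun u hu ↦ (h u hu).trans (le_abs_self _)

lemma LapInt.exp_mul {a : ℝ → ℝ} {σ₀ : ℝ} (ha : LapInt a σ₀) (b : ℝ) :
    LapInt (fun u ↦ Real.exp (-b * u) * a u) (σ₀ - b) := fun σ hσ ↦ by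
  refine (ha (σ + b) (by linarith)).congr_fun (fun u _ ↦ ?_) measurableSet_Ioi
  simp only
  rw [mul_right_comm, ← Real.exp_add, mul_comm]
  ring_nf

lemma lap_exp_mul (a : ℝ → ℝ) (b : ℝ) (z : ℂ) :
    lap (fun u ↦ Real.exp (-b * u) * a u) z = lap a (z + b) := by
  refine setIntegral_congr_fun measurableSet_Ioi fun u _ ↦ ?_
  simp only
  push_cast
  rw [mul_right_comm, ← Complex.exp_add, mul_comm]
  ring_nf

lemma setIntegral_Ioi_one_eq {E : Type*} [NormedAddCommGroup E] [NormedSpace ℝ E] (g : ℝ → E) :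
    ∫ t in Ioi (1 : ℝ), g t = ∫ u in Ioi (0 : ℝ), Real.exp u • g (Real.exp u) := by
  have him : Real.exp '' Ioi 0 = Ioi 1 := by
    ext x
    constructor
    · rintro ⟨u, hu, rfl⟩
      exact Real.one_lt_exp_iff.2 hu
    · intro hx
      have hx : 1 < x := hx
      exact ⟨Real.log x, Real.log_pos hx, Real.exp_log (by linarith)⟩
  rw [← him, integral_image_eq_integral_abs_deriv_smul measurableSet_Ioi
    (fun x _ ↦ (Real.hasDerivAt_exp x).hasDerivWithinAt) Real.exp_injective.injOn]
  simp

lemma setIntegral_Ioi_one_cpow (g : ℝ → ℝ) (z : ℂ) :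
    ∫ t in Ioi (1 : ℝ), (g t : ℂ) * (t : ℂ) ^ (-(z + 1)) = lap (fun u ↦ g (Real.exp u)) z := by
  rw [setIntegral_Ioi_one_eq, lap]
  refine setIntegral_congr_fun measurableSet_Ioi fun u _ ↦ ?_
  rw [Complex.real_smul, Complex.ofReal_exp, Complex.cpow_def_of_ne_zero (Complex.exp_ne_zero _),
    ← Complex.ofReal_exp, ← Complex.ofReal_log (Real.exp_pos u).le, Real.log_exp,
    Complex.ofReal_exp, mul_left_comm, ← Complex.exp_add]
  ring_nf

end Robin

namespace Robin

open Set Filter Topology MeasureTheory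

lemma integral_pow_mul_exp (n : ℕ) {s : ℝ} (hs : 0 < s) :
    ∫ v in Ioi (0 : ℝ), v ^ n * Real.exp (-s * v) = n.factorial / s ^ (n + 1) := by
  have h := Real.integral_rpow_mul_exp_neg_mul_Ioi (a := n + 1) (r := s) (by positivity) hs
  rw [Real.Gamma_nat_eq_factorial] at h
  rw [← Nat.cast_succ, Real.rpow_natCast] at h
  rw [show (n.factorial : ℝ) / s ^ (n + 1) = (1 / s) ^ n.succ * n.factorial by
    rw [Nat.succ_eq_add_one, one_div_pow]; ring, ← h]
  refine setIntegral_congr_fun measurableSet_Ioi fun v hv ↦ ?_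
  simp

lemma integrableOn_pow_mul_exp (n : ℕ) {s : ℝ} (hs : 0 < s) :
    IntegrableOn (fun v : ℝ ↦ v ^ n * Real.exp (-s * v)) (Ioi 0) := by
  simpa using lapInt_one.pow_mul n s hs

lemma integral_sq_sub_mul_gamma (n : ℕ) {u : ℝ} (hu : 0 < u) :
    ∫ v in Ioi (0 : ℝ), (v - u) ^ 2 * (v ^ n * Real.exp (-((n + 1) / u) * v)) =
      u ^ 2 / (n + 1) * (n.factorial / ((n + 1) / u) ^ (n + 1)) := by
  have hs : 0 < ((n : ℝ) + 1) / u := by positivity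
  set s := ((n : ℝ) + 1) / u with hsdef
  have h0 := integrableOn_pow_mul_exp n hs
  have h1 := integrableOn_pow_mul_exp (n + 1) hs
  have h2 := integrableOn_pow_mul_exp (n + 2) hs
  have e : ∀ v : ℝ, (v - u) ^ 2 * (v ^ n * Real.exp (-s * v)) =
      (v ^ (n + 2) * Real.exp (-s * v) - 2 * u * (v ^ (n + 1) * Real.exp (-s * v))) +
        u ^ 2 * (v ^ n * Real.exp (-s * v)) := fun v ↦ by ring
  simp_rw [e]
  have h3 : IntegrableOn (fun v : ℝ ↦ v ^ (n + 2) * Real.exp (-s * v) -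
      2 * u * (v ^ (n + 1) * Real.exp (-s * v))) (Ioi 0) := h2.sub (h1.const_mul _)
  rw [integral_add h3 (h0.const_mul _), integral_sub h2 (h1.const_mul _),
    integral_const_mul, integral_const_mul, integral_pow_mul_exp _ hs, integral_pow_mul_exp _ hs,
    integral_pow_mul_exp _ hs]
  have hu' : u = (n + 1) / s := by rw [hsdef]; field_simp
  rw [hu', Nat.factorial_succ (n + 1), Nat.factorial_succ n]
  push_cast
  field_simp
  ring

lemma post_widder {a : ℝ → ℝ} (ha : LapInt a 0) {M u : ℝ} (hu : 0 < u)
    (hL : ∀ v, 0 < v → |a v - a u| ≤ M * |v - u|) (n : ℕ) :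
    |(((n + 1) / u) ^ (n + 1) / n.factorial *
      ∫ v in Ioi (0 : ℝ), v ^ n * a v * Real.exp (-((n + 1) / u) * v)) - a u| ≤
      M * u / √(n + 1) := by
  have hs : 0 < ((n : ℝ) + 1) / u := by positivity
  have hM : 0 ≤ M := by
    have := (abs_nonneg _).trans (hL (u + 1) (by linarith))
    simpa using this
  have hsq := integral_sq_sub_mul_gamma n hu
  have h0 := integrableOn_pow_mul_exp n hs
  have h1 := integrableOn_pow_mul_exp (n + 1) hs
  have h2 := integrableOn_pow_mul_exp (n + 2) hs
  have hA := ha.pow_mul n _ hs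
  have hI := integral_pow_mul_exp n hs
  set s := ((n : ℝ) + 1) / u with hsdef
  set I : ℝ := n.factorial / s ^ (n + 1) with hIdef
  have hIpos : 0 < I := by positivity
  have hinv : s ^ (n + 1) / n.factorial = I⁻¹ := by rw [hIdef, inv_div]
  set q : ℝ := √(n + 1) with hq
  have hqpos : 0 < q := Real.sqrt_pos.2 (by positivity)
  have hqq : q ^ 2 = n + 1 := Real.sq_sqrt (by positivity)
  have hsqi : IntegrableOn (fun v : ℝ ↦ (v - u) ^ 2 * (v ^ n * Real.exp (-s * v))) (Ioi 0) := by
    refine IntegrableOn.congr_fun (((h2.sub (h1.const_mul (2 * u)))).add (h0.const_mul (u ^ 2)))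
      (fun v _ ↦ ?_) measurableSet_Ioi
    simp only [Pi.add_apply, Pi.sub_apply]
    ring
  have hD : (∫ v in Ioi (0 : ℝ), v ^ n * a v * Real.exp (-s * v)) - a u * I =
      ∫ v in Ioi (0 : ℝ), (a v - a u) * (v ^ n * Real.exp (-s * v)) := by
    rw [← hI, ← integral_const_mul, ← integral_sub hA (h0.const_mul _)]
    congr 1 with v
    ring
  have hB : |(∫ v in Ioi (0 : ℝ), v ^ n * a v * Real.exp (-s * v)) - a u * I| ≤
      M * u / q * I := by
    rw [hD, ← Real.norm_eq_abs]
    have hg : IntegrableOn (fun v : ℝ ↦ (M * (q / (2 * u))) *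
        ((v - u) ^ 2 * (v ^ n * Real.exp (-s * v))) +
          (M * (u / (2 * q))) * (v ^ n * Real.exp (-s * v))) (Ioi 0) :=
      (hsqi.const_mul _).add (h0.const_mul _)
    refine (norm_integral_le_of_norm_le hg ?_).trans_eq ?_
    · filter_upwards [ae_restrict_mem measurableSet_Ioi] with v hv
      have hv : 0 < v := hv
      have hw : 0 < v ^ n * Real.exp (-s * v) := by positivity
      rw [norm_mul, Real.norm_eq_abs, Real.norm_eq_abs, abs_of_pos hw]
      have h4 : |v - u| ≤ (q / (2 * u)) * (v - u) ^ 2 + u / (2 * q) := by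
        rw [← sq_abs (v - u)]
        have h5 : 0 ≤ (q * |v - u| - u) ^ 2 / (2 * u * q) := by positivity
        have h6 : (q * |v - u| - u) ^ 2 / (2 * u * q) =
          (q / (2 * u)) * |v - u| ^ 2 + u / (2 * q) - |v - u| := by
          field_simp
          ring
        linarith
      calc |a v - a u| * (v ^ n * Real.exp (-s * v))
          ≤ (M * ((q / (2 * u)) * (v - u) ^ 2 + u / (2 * q))) * (v ^ n * Real.exp (-s * v)) := by
            gcongr
            exact (hL v hv).trans (by gcongr)
        _ = _ := by ring
    · rw [integral_add (hsqi.const_mul _) (h0.const_mul _), integral_const_mul,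
        integral_const_mul, hsq, hI, ← hqq]
      field_simp
      ring
  have : s ^ (n + 1) / n.factorial * (∫ v in Ioi (0 : ℝ), v ^ n * a v * Real.exp (-s * v)) - a u =
      I⁻¹ * ((∫ v in Ioi (0 : ℝ), v ^ n * a v * Real.exp (-s * v)) - a u * I) := by
    rw [hinv]; field_simp
  rw [this, abs_mul, abs_of_pos (inv_pos.2 hIpos)]
  calc I⁻¹ * _ ≤ I⁻¹ * (M * u / q * I) := by gcongr
    _ = _ := by field_simp

end Robin

namespace Robin

open Set Filter Topology MeasureTheory

/-- The digamma function on the positive reals. -/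
noncomputable def digammaR (x : ℝ) : ℝ := deriv (Real.log ∘ Real.Gamma) x

lemma differentiableAt_Gamma_of_pos {x : ℝ} (hx : 0 < x) : DifferentiableAt ℝ Real.Gamma x :=
  Real.differentiableAt_Gamma fun m ↦ by
    have : (0 : ℝ) ≤ m := m.cast_nonneg
    linarith

lemma hasDerivAt_log_Gamma {x : ℝ} (hx : 0 < x) :
    HasDerivAt (Real.log ∘ Real.Gamma) (digammaR x) x :=
  ((differentiableAt_Gamma_of_pos hx).log (Real.Gamma_pos_of_pos hx).ne').hasDerivAt

lemma digammaR_eq {x : ℝ} (hx : 0 < x) : digammaR x = deriv Real.Gamma x / Real.Gamma x :=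
  deriv.log (differentiableAt_Gamma_of_pos hx) (Real.Gamma_pos_of_pos hx).ne'

lemma digammaR_mono : MonotoneOn digammaR (Ioi 0) :=
  Real.convexOn_log_Gamma.monotoneOn_deriv fun _ hx ↦ (hasDerivAt_log_Gamma hx).differentiableAt

lemma digammaR_add_one {x : ℝ} (hx : 0 < x) : digammaR (x + 1) = digammaR x + 1 / x := by
  have h1 : HasDerivAt (fun y ↦ (Real.log ∘ Real.Gamma) (y + 1)) (digammaR (x + 1)) x :=
    (hasDerivAt_log_Gamma (by linarith : 0 < x + 1)).comp_add_const x 1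
  have h2 : HasDerivAt (fun y ↦ Real.log y + (Real.log ∘ Real.Gamma) y) (x⁻¹ + digammaR x) x :=
    (Real.hasDerivAt_log hx.ne').add (hasDerivAt_log_Gamma hx)
  have h3 : (fun y ↦ (Real.log ∘ Real.Gamma) (y + 1)) =ᶠ[𝓝 x]
      fun y ↦ Real.log y + (Real.log ∘ Real.Gamma) y := by
    filter_upwards [lt_mem_nhds hx] with y hy
    simp only [Function.comp]
    rw [Real.Gamma_add_one hy.ne', Real.log_mul hy.ne' (Real.Gamma_pos_of_pos hy).ne']
  rw [(h2.congr_of_eventuallyEq h3).unique h1 |>.symm]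
  ring

lemma digammaR_add_nat {x : ℝ} (hx : 0 < x) (n : ℕ) :
    digammaR (x + n) = digammaR x + ∑ k ∈ Finset.range n, 1 / (x + k) := by
  induction n with
  | zero => simp
  | succ n ih =>
    have : 0 < x + n := by positivity
    rw [Finset.sum_range_succ, ← add_assoc, ← ih, ← digammaR_add_one this]
    push_cast
    ring_nf

lemma digammaR_one : digammaR 1 = -Real.eulerMascheroniConstant := by
  rw [digammaR_eq one_pos, Real.Gamma_one, Real.eulerMascheroniConstant_eq_neg_deriv]
  simp

lemma hasSum_digammaR {x : ℝ} (hx : 0 < x) :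
    HasSum (fun k : ℕ ↦ 1 / ((k : ℝ) + 1) - 1 / (x + 1 + k))
      (digammaR (x + 1) + Real.eulerMascheroniConstant) := by
  have h0 : ∀ k : ℕ, 0 ≤ 1 / ((k : ℝ) + 1) - 1 / (x + 1 + k) := fun k ↦ by
    rw [sub_nonneg]
    exact one_div_le_one_div_of_le (by positivity) (by linarith)
  rw [hasSum_iff_tendsto_nat_of_nonneg h0]
  have hpart : ∀ n : ℕ, ∑ k ∈ Finset.range n, (1 / ((k : ℝ) + 1) - 1 / (x + 1 + k)) =
      digammaR (x + 1) + Real.eulerMascheroniConstant -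
        (digammaR (x + 1 + n) - digammaR (1 + n)) := fun n ↦ by
    have h1 := digammaR_add_nat (by linarith : 0 < x + 1) n
    have h2 := digammaR_add_nat one_pos n
    rw [digammaR_one] at h2
    rw [Finset.sum_sub_distrib, h1, h2]
    have : ∑ k ∈ Finset.range n, 1 / ((k : ℝ) + 1) = ∑ k ∈ Finset.range n, 1 / (1 + (k : ℝ)) :=
      Finset.sum_congr rfl fun k _ ↦ by rw [add_comm]
    rw [this]
    ring
  simp_rw [hpart]
  obtain ⟨m, hm⟩ := exists_nat_ge x
  have hlim : Tendsto (fun n : ℕ ↦ digammaR (x + 1 + n) - digammaR (1 + n)) atTop (𝓝 0) := by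
    have hup : Tendsto (fun n : ℕ ↦ (m : ℝ) * (1 / ((n : ℝ) + 1))) atTop (𝓝 0) := by
      simpa using tendsto_one_div_add_atTop_nhds_zero_nat.const_mul (m : ℝ)
    refine squeeze_zero (fun n ↦ ?_) (fun n ↦ ?_) hup
    · rw [sub_nonneg]
      refine digammaR_mono ?_ ?_ (by linarith)
      · exact mem_Ioi.2 (by positivity)
      · exact mem_Ioi.2 (by positivity)
    · have h1 : digammaR (x + 1 + n) ≤ digammaR (1 + n + m) := by
        refine digammaR_mono ?_ ?_ (by linarith)
        · exact mem_Ioi.2 (by positivity)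
        · exact mem_Ioi.2 (by positivity)
      rw [digammaR_add_nat (by positivity : (0 : ℝ) < 1 + n) m] at h1
      have h2 : ∑ k ∈ Finset.range m, 1 / (1 + (n : ℝ) + k) ≤ m * (1 / ((n : ℝ) + 1)) := by
        refine (Finset.sum_le_card_nsmul _ _ (1 / ((n : ℝ) + 1)) fun k _ ↦ ?_).trans_eq (by simp)
        gcongr 1 / ?_
        have : (0 : ℝ) ≤ k := k.cast_nonneg
        linarith
      linarith
  simpa using hlim.const_sub (digammaR (x + 1) + Real.eulerMascheroniConstant)

lemma digamma_ofReal {x : ℝ} (hx : 0 < x) : Complex.digamma x = digammaR x := by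
  have hne : ∀ m : ℕ, (x : ℂ) ≠ -m := fun m h ↦ by
    have h2 := congrArg Complex.re h
    simp at h2
    have : (0 : ℝ) ≤ m := m.cast_nonneg
    linarith
  have h1 := (Complex.differentiableAt_Gamma (x : ℂ) hne).hasDerivAt
  have h2 : HasDerivAt (fun y : ℝ ↦ ((Real.Gamma y : ℝ) : ℂ)) (deriv Complex.Gamma x) x := by
    simpa [Complex.Gamma_ofReal] using h1.comp_ofReal
  have h3 := (differentiableAt_Gamma_of_pos hx).hasDerivAt.ofReal_comp
  rw [Complex.digamma_def, logDeriv_apply, h2.unique h3, digammaR_eq hx, Complex.Gamma_ofReal]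
  push_cast
  rfl

end Robin

namespace Robin

open Set Filter Topology MeasureTheory

/-- The Laplace transform of a primitive. -/
lemma lap_integral {h : ℝ → ℝ} (hh : LapInt h 0) {z : ℂ} (hz : 0 < z.re) :
    lap (fun u ↦ ∫ v in (0 : ℝ)..u, h v) z = lap h z / z := by
  have hz0 : z ≠ 0 := fun h0 ↦ by simp [h0] at hz
  set μ := volume.restrict (Ioi (0 : ℝ)) with hμ
  set f : ℝ → ℝ → ℂ := fun v u ↦
    (h v : ℂ) * (Ioi v).indicator (fun u : ℝ ↦ Complex.exp (-z * u)) u with hf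
  have hexp : ∀ v : ℝ, IntegrableOn (fun u : ℝ ↦ Complex.exp (-z * u)) (Ioi v) := fun v ↦
    integrableOn_exp_mul_complex_Ioi (by simpa using hz) v
  have hm : AEStronglyMeasurable h μ := IntegrableOn.aesm_of_mul_exp (hh _ hz)
  have hms : AEStronglyMeasurable (Function.uncurry f) (μ.prod μ) := by
    have h1 : AEStronglyMeasurable (fun p : ℝ × ℝ ↦ (h p.1 : ℂ)) (μ.prod μ) :=
      (Complex.continuous_ofReal.comp_aestronglyMeasurable hm).comp_fst
    have h2 : AEStronglyMeasurable (fun p : ℝ × ℝ ↦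
        {p : ℝ × ℝ | p.1 < p.2}.indicator (fun p : ℝ × ℝ ↦ Complex.exp (-z * p.2)) p)
        (μ.prod μ) :=
      AEStronglyMeasurable.indicator (by fun_prop) (measurableSet_lt measurable_fst measurable_snd)
    exact h1.mul h2
  have hnorm : ∀ v : ℝ, 0 < v → ∫ u, ‖f v u‖ ∂μ = |h v| * Real.exp (-z.re * v) / z.re := by
    intro v hv
    have e : ∀ u, ‖f v u‖ = |h v| * (Ioi v).indicator (fun u ↦ Real.exp (-z.re * u)) u := by
      intro u
      simp only [hf, norm_mul, Complex.norm_real, Real.norm_eq_abs]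
      by_cases hu : u ∈ Ioi v
      · simp [indicator_of_mem hu, Complex.norm_exp]
      · simp [indicator_of_notMem hu]
    simp_rw [e]
    rw [integral_const_mul, hμ, integral_indicator measurableSet_Ioi,
      Measure.restrict_restrict measurableSet_Ioi,
      inter_eq_left.2 (Ioi_subset_Ioi hv.le), integral_exp_mul_Ioi (by linarith) v]
    field_simp
  have h_int : Integrable (Function.uncurry f) (μ.prod μ) := by
    rw [integrable_prod_iff hms]
    constructor
    · filter_upwards [ae_restrict_mem measurableSet_Ioi] with v hv
      have hv : 0 < v := hv
      have hi : Integrable ((Ioi v).indicator fun u : ℝ ↦ Complex.exp (-z * u)) μ := by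
        rw [integrable_indicator_iff measurableSet_Ioi, hμ, IntegrableOn,
          Measure.restrict_restrict measurableSet_Ioi, inter_eq_left.2 (Ioi_subset_Ioi hv.le)]
        exact hexp v
      exact hi.const_mul (h v : ℂ)
    · refine (((hh _ hz).norm).div_const z.re).congr ?_
      filter_upwards [ae_restrict_mem measurableSet_Ioi] with v hv
      simp only [Function.uncurry_apply_pair]
      rw [hnorm v hv, norm_mul, Real.norm_eq_abs, Real.norm_eq_abs, Real.abs_exp]
  have hswap := integral_integral_swap h_int
  have hL : ∫ v, ∫ u, f v u ∂μ ∂μ = lap h z / z := by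
    rw [lap, ← integral_div]
    refine integral_congr_ae ?_
    filter_upwards [ae_restrict_mem measurableSet_Ioi] with v hv
    have hv : 0 < v := hv
    simp only [hf]
    rw [integral_const_mul, hμ, integral_indicator measurableSet_Ioi,
      Measure.restrict_restrict measurableSet_Ioi,
      inter_eq_left.2 (Ioi_subset_Ioi hv.le), integral_exp_mul_complex_Ioi (by simpa using hz) v]
    field_simp
  rw [← hL, hswap, lap]
  refine integral_congr_ae ?_
  filter_upwards [ae_restrict_mem measurableSet_Ioi] with u hu
  have hu : 0 < u := hu
  have e : ∀ v, f v u = (Iio u).indicator (fun v ↦ (h v : ℂ)) v * Complex.exp (-z * u) := by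
    intro v
    simp only [hf]
    by_cases hv : v < u
    · rw [indicator_of_mem (show u ∈ Ioi v from hv), indicator_of_mem (show v ∈ Iio u from hv)]
    · rw [indicator_of_notMem (show u ∉ Ioi v from hv), indicator_of_notMem (show v ∉ Iio u from hv)]
      simp
  simp_rw [e]
  rw [integral_mul_const, hμ, integral_indicator measurableSet_Iio,
    Measure.restrict_restrict measurableSet_Iio, intervalIntegral.integral_of_le hu.le]
  have : Iio u ∩ Ioi 0 = Ioo 0 u := by ext; simp [and_comm]
  rw [this, ← integral_Ioc_eq_integral_Ioo, integral_complex_ofReal]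

/-- `ψ(e^u)e^{-u}`. -/
noncomputable def psiNorm (u : ℝ) : ℝ := Chebyshev.psi (Real.exp u) * Real.exp (-u)

lemma psiNorm_nonneg (u : ℝ) : 0 ≤ psiNorm u :=
  mul_nonneg (Chebyshev.psi_nonneg _) (Real.exp_pos _).le

lemma psiNorm_le (u : ℝ) : psiNorm u ≤ Real.log 4 + 4 := by
  have := Chebyshev.psi_le_const_mul_self (Real.exp_pos u).le
  rw [psiNorm, Real.exp_neg, ← div_eq_mul_inv, div_le_iff₀ (Real.exp_pos u)]
  exact this

lemma measurable_psiNorm : Measurable psiNorm :=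
  (Chebyshev.psi_mono.measurable.comp Real.measurable_exp).mul (by fun_prop)

lemma lapInt_psiNorm : LapInt psiNorm 0 :=
  lapInt_of_bound (n := 0) (C := Real.log 4 + 4) measurable_psiNorm.aestronglyMeasurable
    fun u _ ↦ by simpa [abs_of_nonneg (psiNorm_nonneg u)] using psiNorm_le u

lemma lap_psiNorm {z : ℂ} (hz : 0 < z.re) :
    lap psiNorm z = -deriv riemannZeta (z + 1) / riemannZeta (z + 1) / (z + 1) := by
  have hz1 : z + 1 ≠ 0 := fun h0 ↦ by
    have := congrArg Complex.re h0
    simp at this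
    linarith
  have h1 := ArithmeticFunction.LSeries_vonMangoldt_eq_deriv_riemannZeta_div (s := z + 1)
    (by simpa using hz)
  have hO : (fun n : ℕ ↦ ∑ k ∈ Finset.Icc 1 n, ArithmeticFunction.vonMangoldt k)
      =O[atTop] fun n ↦ (n : ℝ) ^ (1 : ℝ) := by
    refine Asymptotics.IsBigO.of_bound (Real.log 4 + 4) (Eventually.of_forall fun n ↦ ?_)
    have := Chebyshev.psi_le_const_mul_self (x := n) (by positivity)
    rw [Chebyshev.psi, Nat.floor_natCast] at this
    rw [Real.norm_eq_abs, abs_of_nonneg (Finset.sum_nonneg fun _ _ ↦ by simp)]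
    have e : Finset.Ioc 0 n = Finset.Icc 1 n := by ext; simp [Nat.succ_le_iff]
    simpa [e] using this
  have h2 := LSeries_eq_mul_integral_of_nonneg (fun n ↦ ArithmeticFunction.vonMangoldt n)
    zero_le_one (s := z + 1) (by simpa using hz) hO (fun _ ↦ by simp)
  rw [← h1, h2, mul_div_cancel_left₀ _ hz1]
  have h3 : (fun t : ℝ ↦ (∑ k ∈ Finset.Icc 1 ⌊t⌋₊,
      ((ArithmeticFunction.vonMangoldt k : ℝ) : ℂ)) * (t : ℂ) ^ (-(z + 1 + 1))) =
      fun t : ℝ ↦ ((Chebyshev.psi t : ℝ) : ℂ) * (t : ℂ) ^ (-((z + 1) + 1)) := by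
    funext t
    have e : Finset.Ioc 0 ⌊t⌋₊ = Finset.Icc 1 ⌊t⌋₊ := by ext; simp [Nat.succ_le_iff]
    rw [Chebyshev.psi, e]
    push_cast
    rfl
  rw [h3, setIntegral_Ioi_one_cpow]
  have := lap_exp_mul (fun u ↦ Chebyshev.psi (Real.exp u)) 1 z
  rw [Complex.ofReal_one] at this
  rw [← this]
  refine lap_congr (fun u _ ↦ ?_) z
  rw [psiNorm]
  ring_nf

/-- `-1 - γ - ∫_0^u (ψ(e^v)e^{-v} - 1) dv`. -/
noncomputable def psiPrim (u : ℝ) : ℝ :=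
  -(1 + Real.eulerMascheroniConstant) - ∫ v in (0 : ℝ)..u, (psiNorm v - 1)

lemma intervalIntegrable_psiNorm (a b : ℝ) : IntervalIntegrable psiNorm volume a b := by
  rw [intervalIntegrable_iff]
  refine Measure.integrableOn_of_bounded (M := Real.log 4 + 4) (by simp)
    measurable_psiNorm.aestronglyMeasurable (Eventually.of_forall fun u ↦ ?_)
  rw [Real.norm_eq_abs, abs_of_nonneg (psiNorm_nonneg u)]
  exact psiNorm_le u

lemma psiPrim_sub (u v : ℝ) : psiPrim v - psiPrim u = -∫ t in u..v, (psiNorm t - 1) := by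
  have hi : ∀ a b, IntervalIntegrable (fun t ↦ psiNorm t - 1) volume a b := fun a b ↦
    (intervalIntegrable_psiNorm a b).sub (by simp)
  rw [← intervalIntegral.integral_add_adjacent_intervals (hi u 0) (hi 0 v),
    intervalIntegral.integral_symm 0 u, psiPrim, psiPrim]
  ring

lemma abs_psiPrim_sub_le (u v : ℝ) : |psiPrim v - psiPrim u| ≤ (Real.log 4 + 4) * |v - u| := by
  rw [psiPrim_sub, abs_neg, ← Real.norm_eq_abs]
  refine intervalIntegral.norm_integral_le_of_norm_le_const fun t _ ↦ ?_
  have h1 := psiNorm_nonneg t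
  have h2 := psiNorm_le t
  have h3 : 0 ≤ Real.log 4 := Real.log_nonneg (by norm_num)
  rw [Real.norm_eq_abs, abs_le]
  constructor <;> linarith

lemma continuous_psiPrim : Continuous psiPrim := by
  have h3 : 0 ≤ Real.log 4 := Real.log_nonneg (by norm_num)
  have : LipschitzWith (Real.toNNReal (Real.log 4 + 4)) psiPrim :=
    LipschitzWith.of_dist_le' fun u v ↦ by
      rw [Real.dist_eq, Real.dist_eq]
      exact abs_psiPrim_sub_le v u
  exact this.continuous

lemma lapInt_psiNorm_sub : LapInt (fun u ↦ psiNorm u - 1) 0 := lapInt_psiNorm.sub lapInt_one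

lemma lapInt_psiPrim : LapInt psiPrim 0 := by
  have hγ := Real.eulerMascheroniConstant_lt_two_thirds
  have hγ' := Real.one_half_lt_eulerMascheroniConstant
  have h3 : 0 ≤ Real.log 4 := Real.log_nonneg (by norm_num)
  refine lapInt_of_bound (n := 1) (C := Real.log 4 + 4) continuous_psiPrim.aestronglyMeasurable
    fun u hu ↦ ?_
  have h1 := abs_psiPrim_sub_le 0 u
  have h2 : psiPrim 0 = -(1 + Real.eulerMascheroniConstant) := by simp [psiPrim]
  rw [h2, sub_zero, abs_of_pos hu, abs_le] at h1
  rw [pow_one, abs_le]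
  constructor <;> nlinarith [h1.1, h1.2]

lemma lap_psiPrim {z : ℂ} (hz : 0 < z.re) :
    lap psiPrim z = -(1 + Real.eulerMascheroniConstant) / z -
      (-deriv riemannZeta (z + 1) / riemannZeta (z + 1) / (z + 1) - 1 / z) / z := by
  have hF := lap_integral lapInt_psiNorm_sub hz
  rw [lap_sub lapInt_psiNorm lapInt_one hz, lap_psiNorm hz, lap_one hz] at hF
  have hI : LapInt (fun u ↦ ∫ v in (0 : ℝ)..u, (psiNorm v - 1)) 0 :=
    ((lapInt_one.const_mul (-(1 + Real.eulerMascheroniConstant))).sub lapInt_psiPrim).congr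
      fun u _ ↦ by simp [psiPrim]
  have h1 : lap psiPrim z = lap (fun u ↦ -(1 + Real.eulerMascheroniConstant) * 1 -
      ∫ v in (0 : ℝ)..u, (psiNorm v - 1)) z :=
    lap_congr (fun u _ ↦ by simp [psiPrim]) z
  rw [h1, lap_sub (lapInt_one.const_mul _) hI hz, lap_const_mul, lap_one hz, hF]
  push_cast
  ring

end Robin

namespace Robin

open Set Filter Topology MeasureTheory

/-- The coefficients `1 / ((2k+2)(2k+3))`. -/
noncomputable def tailCoeff (k : ℕ) : ℝ := 1 / ((2 * k + 2) * (2 * k + 3))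

lemma tailCoeff_pos (k : ℕ) : 0 < tailCoeff k := by unfold tailCoeff; positivity

lemma hasSum_tailCoeff_div {w : ℝ} (hw : 1 < w) :
    HasSum (fun k : ℕ ↦ tailCoeff k * (1 / (w - 1) - 1 / (w + 2 * k + 2)))
      ((digammaR (w / 2 + 1) + Real.eulerMascheroniConstant) / (2 * (w * (w - 1)))) := by
  have h := (hasSum_digammaR (by linarith : 0 < w / 2)).div_const (2 * (w * (w - 1)))
  refine h.congr_fun fun k ↦ ?_
  have h1 : w - 1 ≠ 0 := by linarith
  have h2 : (w : ℝ) + 2 * k + 2 ≠ 0 := by positivity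
  have h3 : (w : ℝ) / 2 + 1 + k ≠ 0 := by positivity
  have h4 : (w : ℝ) ≠ 0 := by positivity
  rw [tailCoeff]
  field_simp
  ring

lemma digammaR_half : digammaR (1 / 2) = -2 * Real.log 2 - Real.eulerMascheroniConstant := by
  have h := Complex.digamma_one_half
  have h2 := digamma_ofReal (by norm_num : (0 : ℝ) < 1 / 2)
  push_cast at h2
  rw [h2, ← Complex.ofReal_ofNat, ← Complex.ofReal_log (by norm_num)] at h
  exact_mod_cast h

lemma hasSum_tailCoeff : HasSum tailCoeff (1 - Real.log 2) := by
  have h := (hasSum_digammaR (by norm_num : (0 : ℝ) < 1 / 2)).div_const 2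
  rw [digammaR_add_one (by norm_num), digammaR_half] at h
  have e : (-2 * Real.log 2 - Real.eulerMascheroniConstant + 1 / (1 / 2) +
      Real.eulerMascheroniConstant) / 2 = 1 - Real.log 2 := by ring
  rw [e] at h
  refine h.congr_fun fun k ↦ ?_
  rw [tailCoeff]
  have h3 : (1 : ℝ) / 2 + 1 + k ≠ 0 := by positivity
  field_simp
  ring

lemma hasSum_tailCoeff_div' {s : ℝ} (hs : 0 < s) :
    HasSum (fun k : ℕ ↦ tailCoeff k / (s + (2 * k + 3))) ((1 - Real.log 2) / s -
      (digammaR ((s + 1) / 2 + 1) + Real.eulerMascheroniConstant) / (2 * ((s + 1) * s))) := by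
  have h1 := hasSum_tailCoeff_div (by linarith : 1 < s + 1)
  have h2 := (hasSum_tailCoeff.div_const s).sub h1
  rw [add_sub_cancel_right] at h2
  refine h2.congr_fun fun k ↦ ?_
  have h3 : s + 1 + 2 * (k : ℝ) + 2 = s + (2 * k + 3) := by ring
  rw [h3]
  ring

/-- The contribution of the trivial zeros and the constant term. -/
noncomputable def gamTail (u : ℝ) : ℝ :=
  -Real.log (2 * Real.pi) * Real.exp (-u) +
    ∑' k : ℕ, tailCoeff k * Real.exp (-(2 * k + 3) * u)

lemma summable_gamTail {u : ℝ} (hu : 0 ≤ u) :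
    Summable fun k : ℕ ↦ tailCoeff k * Real.exp (-(2 * k + 3) * u) := by
  refine Summable.of_nonneg_of_le (fun k ↦ ?_) (fun k ↦ ?_) hasSum_tailCoeff.summable
  · exact mul_nonneg (tailCoeff_pos k).le (Real.exp_pos _).le
  · refine mul_le_of_le_one_right (tailCoeff_pos k).le (Real.exp_le_one_iff.2 ?_)
    have : 0 ≤ (2 * (k : ℝ) + 3) * u := by positivity
    linarith

lemma tail_sum_nonneg (u : ℝ) : 0 ≤ ∑' k : ℕ, tailCoeff k * Real.exp (-(2 * k + 3) * u) :=
  tsum_nonneg fun k ↦ mul_nonneg (tailCoeff_pos k).le (Real.exp_pos _).le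

lemma abs_exp_sub_exp_le {m u v : ℝ} (hm : 0 ≤ m) (hu : 0 < u) (hv : 0 ≤ v) :
    |Real.exp (-m * v) - Real.exp (-m * u)| ≤ 1 / u * |v - u| := by
  have key : ∀ x y : ℝ, 0 ≤ x → x ≤ y → 0 < y →
      Real.exp (-m * x) ≤ Real.exp (-m * y) + (y - x) / y := by
    intro x y hx hxy hy
    have h := convexOn_exp.2 (mem_univ 0) (mem_univ (-m * y))
      (show 0 ≤ (y - x) / y from div_nonneg (by linarith) hy.le) (show 0 ≤ x / y by positivity)
      (by field_simp; ring)
    simp only [smul_eq_mul, mul_zero, zero_add, Real.exp_zero, mul_one] at h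
    have e : x / y * (-m * y) = -m * x := by field_simp
    rw [e] at h
    have h2 : x / y * Real.exp (-m * y) ≤ 1 * Real.exp (-m * y) := by
      gcongr
      exact (div_le_one hy).2 hxy
    linarith
  rcases le_total v u with h | h
  · have h1 := key v u hv h hu
    have h2 : Real.exp (-m * u) ≤ Real.exp (-m * v) := Real.exp_le_exp.2 (by nlinarith)
    rw [abs_of_nonneg (by linarith), abs_of_nonpos (by linarith)]
    have : 1 / u * -(v - u) = (u - v) / u := by ring
    linarith
  · have h1 := key u v hu.le h (by linarith)
    have h2 : Real.exp (-m * v) ≤ Real.exp (-m * u) := Real.exp_le_exp.2 (by nlinarith)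
    rw [abs_of_nonpos (by linarith), abs_of_nonneg (by linarith)]
    have h3 : (v - u) / v ≤ (v - u) / u := by gcongr
    have : 1 / u * (v - u) = (v - u) / u := by ring
    linarith

lemma abs_gamTail_sub_le {u v : ℝ} (hu : 0 < u) (hv : 0 < v) :
    |gamTail v - gamTail u| ≤ (Real.log (2 * Real.pi) + 1) / u * |v - u| := by
  have hl : 0 ≤ Real.log (2 * Real.pi) := Real.log_nonneg (by linarith [Real.pi_gt_three])
  have h1 := abs_exp_sub_exp_le zero_le_one hu hv.le
  rw [neg_one_mul, neg_one_mul] at h1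
  have h2 : |(∑' k : ℕ, tailCoeff k * Real.exp (-(2 * k + 3) * v)) -
      ∑' k : ℕ, tailCoeff k * Real.exp (-(2 * k + 3) * u)| ≤ 1 / u * |v - u| := by
    rw [← (summable_gamTail hv.le).tsum_sub (summable_gamTail hu.le), ← Real.norm_eq_abs]
    have hs := hasSum_tailCoeff.mul_right (1 / u * |v - u|)
    refine (tsum_of_norm_bounded hs fun k ↦ ?_).trans ?_
    · rw [← mul_sub, norm_mul, Real.norm_eq_abs, Real.norm_eq_abs, abs_of_pos (tailCoeff_pos k)]
      gcongr
      · exact (tailCoeff_pos k).le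
      · exact abs_exp_sub_exp_le (by positivity) hu hv.le
    · refine mul_le_of_le_one_left (by positivity) ?_
      have := Real.log_nonneg (by norm_num : (1 : ℝ) ≤ 2)
      linarith
  have e : gamTail v - gamTail u = -Real.log (2 * Real.pi) * (Real.exp (-v) - Real.exp (-u)) +
      ((∑' k : ℕ, tailCoeff k * Real.exp (-(2 * k + 3) * v)) -
      ∑' k : ℕ, tailCoeff k * Real.exp (-(2 * k + 3) * u)) := by
    rw [gamTail, gamTail]; ring
  rw [e]
  refine (abs_add_le _ _).trans ?_
  rw [abs_mul, abs_neg, abs_of_nonneg hl]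
  have h3 := mul_le_mul_of_nonneg_left h1 hl
  calc _ ≤ Real.log (2 * Real.pi) * (1 / u * |v - u|) + 1 / u * |v - u| := add_le_add h3 h2
    _ = _ := by ring

lemma lapInt_exp_neg {b : ℝ} (hb : 0 ≤ b) : LapInt (fun u ↦ Real.exp (-b * u)) 0 :=
  ((lapInt_one.exp_mul b).mono (by linarith)).congr fun u _ ↦ by simp

lemma lap_exp_neg {b : ℝ} (hb : 0 ≤ b) {z : ℂ} (hz : 0 < z.re) :
    lap (fun u ↦ Real.exp (-b * u)) z = 1 / (z + b) := by
  have h := lap_exp_mul (fun _ ↦ 1) b z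
  rw [lap_one (by simp; linarith)] at h
  simpa using h

lemma measurable_gamTail : Measurable gamTail := by
  unfold gamTail
  refine Measurable.add (by fun_prop) (Measurable.tsum fun k ↦ by fun_prop)

lemma lapInt_gamTail : LapInt gamTail 0 := by
  have hl : 0 ≤ Real.log (2 * Real.pi) := Real.log_nonneg (by linarith [Real.pi_gt_three])
  refine lapInt_of_bound (n := 0) (C := Real.log (2 * Real.pi) + 1)
    measurable_gamTail.aestronglyMeasurable fun u hu ↦ ?_
  rw [pow_zero, mul_one, gamTail]
  refine (abs_add_le _ _).trans (add_le_add ?_ ?_)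
  · rw [abs_mul, abs_neg, abs_of_nonneg hl, Real.abs_exp]
    exact mul_le_of_le_one_right hl (Real.exp_le_one_iff.2 (by linarith))
  · rw [abs_of_nonneg (tail_sum_nonneg u)]
    calc _ ≤ ∑' k, tailCoeff k := by
          refine (summable_gamTail hu.le).tsum_le_tsum (fun k ↦ ?_) hasSum_tailCoeff.summable
          refine mul_le_of_le_one_right (tailCoeff_pos k).le (Real.exp_le_one_iff.2 ?_)
          have : 0 ≤ (2 * (k : ℝ) + 3) * u := by positivity
          linarith
      _ ≤ 1 := by
          rw [hasSum_tailCoeff.tsum_eq]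
          have := Real.log_nonneg (by norm_num : (1 : ℝ) ≤ 2)
          linarith

lemma lap_gamTail {s : ℝ} (hs : 0 < s) :
    lap gamTail s = ((-Real.log (2 * Real.pi) / (s + 1) + ((1 - Real.log 2) / s -
      (digammaR ((s + 1) / 2 + 1) + Real.eulerMascheroniConstant) / (2 * ((s + 1) * s))) : ℝ) :
        ℂ) := by
  have hz : 0 < (s : ℂ).re := by simpa using hs
  have hexp := (lapInt_exp_neg zero_le_one).const_mul (-Real.log (2 * Real.pi))
  have hI1 : LapInt (fun u ↦ -Real.log (2 * Real.pi) * Real.exp (-u)) 0 :=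
    hexp.congr fun u _ ↦ by simp
  have hI2 : LapInt (fun u ↦ ∑' k : ℕ, tailCoeff k * Real.exp (-(2 * k + 3) * u)) 0 :=
    (lapInt_gamTail.sub hI1).congr fun u _ ↦ by rw [gamTail]; ring
  have h1 : lap (fun u ↦ -Real.log (2 * Real.pi) * Real.exp (-u)) s =
      ((-Real.log (2 * Real.pi) / (s + 1) : ℝ) : ℂ) := by
    have := lap_const_mul (fun u ↦ Real.exp (-1 * u)) (-Real.log (2 * Real.pi)) s
    rw [lap_exp_neg zero_le_one hz] at this
    simp only [neg_one_mul] at this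
    rw [this]
    push_cast
    ring
  have hterm : ∀ k : ℕ, IntegrableOn (fun u : ℝ ↦ tailCoeff k * Real.exp (-(2 * k + 3) * u) *
      Real.exp (-s * u)) (Ioi 0) := fun k ↦
    ((lapInt_exp_neg (by positivity : (0 : ℝ) ≤ 2 * k + 3)).const_mul (tailCoeff k)) s hs
  have hval : ∀ k : ℕ, ∫ u in Ioi (0 : ℝ), tailCoeff k * Real.exp (-(2 * k + 3) * u) *
      Real.exp (-s * u) = tailCoeff k / (s + (2 * k + 3)) := fun k ↦ by
    have h3 := lap_const_mul (fun u ↦ Real.exp (-(2 * k + 3) * u)) (tailCoeff k) s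
    rw [lap_exp_neg (by positivity) hz, lap_ofReal] at h3
    have h4 : ((∫ u in Ioi (0 : ℝ), tailCoeff k * Real.exp (-(2 * k + 3) * u) *
      Real.exp (-s * u) : ℝ) : ℂ) = ((tailCoeff k / (s + (2 * k + 3)) : ℝ) : ℂ) := by
      rw [h3]; push_cast; ring
    exact_mod_cast h4
  have hsum := hasSum_integral_of_summable_integral_norm (μ := volume.restrict (Ioi (0 : ℝ)))
    (F := fun (k : ℕ) (u : ℝ) ↦ tailCoeff k * Real.exp (-(2 * k + 3) * u) * Real.exp (-s * u))
    hterm (by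
      have e : ∀ (k : ℕ) (u : ℝ), ‖tailCoeff k * Real.exp (-(2 * k + 3) * u) * Real.exp (-s * u)‖ =
          tailCoeff k * Real.exp (-(2 * k + 3) * u) * Real.exp (-s * u) := fun k u ↦
        Real.norm_of_nonneg (mul_nonneg (mul_nonneg (tailCoeff_pos k).le (Real.exp_pos _).le)
          (Real.exp_pos _).le)
      simp_rw [e, hval]
      exact (hasSum_tailCoeff_div' hs).summable)
  simp_rw [hval] at hsum
  have h2 : lap (fun u ↦ ∑' k : ℕ, tailCoeff k * Real.exp (-(2 * k + 3) * u)) s =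
      (((1 - Real.log 2) / s -
      (digammaR ((s + 1) / 2 + 1) + Real.eulerMascheroniConstant) / (2 * ((s + 1) * s)) : ℝ) :
        ℂ) := by
    rw [lap_ofReal, (hasSum_tailCoeff_div' hs).unique hsum]
    simp_rw [tsum_mul_right]
  have h0 : lap gamTail s = lap (fun u ↦ -Real.log (2 * Real.pi) * Real.exp (-u) +
    ∑' k : ℕ, tailCoeff k * Real.exp (-(2 * k + 3) * u)) s := rfl
  rw [h0, lap_add hI1 hI2 hz, h1, h2, ← Complex.ofReal_add]

end Robin

namespace Robin

open Set Filter Topology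

lemma abs_log_one_sub_add_le {x : ℝ} (hx0 : 0 ≤ x) (hx : x < 1) (n : ℕ) :
    |(∑ i ∈ Finset.range n, x ^ (i + 1) / (i + 1)) + Real.log (1 - x)| ≤
      x ^ (n + 1) / (1 - x) := by
  have := Real.abs_log_sub_add_sum_range_le (x := x) (by rwa [abs_of_nonneg hx0]) n
  rwa [abs_of_nonneg hx0] at this

lemma two_div_le_log {x : ℝ} (hx : 0 ≤ x) (hx1 : x < 1) :
    2 * x ≤ Real.log ((1 + x) / (1 - x)) := by
  have h := Real.hasSum_log_sub_log_of_abs_lt_one (x := x) (by rwa [abs_of_nonneg hx])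
  rw [Real.log_div (by linarith) (by linarith)]
  have := le_hasSum h 0 fun j _ ↦ by positivity
  simpa using this

lemma log_le_half_sub_inv {y : ℝ} (hy : 1 ≤ y) : Real.log y ≤ (y - 1 / y) / 2 := by
  have h := Real.sinh_sub_id_strictMono.monotone (Real.log_nonneg hy)
  have hy0 : 0 < y := by linarith
  simp only [Real.sinh_zero, sub_zero] at h
  rw [Real.sinh_eq, Real.exp_neg, Real.exp_log hy0] at h
  rw [one_div]
  linarith

lemma tendsto_harmonic_sub_log_of {f : ℕ → ℝ} (hf : Tendsto f atTop (𝓝 0)) :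
    Tendsto (fun n : ℕ ↦ (harmonic n : ℝ) - Real.log n + f n) atTop
      (𝓝 Real.eulerMascheroniConstant) := by
  simpa using Real.tendsto_harmonic_sub_log.add hf

lemma le_eulerMascheroni {n : ℕ} (hn : 1 ≤ n) :
    (harmonic n : ℝ) - Real.log n - 1 / (2 * n) ≤ Real.eulerMascheroniConstant := by
  set g : ℕ → ℝ := fun n ↦ (harmonic n : ℝ) - Real.log n - 1 / (2 * n) with hg
  have hmono : ∀ m, n ≤ m → g n ≤ g m := by
    intro m hm
    induction m, hm using Nat.le_induction with
    | base => exact le_rfl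
    | succ m hm ih =>
      refine ih.trans ?_
      have hm0 : (0 : ℝ) < m := by exact_mod_cast (hn.trans hm)
      have h := log_le_half_sub_inv (y := (m + 1) / m) (by rw [le_div_iff₀ hm0]; linarith)
      rw [Real.log_div (by positivity) hm0.ne'] at h
      simp only [hg, harmonic_succ]
      push_cast
      have e : ((m + 1) / m - 1 / ((m + 1) / m)) / 2 = 1 / (2 * (m : ℝ)) + 1 / (2 * (m + 1)) := by
        field_simp
        ring
      have e2 : ((m : ℝ) + 1)⁻¹ - 1 / (2 * (m + 1)) = 1 / (2 * (m + 1)) := by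
        field_simp
        ring
      linarith
  have hlim : Tendsto g atTop (𝓝 Real.eulerMascheroniConstant) := by
    have h0 : Tendsto (fun n : ℕ ↦ -(1 / (2 * (n : ℝ)))) atTop (𝓝 0) := by
      have : Tendsto (fun n : ℕ ↦ -(1 / 2) * (1 / (n : ℝ))) atTop (𝓝 (-(1 / 2) * 0)) :=
        tendsto_one_div_atTop_nhds_zero_nat.const_mul _
      rw [mul_zero] at this
      refine this.congr fun n ↦ ?_
      ring
    exact tendsto_harmonic_sub_log_of h0
  exact ge_of_tendsto hlim (eventually_atTop.2 ⟨n, hmono⟩)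

lemma eulerMascheroni_le {n : ℕ} (hn : 1 ≤ n) :
    Real.eulerMascheroniConstant ≤ (harmonic n : ℝ) - Real.log (n + 1 / 2) := by
  set g : ℕ → ℝ := fun n ↦ (harmonic n : ℝ) - Real.log (n + 1 / 2) with hg
  have hmono : ∀ m, n ≤ m → g m ≤ g n := by
    intro m hm
    induction m, hm using Nat.le_induction with
    | base => exact le_rfl
    | succ m hm ih =>
      refine le_trans ?_ ih
      have hm0 : (0 : ℝ) < m := by exact_mod_cast (hn.trans hm)
      have h := two_div_le_log (x := 1 / (2 * (m + 1))) (by positivity)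
        (by rw [div_lt_one (by positivity)]; linarith)
      have e : (1 + 1 / (2 * ((m : ℝ) + 1))) / (1 - 1 / (2 * (m + 1))) =
          (m + 1 + 1 / 2) / (m + 1 / 2) := by
        have : (2 * ((m : ℝ) + 1) - 1) ≠ 0 := by linarith
        field_simp
        ring
      rw [e, Real.log_div (by positivity) (by positivity)] at h
      simp only [hg, harmonic_succ]
      push_cast
      have e2 : 2 * (1 / (2 * ((m : ℝ) + 1))) = ((m : ℝ) + 1)⁻¹ := by
        field_simp
      linarith
  have hlim : Tendsto g atTop (𝓝 Real.eulerMascheroniConstant) := by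
    have h0 : Tendsto (fun n : ℕ ↦ Real.log n - Real.log (n + 1 / 2)) atTop (𝓝 0) := by
      have h1 : Tendsto (fun n : ℕ ↦ -Real.log (1 + (1 / 2) * (1 / (n : ℝ)))) atTop
          (𝓝 (-Real.log (1 + (1 / 2) * 0))) := by
        refine (Tendsto.log ?_ (by norm_num)).neg
        exact (tendsto_one_div_atTop_nhds_zero_nat.const_mul _).const_add 1
      simp only [mul_zero, add_zero, Real.log_one, neg_zero] at h1
      refine h1.congr' ?_
      filter_upwards [eventually_gt_atTop 0] with n hn
      have hn0 : (0 : ℝ) < n := by exact_mod_cast hn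
      have : (n : ℝ) + 1 / 2 = n * (1 + (1 / 2) * (1 / (n : ℝ))) := by field_simp
      rw [this, Real.log_mul hn0.ne' (by positivity)]
      ring
    refine (tendsto_harmonic_sub_log_of h0).congr fun n ↦ ?_
    simp only [hg]
    ring
  exact le_of_tendsto hlim (eventually_atTop.2 ⟨n, hmono⟩)

lemma harmonic_thirty_two : (harmonic 32 : ℝ) = 586061125622639 / 144403552893600 := by
  have : harmonic 32 = 586061125622639 / 144403552893600 := by
    norm_num [harmonic, Finset.sum_range_succ]
  rw [this]
  norm_num

lemma eulerMascheroni_gt : 0.5771 < Real.eulerMascheroniConstant := by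
  have h := le_eulerMascheroni (n := 32) (by norm_num)
  rw [harmonic_thirty_two] at h
  have h2 : Real.log (32 : ℕ) = 5 * Real.log 2 := by
    rw [← Real.log_rpow (by norm_num)]; norm_num
  rw [h2] at h
  norm_num at h
  have := Real.log_two_lt_d9
  norm_num at this ⊢
  linarith

lemma eulerMascheroni_lt : Real.eulerMascheroniConstant < 0.5773 := by
  have h := eulerMascheroni_le (n := 32) (by norm_num)
  rw [harmonic_thirty_two] at h
  have h2 : Real.log ((32 : ℕ) + 1 / 2) = 5 * Real.log 2 + Real.log ((1 + 1 / 129) / (1 - 1 / 129)) := by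
    rw [← Real.log_rpow (by norm_num), ← Real.log_mul (by norm_num) (by norm_num)]; norm_num
  have h3 := two_div_le_log (x := 1 / 129) (by norm_num) (by norm_num)
  rw [h2] at h
  have := Real.log_two_gt_d9
  norm_num at this h h3 ⊢
  linarith

lemma log_four_pi_bounds : 2.5309 < Real.log (4 * Real.pi) ∧ Real.log (4 * Real.pi) < 2.5311 := by
  have h1 := abs_le.1 (abs_log_one_sub_add_le (x := 0.21460) (by norm_num) (by norm_num) 9)
  have hp := Real.pi_gt_d6
  have hp' := Real.pi_lt_d6
  have hl := Real.log_two_gt_d9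
  have hl' := Real.log_two_lt_d9
  have e : Real.log (4 * Real.pi) = 4 * Real.log 2 + Real.log (Real.pi / 4) := by
    rw [← Real.log_rpow (by norm_num), ← Real.log_mul (by norm_num) (by positivity)]
    congr 1
    norm_num
    ring
  have hb1 : Real.log (1 - 0.21460) - 0.00001 ≤ Real.log (Real.pi / 4) := by
    have h3 : 1 - 0.21460 ≤ Real.pi / 4 * (1 + 0.00001) := by
      norm_num at hp ⊢
      linarith
    have h4 := Real.log_le_log (by norm_num) h3
    rw [Real.log_mul (by positivity) (by norm_num)] at h4
    have h5 := Real.log_le_sub_one_of_pos (by norm_num : (0 : ℝ) < 1 + 0.00001)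
    norm_num at h4 h5 ⊢
    linarith
  have hb2 : Real.log (Real.pi / 4) ≤ Real.log (1 - 0.21460) := by
    apply Real.log_le_log (by positivity)
    norm_num at hp' ⊢
    linarith
  rw [e]
  norm_num [Finset.sum_range_succ] at h1 hl hl' hb1 hb2 ⊢
  constructor <;> linarith

end Robin

namespace Robin

open Set Filter Topology MeasureTheory

/-- The value of the logarithmic derivative of `xi` at `1`. -/
noncomputable def xiConst : ℝ :=
  1 + Real.eulerMascheroniConstant - (Real.eulerMascheroniConstant + Real.log (4 * Real.pi)) / 2

lemma xiConst_pos : 0 < xiConst := by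
  have h1 := eulerMascheroni_gt
  have h2 := log_four_pi_bounds.2
  rw [xiConst]
  norm_num at h1 h2 ⊢
  linarith

lemma four_mul_xiConst_lt : 4 * xiConst < 0.0928 := by
  have h1 := eulerMascheroni_lt
  have h2 := log_four_pi_bounds.1
  rw [xiConst]
  norm_num at h1 h2 ⊢
  linarith

lemma xiLog_eq {s : ℂ} (hs : 0 < s.re) (hz : riemannZeta₁ s ≠ 0) :
    xiLog s = 1 / s + deriv riemannZeta₁ s / riemannZeta₁ s +
      deriv Complex.Gammaℝ s / Complex.Gammaℝ s := by
  have hs0 : s ≠ 0 := fun h ↦ by simp [h] at hs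
  have hG : Complex.Gammaℝ s ≠ 0 := Complex.Gammaℝ_ne_zero_of_re_pos hs
  have hev : xi =ᶠ[𝓝 s] fun w ↦ w * riemannZeta₁ w * Complex.Gammaℝ w := by
    filter_upwards [(isOpen_lt continuous_const Complex.continuous_re).mem_nhds hs] with w hw
    exact xi_eq hw
  have hd1 := (differentiable_riemannZeta₁ s).hasDerivAt
  have hd2 : HasDerivAt Complex.Gammaℝ (deriv Complex.Gammaℝ s) s := by
    refine DifferentiableAt.hasDerivAt ?_
    have : Complex.Gammaℝ = fun w ↦ ((Real.pi : ℂ) ^ (-w / 2)) * Complex.Gamma (w / 2) := by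
      funext w
      rw [Complex.Gammaℝ_def]
    rw [this]
    refine DifferentiableAt.mul ?_ ?_
    · refine DifferentiableAt.const_cpow (by fun_prop) (Or.inl ?_)
      exact_mod_cast Real.pi_ne_zero
    · refine DifferentiableAt.comp s (Complex.differentiableAt_Gamma _ fun m h ↦ ?_) (by fun_prop)
      have := congrArg Complex.re h
      simp at this
      have hm : (0 : ℝ) ≤ m := m.cast_nonneg
      linarith
  have hd := ((hasDerivAt_id s).mul hd1).mul hd2
  have hd' : deriv xi s = _ := (hd.congr_of_eventuallyEq hev).deriv
  rw [xiLog, hd', hev.eq_of_nhds]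
  simp only [id, Pi.mul_apply]
  field_simp

lemma xiLog_one : xiLog 1 = xiConst := by
  rw [xiLog_eq (by simp) (by simp [riemannZeta₁_one]), deriv_riemannZeta₁_one, riemannZeta₁_one,
    Complex.Gammaℝ_one, Complex.hasDerivAt_Gammaℝ_one.deriv, xiConst]
  push_cast [Complex.ofReal_log (by positivity : 0 ≤ 4 * Real.pi)]
  ring

lemma logDeriv_Gammaℝ {w : ℝ} (hw : 0 < w) :
    deriv Complex.Gammaℝ w / Complex.Gammaℝ w =
      ((-Real.log Real.pi / 2 + digammaR (w / 2) / 2 : ℝ) : ℂ) := by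
  have hG : Complex.Gamma ((w : ℂ) / 2) ≠ 0 := by
    refine Complex.Gamma_ne_zero_of_re_pos ?_
    simpa using hw
  have hpi : (Real.pi : ℂ) ≠ 0 := by exact_mod_cast Real.pi_ne_zero
  have h1 : HasDerivAt (fun z : ℂ ↦ (Real.pi : ℂ) ^ (-z / 2))
      ((Real.pi : ℂ) ^ (-(w : ℂ) / 2) * Complex.log Real.pi * (-1 / 2)) w :=
    ((hasDerivAt_id (w : ℂ)).neg.div_const 2).const_cpow (Or.inl hpi)
  have h2 : HasDerivAt (fun z : ℂ ↦ Complex.Gamma (z / 2))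
      (deriv Complex.Gamma ((w : ℂ) / 2) * (1 / 2)) w := by
    refine HasDerivAt.comp (w : ℂ) (h₂ := Complex.Gamma) (h := fun z : ℂ ↦ z / 2)
      (DifferentiableAt.hasDerivAt ?_) ((hasDerivAt_id (w : ℂ)).div_const 2)
    refine Complex.differentiableAt_Gamma _ fun m h ↦ ?_
    have := congrArg Complex.re h
    simp at this
    have hm : (0 : ℝ) ≤ m := m.cast_nonneg
    linarith
  have h3 : Complex.Gammaℝ = fun z ↦ ((Real.pi : ℂ) ^ (-z / 2)) * Complex.Gamma (z / 2) := by
    funext z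
    rw [Complex.Gammaℝ_def]
  have h4 := (h1.mul h2).congr_of_eventuallyEq (f₁ := Complex.Gammaℝ)
    (Filter.Eventually.of_forall fun z ↦ congrFun h3 z)
  have h4' := h4.deriv
  have h5 := digamma_ofReal (by linarith : 0 < w / 2)
  rw [Complex.digamma_def, logDeriv_apply] at h5
  push_cast at h5
  have h6 : deriv Complex.Gamma ((w : ℂ) / 2) =
      digammaR (w / 2) * Complex.Gamma ((w : ℂ) / 2) := by
    rw [← h5]; field_simp
  have h7 : (Real.pi : ℂ) ^ (-(w : ℂ) / 2) ≠ 0 := by simp [Complex.cpow_eq_zero_iff, hpi]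
  rw [h4', Complex.Gammaℝ_def, h6, ← Complex.ofReal_log Real.pi_pos.le]
  push_cast
  field_simp

lemma logDeriv_riemannZeta₁ {s : ℂ} (hs : 1 < s.re) :
    deriv riemannZeta₁ s / riemannZeta₁ s = 1 / (s - 1) + deriv riemannZeta s / riemannZeta s := by
  have hs1 : s ≠ 1 := fun h ↦ by simp [h] at hs
  have hs1' : s - 1 ≠ 0 := sub_ne_zero.2 hs1
  have hz : riemannZeta s ≠ 0 := riemannZeta_ne_zero_of_one_lt_re hs
  have hev : riemannZeta₁ =ᶠ[𝓝 s] fun w ↦ (w - 1) * riemannZeta w := by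
    filter_upwards [isOpen_ne.mem_nhds hs1] with w hw
    exact riemannZeta₁_eq_mul hw
  have hd := (((hasDerivAt_id s).sub_const 1).mul (differentiableAt_riemannZeta hs1).hasDerivAt)
  have hd' : deriv riemannZeta₁ s = _ := (hd.congr_of_eventuallyEq hev).deriv
  rw [hd', hev.eq_of_nhds]
  simp only [id]
  field_simp

/-- The numerator in Richards' transform of `xiLog`. -/
noncomputable def richNum (w : ℂ) : ℂ := (2 * w - 1) * xiConst - xiLog w

/-- Richards' transform of `xiLog`. -/
noncomputable def rich (w : ℂ) : ℂ := dslope richNum 1 w / w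

lemma rich_eq {w : ℂ} (hw : w ≠ 1) : rich w = richNum w / (w * (w - 1)) := by
  have h1 : richNum 1 = 0 := by rw [richNum, xiLog_one]; ring
  rw [rich, dslope_of_ne _ hw, slope_def_field, h1, sub_zero, div_div, mul_comm]

lemma differentiableOn_xiLog (hRH : RiemannHypothesis) :
    DifferentiableOn ℂ xiLog {w | 1 / 2 < w.re} := fun w hw ↦ by
  have h1 : Differentiable ℂ (deriv xi) := differentiable_xi.deriv
  exact ((h1 w).div (differentiable_xi w) (xi_ne_zero hRH hw)).differentiableWithinAt

lemma differentiableOn_rich (hRH : RiemannHypothesis) :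
    DifferentiableOn ℂ rich {w | 1 / 2 < w.re} := by
  have ho : IsOpen {w : ℂ | 1 / 2 < w.re} := isOpen_lt continuous_const Complex.continuous_re
  have h1 : DifferentiableOn ℂ richNum {w | 1 / 2 < w.re} :=
    DifferentiableOn.sub (by fun_prop) (differentiableOn_xiLog hRH)
  have h2 := (Complex.differentiableOn_dslope (c := 1) (ho.mem_nhds (by norm_num))).2 h1
  refine h2.div differentiableOn_id fun w hw h0 ↦ ?_
  have hw : 1 / 2 < w.re := hw
  change w = 0 at h0
  rw [h0] at hw
  norm_num at hw

lemma re_rich_nonneg (hRH : RiemannHypothesis) {w : ℂ} (hw : 1 / 2 < w.re) : 0 ≤ (rich w).re := by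
  have ho : IsOpen {w : ℂ | 1 / 2 < w.re} := isOpen_lt continuous_const Complex.continuous_re
  have key : ∀ w : ℂ, 1 / 2 < w.re → w ≠ 1 → 0 ≤ (rich w).re := by
    intro w hw hw1
    have hd : DifferentiableOn ℂ (fun z : ℂ ↦ xiLog (z + 1 / 2)) {z | 0 < z.re} := by
      refine (differentiableOn_xiLog hRH).comp (by fun_prop) fun z hz ↦ ?_
      have hz : 0 < z.re := hz
      simp
      linarith
    have hval : xiLog (((1 / 2 : ℝ) : ℂ) + 1 / 2) = xiConst := by
      rw [← xiLog_one]; norm_num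
    have h := re_richards_nonneg xiConst_pos one_half_pos hd (fun z hz ↦
      re_xiLog_nonneg hRH (by simp; linarith)) hval (z := w - 1 / 2)
      (by simp; norm_num at hw ⊢; linarith) (fun h ↦ hw1 (by
        have := congrArg (· + (1 / 2 : ℂ)) h
        norm_num at this
        exact this))
    have hw0 : w ≠ 0 := fun h0 ↦ by rw [h0] at hw; norm_num at hw
    have hw1' : w - 1 ≠ 0 := sub_ne_zero.2 hw1
    have e : rich w = 2 * (((w - 1 / 2) * xiConst - ((1 / 2 : ℝ) : ℂ) *
        xiLog (w - 1 / 2 + 1 / 2)) / ((w - 1 / 2) ^ 2 - ((1 / 2 : ℝ) : ℂ) ^ 2)) := by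
      have e1 : (w - 1 / 2) ^ 2 - ((1 / 2 : ℝ) : ℂ) ^ 2 = w * (w - 1) := by push_cast; ring
      rw [rich_eq hw1, richNum, e1, sub_add_cancel]
      push_cast
      field_simp
    rw [e]
    simpa using h
  rcases eq_or_ne w 1 with rfl | hw1
  · have hc : ContinuousAt rich 1 :=
      ((differentiableOn_rich hRH).differentiableAt (ho.mem_nhds hw)).continuousAt
    have hc2 : Tendsto (fun z ↦ (rich z).re) (𝓝[≠] 1) (𝓝 (rich 1).re) :=
      ((Complex.continuous_re.tendsto _).comp hc.tendsto).mono_left nhdsWithin_le_nhds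
    refine ge_of_tendsto hc2 ?_
    filter_upwards [self_mem_nhdsWithin, nhdsWithin_le_nhds (ho.mem_nhds hw)] with z hz1 hz2
    exact key z hz2 hz1
  · exact key w hw hw1

end Robin

namespace Robin

open Set Filter Topology MeasureTheory

/-- The part of `psiPrim` which is accounted for by the non-trivial zeros of `ζ`. -/
noncomputable def zeroSum (u : ℝ) : ℝ := psiPrim u - gamTail u

lemma lapInt_zeroSum : LapInt zeroSum 0 := lapInt_psiPrim.sub lapInt_gamTail

lemma lap_zeroSum_ofReal {s : ℝ} (hs : 0 < s) : lap zeroSum s = -rich (1 + s) := by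
  have hs0 : (s : ℂ) ≠ 0 := by exact_mod_cast hs.ne'
  have hw0 : (1 + s : ℂ) ≠ 0 := by exact_mod_cast (by positivity : (1 + s : ℝ) ≠ 0)
  have hw0' : (s + 1 : ℂ) ≠ 0 := by rwa [add_comm]
  have hre : (0 : ℝ) < (s : ℂ).re := hs
  have hw1 : (1 : ℝ) < (1 + s : ℂ).re := by simp [hs]
  have hz : riemannZeta (1 + s) ≠ 0 := riemannZeta_ne_zero_of_one_lt_re hw1
  have hne : (1 + s : ℂ) ≠ 1 := fun h ↦ hs0 (by simpa using h)
  have hz1 : riemannZeta₁ (1 + s) ≠ 0 := by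
    rw [riemannZeta₁_eq_mul hne]
    exact mul_ne_zero (by simpa using hs0) hz
  have hG := logDeriv_Gammaℝ (by positivity : 0 < 1 + s)
  have hd := digammaR_add_one (by positivity : 0 < (1 + s) / 2)
  push_cast at hG
  have hl4 : Real.log (4 * Real.pi) = 2 * Real.log 2 + Real.log Real.pi := by
    rw [show 4 * Real.pi = 2 * (2 * Real.pi) by ring, Real.log_mul two_ne_zero (by positivity),
      Real.log_mul two_ne_zero Real.pi_ne_zero]
    ring
  rw [show (zeroSum) = fun u ↦ psiPrim u - gamTail u from rfl,
    lap_sub lapInt_psiPrim lapInt_gamTail hre, lap_psiPrim hre, lap_gamTail hs, rich_eq hne,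
    richNum, xiLog_eq (by linarith) hz1, hG, logDeriv_riemannZeta₁ hw1, add_comm s 1, hd, xiConst,
    hl4, Real.log_mul two_ne_zero Real.pi_ne_zero, add_comm (s : ℂ) 1]
  obtain ⟨Z, hZ⟩ : ∃ Z, deriv riemannZeta (1 + s) = Z * riemannZeta (1 + s) :=
    ⟨deriv riemannZeta (1 + s) / riemannZeta (1 + s), by field_simp⟩
  rw [hZ]
  generalize digammaR ((1 + s) / 2) = D
  push_cast
  rw [add_sub_cancel_left]
  field_simp
  ring

lemma lap_zeroSum (hRH : RiemannHypothesis) {z : ℂ} (hz : 0 < z.re) :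
    lap zeroSum z = -rich (1 + z) := by
  have ho : IsOpen {z : ℂ | 0 < z.re} := isOpen_lt continuous_const Complex.continuous_re
  have hd1 : DifferentiableOn ℂ (lap zeroSum) {z | 0 < z.re} := differentiableOn_lap lapInt_zeroSum
  have hd2 : DifferentiableOn ℂ (fun z ↦ -rich (1 + z)) {z | 0 < z.re} := by
    refine ((differentiableOn_rich hRH).comp (t := {w : ℂ | 1 / 2 < w.re}) (by fun_prop)
      fun z hz ↦ ?_).neg
    have hz : 0 < z.re := hz
    change 1 / 2 < (1 + z).re
    simp
    linarith
  refine (hd1.analyticOnNhd ho).eqOn_of_preconnected_of_frequently_eq (hd2.analyticOnNhd ho)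
    (convex_halfSpace_re_gt 0).isPreconnected (z₀ := ((1 : ℝ) : ℂ)) (by simp) ?_ hz
  have ht : Tendsto (fun n : ℕ ↦ (((1 : ℝ) + 1 / ((n : ℝ) + 1) : ℝ) : ℂ)) atTop
      (𝓝[≠] (((1 : ℝ) : ℂ))) := by
    refine tendsto_nhdsWithin_iff.2 ⟨?_, Eventually.of_forall fun n ↦ ?_⟩
    · refine (Complex.continuous_ofReal.tendsto _).comp ?_
      simpa using (tendsto_const_nhds (x := (1 : ℝ))).add tendsto_one_div_add_atTop_nhds_zero_nat
    · have : (0 : ℝ) < 1 / ((n : ℝ) + 1) := by positivity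
      intro h
      have h : (((1 : ℝ) + 1 / ((n : ℝ) + 1) : ℝ) : ℂ) = ((1 : ℝ) : ℂ) := h
      rw [Complex.ofReal_inj] at h
      linarith
  refine ht.frequently (Frequently.of_forall fun n ↦ ?_)
  exact lap_zeroSum_ofReal (by positivity)

lemma re_rich_le (hRH : RiemannHypothesis) {s : ℝ} (hs : 0 < s) :
    (rich (1 + s)).re ≤ 2 * xiConst / s := by
  have hs0 : (s : ℂ) ≠ 0 := by exact_mod_cast hs.ne'
  have hne : (1 + s : ℂ) ≠ 1 := fun h ↦ hs0 (by simpa using h)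
  have h0 : 0 ≤ (xiLog (1 + s)).re := re_xiLog_nonneg hRH (by simp; norm_num; linarith)
  have hc := xiConst_pos
  have e : rich (1 + s) = ((((1 + s) * s)⁻¹ : ℝ) : ℂ) * ((((2 * s + 1) * xiConst : ℝ) : ℂ) -
      xiLog (1 + s)) := by
    rw [rich_eq hne, richNum]
    push_cast
    rw [add_sub_cancel_left, div_eq_inv_mul]
    ring
  rw [e, Complex.re_ofReal_mul, Complex.sub_re, Complex.ofReal_re, inv_mul_le_iff₀ (by positivity)]
  have : (1 + s) * s * (2 * xiConst / s) = (2 * s + 2) * xiConst := by field_simp; ring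
  rw [this]
  linarith

lemma abs_integral_zeroSum_le (hRH : RiemannHypothesis) {s : ℝ} (hs : 0 < s) {n : ℕ} (hn : n ≠ 0) :
    |∫ v in Ioi 0, v ^ n * zeroSum v * Real.exp (-s * v)| ≤
      n.factorial * (4 * xiConst / s / (s + 1 / 2) ^ n) := by
  have hd : DifferentiableOn ℂ (fun z ↦ rich (1 + z)) {z | -1 / 2 < z.re} := by
    refine (differentiableOn_rich hRH).comp (t := {w : ℂ | 1 / 2 < w.re}) (by fun_prop)
      fun z hz ↦ ?_
    have hz : -1 / 2 < z.re := hz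
    change 1 / 2 < (1 + z).re
    simp
    linarith
  have hsub : ∀ r : ℝ, r < s + 1 / 2 → Metric.closedBall (s : ℂ) r ⊆ {z | -1 / 2 < z.re} := by
    intro r hr z hz
    have h1 := (Complex.abs_re_le_norm (z - s)).trans (mem_closedBall_iff_norm.1 hz)
    rw [Complex.sub_re, Complex.ofReal_re] at h1
    have := (abs_le.1 h1).1
    change -1 / 2 < z.re
    linarith
  have hev : lap zeroSum =ᶠ[𝓝 (s : ℂ)] fun z ↦ -rich (1 + z) := by
    filter_upwards [(isOpen_lt continuous_const Complex.continuous_re).mem_nhds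
      (show (0 : ℝ) < (s : ℂ).re from hs)] with z hz
    exact lap_zeroSum hRH hz
  have e1 : ‖iteratedDeriv n (lap zeroSum) s‖ =
      |∫ v in Ioi 0, v ^ n * zeroSum v * Real.exp (-s * v)| := by
    rw [iteratedDeriv_lap lapInt_zeroSum n (by simpa using hs), lap_ofReal]
    simp
  have e2 : iteratedDeriv n (lap zeroSum) s = -iteratedDeriv n (fun z ↦ rich (1 + z)) s := by
    rw [hev.iteratedDeriv_eq, iteratedDeriv_fun_neg]
  rw [← e1, e2, norm_neg]
  have hr : ∀ r : ℝ, 0 < r → r < s + 1 / 2 → ‖iteratedDeriv n (fun z ↦ rich (1 + z)) s‖ ≤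
      n.factorial * (4 * xiConst / s / r ^ n) := by
    intro r hr0 hr
    refine (norm_iteratedDeriv_le_of_re_nonneg hn hr0
      (DifferentiableOn.diffContOnCl_ball hd (hsub r hr)) fun z hz ↦ ?_).trans ?_
    · have := hsub r hr (Metric.sphere_subset_closedBall hz)
      have : -1 / 2 < z.re := this
      refine re_rich_nonneg hRH ?_
      simp
      linarith
    · have := re_rich_le hRH hs
      have h4 : 4 * xiConst / s = 2 * (2 * xiConst / s) := by ring
      rw [h4]
      gcongr
  have ht : Tendsto (fun r : ℝ ↦ n.factorial * (4 * xiConst / s / r ^ n)) (𝓝[<] (s + 1 / 2))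
      (𝓝 (n.factorial * (4 * xiConst / s / (s + 1 / 2) ^ n))) := by
    refine (ContinuousAt.tendsto ?_).mono_left nhdsWithin_le_nhds
    have : (s + 1 / 2) ^ n ≠ 0 := by positivity
    fun_prop (disch := assumption)
  refine ge_of_tendsto ht ?_
  filter_upwards [Ioo_mem_nhdsLT (by positivity : (0 : ℝ) < s + 1 / 2)] with r hr'
  exact hr r hr'.1 hr'.2

/-- The contribution of the non-trivial zeros, under the Riemann hypothesis. -/
lemma abs_zeroSum_le (hRH : RiemannHypothesis) {u : ℝ} (hu : 0 < u) :
    |zeroSum u| ≤ 4 * xiConst * Real.exp (-u / 2) := by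
  have hc := xiConst_pos
  set M : ℝ := (Real.log 4 + 4) + (Real.log (2 * Real.pi) + 1) / u with hM
  have hL : ∀ v : ℝ, 0 < v → |zeroSum v - zeroSum u| ≤ M * |v - u| := by
    intro v hv
    have h1 := abs_psiPrim_sub_le u v
    have h2 := abs_gamTail_sub_le hu hv
    rw [zeroSum, zeroSum, hM, add_mul]
    have : psiPrim v - gamTail v - (psiPrim u - gamTail u) =
      (psiPrim v - psiPrim u) - (gamTail v - gamTail u) := by ring
    rw [this]
    exact (abs_sub _ _).trans (by linarith)
  have hb : ∀ n : ℕ, n ≠ 0 → |zeroSum u| ≤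
      4 * xiConst * ((1 + u / 2 / ((n + 1 : ℕ) : ℝ)) / (1 + u / 2 / ((n + 1 : ℕ) : ℝ)) ^ (n + 1)) +
        M * u / √(n + 1) := by
    intro n hn
    have h1 := post_widder lapInt_zeroSum hu hL n
    set s : ℝ := ((n : ℝ) + 1) / u with hs
    have hs0 : 0 < s := by positivity
    have h2 := abs_integral_zeroSum_le hRH hs0 hn
    set I := ∫ v in Ioi 0, v ^ n * zeroSum v * Real.exp (-s * v)
    have h3 : |s ^ (n + 1) / n.factorial * I| ≤ 4 * xiConst *
        ((1 + u / 2 / ((n + 1 : ℕ) : ℝ)) / (1 + u / 2 / ((n + 1 : ℕ) : ℝ)) ^ (n + 1)) := by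
      rw [abs_mul, abs_of_pos (by positivity)]
      refine (mul_le_mul_of_nonneg_left h2 (by positivity)).trans (le_of_eq ?_)
      have e : (1 + u / 2 / ((n + 1 : ℕ) : ℝ)) = (s + 1 / 2) / s := by
        rw [hs]; push_cast; field_simp
      have hf : (n.factorial : ℝ) ≠ 0 := by positivity
      have hs2 : (s + 1 / 2) ≠ 0 := by positivity
      clear_value s
      rw [e, pow_succ ((s + 1 / 2) / s), div_pow, pow_succ s]
      field_simp
    have h4 : |zeroSum u| ≤ |s ^ (n + 1) / n.factorial * I| +
        |s ^ (n + 1) / n.factorial * I - zeroSum u| := by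
      have := abs_sub (s ^ (n + 1) / n.factorial * I) (s ^ (n + 1) / n.factorial * I - zeroSum u)
      rwa [sub_sub_cancel] at this
    linarith
  have ht1 : Tendsto (fun n : ℕ ↦ (1 + u / 2 / ((n + 1 : ℕ) : ℝ)) ^ (n + 1)) atTop
      (𝓝 (Real.exp (u / 2))) :=
    (Real.tendsto_one_add_div_pow_exp (u / 2)).comp (tendsto_add_atTop_nat 1)
  have ht2 : Tendsto (fun n : ℕ ↦ (1 + u / 2 / ((n + 1 : ℕ) : ℝ))) atTop (𝓝 (1 + 0)) :=
    tendsto_const_nhds.add (((tendsto_const_div_atTop_nhds_zero_nat (u / 2))).comp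
      (tendsto_add_atTop_nat 1))
  have ht3 : Tendsto (fun n : ℕ ↦ M * u / √((n : ℝ) + 1)) atTop (𝓝 0) :=
    tendsto_const_nhds.div_atTop (Real.tendsto_sqrt_atTop.comp
      (tendsto_atTop_add_const_right _ _ tendsto_natCast_atTop_atTop))
  have ht := ((ht2.div ht1 (Real.exp_ne_zero _)).const_mul (4 * xiConst)).add ht3
  have e : 4 * xiConst * ((1 + 0) / Real.exp (u / 2)) + 0 = 4 * xiConst * Real.exp (-u / 2) := by
    rw [neg_div, Real.exp_neg]; ring
  rw [e] at ht
  refine ge_of_tendsto ht ?_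
  filter_upwards [eventually_ne_atTop 0] with n hn
  exact hb n hn

end Robin

namespace Robin

open Set Filter Topology MeasureTheory ArithmeticFunction

/-- The sum of `Λ(n) / (n log n)` over `n ≤ x`. -/
noncomputable def mertSum (x : ℝ) : ℝ :=
  ∑ n ∈ Finset.Icc 1 ⌊x⌋₊, vonMangoldt n / (n * Real.log n)

lemma mertSum_mono : Monotone mertSum := fun x y h ↦ by
  refine Finset.sum_le_sum_of_subset_of_nonneg
    (Finset.Icc_subset_Icc_right (Nat.floor_mono h)) fun n _ _ ↦ ?_
  exact div_nonneg vonMangoldt_nonneg (mul_nonneg n.cast_nonneg (Real.log_natCast_nonneg n))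

lemma mertSum_sub {a b : ℝ} (ha : 1 < a) (hab : a ≤ b) :
    mertSum b - mertSum a = Chebyshev.psi b / (b * Real.log b) -
      Chebyshev.psi a / (a * Real.log a) +
      ∫ t in Ioc a b, (Real.log t + 1) / (t * Real.log t) ^ 2 * Chebyshev.psi t := by
  have hd : ∀ t ∈ Icc a b, HasDerivAt (fun t : ℝ ↦ (t * Real.log t)⁻¹)
      (-((Real.log t + 1) / (t * Real.log t) ^ 2)) t := by
    intro t ht
    have ht1 : 1 < t := ha.trans_le ht.1
    have ht0 : t ≠ 0 := by linarith
    have hl : Real.log t ≠ 0 := (Real.log_pos ht1).ne'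
    refine (((hasDerivAt_id t).mul (Real.hasDerivAt_log ht0)).inv
      (mul_ne_zero ht0 hl)).congr_deriv ?_
    simp only [id_eq, ne_eq, ht0, not_false_eq_true, mul_inv_cancel₀, one_mul, Pi.mul_apply]
    ring
  have hcont : ContinuousOn (fun t : ℝ ↦ -((Real.log t + 1) / (t * Real.log t) ^ 2))
      (Icc a b) := by
    have h0 : ∀ t ∈ Icc a b, t ≠ 0 := fun t ht ↦ by linarith [ht.1]
    have hl : ContinuousOn Real.log (Icc a b) := Real.continuousOn_log.mono fun t ht ↦ h0 t ht
    refine ((hl.add continuousOn_const).div ((continuousOn_id.mul hl).pow 2) fun t ht ↦ ?_).neg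
    have ht1 : 1 < t := ha.trans_le ht.1
    exact pow_ne_zero 2 (mul_ne_zero (h0 t ht) (Real.log_pos ht1).ne')
  have h_int : IntegrableOn (deriv fun t : ℝ ↦ (t * Real.log t)⁻¹) (Icc a b) :=
    (hcont.integrableOn_Icc).congr_fun (fun t ht ↦ (hd t ht).deriv.symm) measurableSet_Icc
  have h := sum_mul_eq_sub_sub_integral_mul (fun n ↦ vonMangoldt n) (by linarith) hab
    (fun t ht ↦ (hd t ht).differentiableAt) h_int
  have h1 : mertSum b - mertSum a =
      ∑ k ∈ Finset.Ioc ⌊a⌋₊ ⌊b⌋₊, ((k : ℝ) * Real.log k)⁻¹ * vonMangoldt k := by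
    rw [sub_eq_iff_eq_add', mertSum, mertSum]
    have : Finset.Icc 1 ⌊b⌋₊ = Finset.Icc 1 ⌊a⌋₊ ∪ Finset.Ioc ⌊a⌋₊ ⌊b⌋₊ := by
      have := Nat.floor_mono hab
      ext k
      simp
      omega
    rw [this, Finset.sum_union]
    · congr 1
      exact Finset.sum_congr rfl fun k _ ↦ by rw [div_eq_inv_mul]
    · refine Finset.disjoint_left.2 fun k hk hk' ↦ ?_
      simp at hk hk'
      omega
  have h2 : ∫ t in Ioc a b, deriv (fun t : ℝ ↦ (t * Real.log t)⁻¹) t *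
      ∑ k ∈ Finset.Icc 0 ⌊t⌋₊, vonMangoldt k =
      -∫ t in Ioc a b, (Real.log t + 1) / (t * Real.log t) ^ 2 * Chebyshev.psi t := by
    rw [← integral_neg]
    refine setIntegral_congr_fun measurableSet_Ioc fun t ht ↦ ?_
    rw [(hd t (Ioc_subset_Icc_self ht)).deriv, Chebyshev.psi_eq_sum_Icc, neg_mul]
  rw [h1, h, h2, ← Chebyshev.psi_eq_sum_Icc, ← Chebyshev.psi_eq_sum_Icc, sub_neg_eq_add]
  simp only [div_eq_inv_mul]

/-- `mertSum` in logarithmic scale. -/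
noncomputable def mert (u : ℝ) : ℝ := mertSum (Real.exp u)

lemma mert_mono : Monotone mert := fun _ _ h ↦ mertSum_mono (Real.exp_le_exp.2 h)

lemma mert_sub {u w : ℝ} (hu : 0 < u) (huw : u ≤ w) :
    mert w - mert u = psiNorm w / w - psiNorm u / u +
      ∫ v in u..w, psiNorm v * (1 / v + 1 / v ^ 2) := by
  rw [mert, mert, mertSum_sub (Real.one_lt_exp_iff.2 hu) (Real.exp_le_exp.2 huw), Real.log_exp,
    Real.log_exp, intervalIntegral.integral_of_le huw]
  have him : Real.exp '' Ioc u w = Ioc (Real.exp u) (Real.exp w) := by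
    ext x
    constructor
    · rintro ⟨u, hu, rfl⟩
      exact ⟨Real.exp_lt_exp.2 hu.1, Real.exp_le_exp.2 hu.2⟩
    · intro hx
      have hx0 : 0 < x := (Real.exp_pos u).trans hx.1
      exact ⟨Real.log x, ⟨(Real.lt_log_iff_exp_lt hx0).2 hx.1, (Real.log_le_iff_le_exp hx0).2 hx.2⟩,
        Real.exp_log hx0⟩
  rw [← him, integral_image_eq_integral_abs_deriv_smul measurableSet_Ioc
    (fun x _ ↦ (Real.hasDerivAt_exp x).hasDerivWithinAt) Real.exp_injective.injOn]
  congr 1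
  · rw [psiNorm, psiNorm, Real.exp_neg, Real.exp_neg]
    congr 1 <;> field_simp
  · refine setIntegral_congr_fun measurableSet_Ioc fun v hv ↦ ?_
    have hv : v ≠ 0 := (hu.trans hv.1).ne'
    simp only [smul_eq_mul, Real.abs_exp, Real.log_exp]
    rw [psiNorm, Real.exp_neg]
    field_simp

lemma continuousWithinAt_psiNorm (u : ℝ) : ContinuousWithinAt psiNorm (Ioi u) u := by
  have h : psiNorm =ᶠ[𝓝[>] u] fun v ↦ Chebyshev.psi (Real.exp u) * Real.exp (-v) := by
    have : Real.exp ⁻¹' Iio (⌊Real.exp u⌋₊ + 1 : ℝ) ∈ 𝓝 u :=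
      Real.continuous_exp.continuousAt.preimage_mem_nhds (Iio_mem_nhds (Nat.lt_floor_add_one _))
    filter_upwards [nhdsWithin_le_nhds this, self_mem_nhdsWithin] with v hv1 hv2
    have hv2 : u < v := hv2
    have hf : ⌊Real.exp v⌋₊ = ⌊Real.exp u⌋₊ :=
      (Nat.floor_eq_iff (Real.exp_pos v).le).2
        ⟨(Nat.floor_le (Real.exp_pos u).le).trans (Real.exp_le_exp.2 hv2.le), hv1⟩
    rw [psiNorm, Chebyshev.psi_eq_psi_coe_floor, hf, ← Chebyshev.psi_eq_psi_coe_floor]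
  have h2 : ContinuousWithinAt (fun v ↦ Chebyshev.psi (Real.exp u) * Real.exp (-v)) (Ioi u) u :=
    (by fun_prop : Continuous fun v ↦
      Chebyshev.psi (Real.exp u) * Real.exp (-v)).continuousWithinAt
  exact h2.congr_of_eventuallyEq h rfl

lemma hasDerivWithinAt_psiPrim (u : ℝ) :
    HasDerivWithinAt psiPrim (-(psiNorm u - 1)) (Ioi u) u := by
  refine HasDerivWithinAt.const_sub _ ?_
  exact (intervalIntegral.integral_hasDerivWithinAt_right (s := Ici u) (t := Ioi u)
    ((intervalIntegrable_psiNorm 0 u).sub (by simp))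
    ((measurable_psiNorm.sub_const 1).stronglyMeasurable.stronglyMeasurableAtFilter)
    ((continuousWithinAt_psiNorm u).sub continuousWithinAt_const)).mono Ioi_subset_Ici_self

/-- The error term in the sum of `Λ(n) / (n log n)`, apart from its smooth part. -/
noncomputable def mertErr (u : ℝ) : ℝ := mert u - Real.log u - (psiNorm u - 1) / u

lemma mertErr_sub {u w : ℝ} (hu : 0 < u) (huw : u ≤ w) :
    mertErr w - mertErr u = psiPrim u * (1 / u + 1 / u ^ 2) - psiPrim w * (1 / w + 1 / w ^ 2) -
      ∫ v in u..w, psiPrim v * (1 / v ^ 2 + 2 / v ^ 3) := by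
  have hpos : ∀ v ∈ uIcc u w, 0 < v := fun v hv ↦ by
    rw [uIcc_of_le huw] at hv
    exact hu.trans_le hv.1
  have hdg : ∀ v, 0 < v → HasDerivAt (fun v : ℝ ↦ 1 / v + 1 / v ^ 2)
      (-(1 / v ^ 2 + 2 / v ^ 3)) v := by
    intro v hv
    have h1 := hasDerivAt_inv hv.ne'
    have h2 := (hasDerivAt_pow 2 v).inv (pow_ne_zero 2 hv.ne')
    simp only [one_div]
    refine (h1.add h2).congr_deriv ?_
    field_simp
    norm_num
    ring
  have hcg : ContinuousOn (fun v : ℝ ↦ 1 / v + 1 / v ^ 2) (uIcc u w) := fun v hv ↦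
    (hdg v (hpos v hv)).continuousAt.continuousWithinAt
  have hcg' : ContinuousOn (fun v : ℝ ↦ 1 / v ^ 2 + 2 / v ^ 3) (uIcc u w) := by
    have : ∀ v ∈ uIcc u w, v ≠ 0 := fun v hv ↦ (hpos v hv).ne'
    fun_prop (disch := simpa using this)
  have hlog : ∫ v in u..w, (1 / v + 1 / v ^ 2) = Real.log w - 1 / w - (Real.log u - 1 / u) := by
    refine intervalIntegral.integral_eq_sub_of_hasDerivAt
      (f := fun v ↦ Real.log v - 1 / v) (fun v hv ↦ ?_) hcg.intervalIntegrable
    have hv := hpos v hv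
    simp only [one_div]
    refine ((Real.hasDerivAt_log hv.ne').sub (hasDerivAt_inv hv.ne')).congr_deriv ?_
    ring
  have hB : IntervalIntegrable (fun v ↦ psiNorm v - 1) volume u w :=
    (intervalIntegrable_psiNorm u w).sub (by simp)
  have hparts := intervalIntegral.integral_mul_deriv_eq_deriv_mul_of_hasDeriv_right
    (u := fun v : ℝ ↦ 1 / v + 1 / v ^ 2) (u' := fun v ↦ -(1 / v ^ 2 + 2 / v ^ 3))
    (v := psiPrim) (v' := fun v ↦ -(psiNorm v - 1)) (a := u) (b := w) hcg
    continuous_psiPrim.continuousOn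
    (fun v hv ↦ (hdg v (hpos v (Ioo_subset_Icc_self hv))).hasDerivWithinAt)
    (fun v _ ↦ hasDerivWithinAt_psiPrim v) hcg'.neg.intervalIntegrable hB.neg
  have h1 : ∫ v in u..w, (1 / v + 1 / v ^ 2) * -(psiNorm v - 1) =
      (∫ v in u..w, (1 / v + 1 / v ^ 2)) - ∫ v in u..w, psiNorm v * (1 / v + 1 / v ^ 2) := by
    rw [← intervalIntegral.integral_sub hcg.intervalIntegrable
      ((intervalIntegrable_psiNorm u w).mul_continuousOn hcg)]
    congr 1
    funext v
    ring
  have h2 : ∫ v in u..w, -(1 / v ^ 2 + 2 / v ^ 3) * psiPrim v =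
      -∫ v in u..w, psiPrim v * (1 / v ^ 2 + 2 / v ^ 3) := by
    rw [← intervalIntegral.integral_neg]
    congr 1
    funext v
    ring
  rw [h1, h2, hlog] at hparts
  have h3 := mert_sub hu huw
  rw [mertErr, mertErr, sub_div, sub_div]
  linarith

end Robin

namespace Robin

open Set Filter Topology MeasureTheory ArithmeticFunction

/-- The coefficients of `log ζ(1 + s)`. -/
noncomputable def mertCoeff (n : ℕ) : ℝ := vonMangoldt n / (n * Real.log n)

lemma mertCoeff_nonneg (n : ℕ) : 0 ≤ mertCoeff n :=
  div_nonneg vonMangoldt_nonneg (mul_nonneg n.cast_nonneg (Real.log_natCast_nonneg n))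

lemma mertCoeff_le (n : ℕ) : mertCoeff n ≤ (n : ℝ)⁻¹ := by
  rw [mertCoeff, mul_comm, ← div_div, ← one_div]
  gcongr
  exact div_le_one_of_le₀ vonMangoldt_le_log (Real.log_natCast_nonneg n)

lemma sum_mertCoeff_le (n : ℕ) : ∑ k ∈ Finset.Icc 1 n, mertCoeff k ≤ 1 + Real.log n := by
  refine (Finset.sum_le_sum fun k _ ↦ mertCoeff_le k).trans ?_
  have := harmonic_le_one_add_log n
  rw [harmonic_eq_sum_Icc] at this
  push_cast at this
  exact this

lemma mertSum_eq (x : ℝ) : mertSum x = ∑ k ∈ Finset.Icc 1 ⌊x⌋₊, mertCoeff k := rfl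

lemma mertSum_nonneg (x : ℝ) : 0 ≤ mertSum x := Finset.sum_nonneg fun k _ ↦ mertCoeff_nonneg k

lemma mert_nonneg (u : ℝ) : 0 ≤ mert u := mertSum_nonneg _

lemma mert_le {u : ℝ} (hu : 0 ≤ u) : mert u ≤ 1 + u := by
  refine (sum_mertCoeff_le _).trans ?_
  have h1 : (1 : ℝ) ≤ ⌊Real.exp u⌋₊ := by
    exact_mod_cast Nat.le_floor (by simpa using Real.one_le_exp hu)
  have := Real.log_le_log (by linarith) (Nat.floor_le (Real.exp_pos u).le)
  rw [Real.log_exp] at this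
  linarith

lemma lapInt_mert : LapInt mert 0 := by
  refine lapInt_of_bound mert_mono.measurable.aestronglyMeasurable (C := 1) (n := 1) fun u hu ↦ ?_
  rw [abs_of_nonneg (mert_nonneg u)]
  simpa using mert_le hu.le

lemma sum_mertCoeff_isBigO {r : ℝ} (hr : 0 < r) :
    (fun n : ℕ ↦ ∑ k ∈ Finset.Icc 1 n, mertCoeff k) =O[atTop] fun n ↦ (n : ℝ) ^ r := by
  have h1 : (fun x : ℝ ↦ 1 + Real.log x) =O[atTop] fun x ↦ x ^ r := by
    refine Asymptotics.IsBigO.add ?_ (isLittleO_log_rpow_atTop hr).isBigO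
    refine Asymptotics.IsBigO.of_bound 1 ?_
    filter_upwards [eventually_ge_atTop 1] with x hx
    have := Real.one_le_rpow hx hr.le
    rw [norm_one, one_mul, Real.norm_eq_abs]
    exact this.trans (le_abs_self _)
  refine Asymptotics.IsBigO.trans ?_ (h1.comp_tendsto tendsto_natCast_atTop_atTop)
  refine Asymptotics.IsBigO.of_bound 1 (Eventually.of_forall fun n ↦ ?_)
  rw [one_mul, Real.norm_eq_abs, abs_of_nonneg (Finset.sum_nonneg fun k _ ↦ mertCoeff_nonneg k)]
  exact (sum_mertCoeff_le n).trans (le_abs_self _)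

lemma lseries_mertCoeff {z : ℂ} (hz : 0 < z.re) :
    LSeries (fun n ↦ mertCoeff n) z = z * lap mert z := by
  rw [LSeries_eq_mul_integral_of_nonneg mertCoeff (half_pos hz).le (half_lt_self hz)
    (sum_mertCoeff_isBigO (half_pos hz)) mertCoeff_nonneg]
  congr 1
  have h := setIntegral_Ioi_one_cpow mertSum z
  rw [show (fun u ↦ mertSum (Real.exp u)) = mert from rfl] at h
  rw [← h]
  simp only [mertSum_eq, Complex.ofReal_sum]

lemma abscissa_mertCoeff_le : LSeries.abscissaOfAbsConv (fun n ↦ (mertCoeff n : ℂ)) ≤ 0 := by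
  refine LSeries.abscissaOfAbsConv_le_of_forall_lt_LSeriesSummable' fun y hy ↦ ?_
  have hy : 0 < y := by exact_mod_cast hy
  refine LSeriesSummable_of_sum_norm_bigO (r := y / 2) ?_ (by positivity) (by simpa using hy)
  refine (sum_mertCoeff_isBigO (half_pos hy)).congr_left fun n ↦ ?_
  refine Finset.sum_congr rfl fun k _ ↦ ?_
  rw [Complex.norm_real, Real.norm_eq_abs, abs_of_nonneg (mertCoeff_nonneg k)]

lemma lseries_logMul_mertCoeff (z : ℂ) :
    LSeries (LSeries.logMul fun n ↦ (mertCoeff n : ℂ)) z =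
      LSeries (fun n ↦ (vonMangoldt n : ℂ)) (z + 1) := by
  refine tsum_congr fun n ↦ ?_
  rcases Nat.lt_or_ge n 2 with h | h
  · interval_cases n <;> simp [LSeries.term, LSeries.logMul]
  · have hn0 : (n : ℂ) ≠ 0 := by
      exact_mod_cast (by omega : n ≠ 0)
    have hl : ((Real.log n : ℝ) : ℂ) ≠ 0 := by
      exact_mod_cast (Real.log_pos (by exact_mod_cast h)).ne'
    rw [LSeries.term_of_ne_zero (by omega), LSeries.term_of_ne_zero (by omega), LSeries.logMul,
      mertCoeff, Complex.cpow_add _ _ hn0, Complex.cpow_one, ← Complex.natCast_log]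
    push_cast
    rw [← Complex.natCast_log] at *
    field_simp

/-- `log ζ(1 + z)` as a Laplace transform. -/
lemma exp_mul_lap_mert {z : ℂ} (hz : 0 < z.re) :
    Complex.exp (z * lap mert z) = riemannZeta (z + 1) := by
  set ℓ : ℂ → ℂ := LSeries (fun n ↦ (mertCoeff n : ℂ)) with hℓ
  have ho : IsOpen {z : ℂ | 0 < z.re} := isOpen_lt continuous_const Complex.continuous_re
  have hne1 : ∀ w : ℂ, 0 < w.re → w + 1 ≠ 1 := fun w hw h ↦ by
    rw [add_eq_right] at h
    simp [h] at hw
  have hζ : ∀ w : ℂ, 0 < w.re → riemannZeta (w + 1) ≠ 0 := fun w hw ↦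
    riemannZeta_ne_zero_of_one_lt_re (by simpa using hw)
  have hd : ∀ w : ℂ, 0 < w.re → HasDerivAt ℓ (deriv riemannZeta (w + 1) / riemannZeta (w + 1)) w := by
    intro w hw
    refine (LSeries_hasDerivAt (abscissa_mertCoeff_le.trans_lt (by exact_mod_cast hw))).congr_deriv ?_
    rw [lseries_logMul_mertCoeff, LSeries_vonMangoldt_eq_deriv_riemannZeta_div (by simpa using hw)]
    ring
  have hh : ∀ w : ℂ, 0 < w.re →
      HasDerivAt (fun w ↦ Complex.exp (-ℓ w) * riemannZeta (w + 1)) 0 w := by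
    intro w hw
    have h1 := (hd w hw).neg.cexp
    have h2 : HasDerivAt (fun w ↦ riemannZeta (w + 1)) (deriv riemannZeta (w + 1)) w :=
      ((differentiableAt_riemannZeta (hne1 w hw)).hasDerivAt).comp_add_const w 1
    refine (h1.mul h2).congr_deriv ?_
    have := hζ w hw
    field_simp
    simp
  have hc : ∀ x : ℝ, 0 < x → Complex.exp (-ℓ z) * riemannZeta (z + 1) =
      Complex.exp (-ℓ x) * riemannZeta (x + 1) := fun x hx ↦
    ho.is_const_of_deriv_eq_zero (convex_halfSpace_re_gt 0).isPreconnected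
      (fun w hw ↦ (hh w hw).differentiableAt.differentiableWithinAt)
      (fun w hw ↦ (hh w hw).deriv) hz (by simpa using hx)
  have ht1 : Tendsto (fun x : ℝ ↦ ℓ x) atTop (𝓝 0) := by
    have := LSeries.tendsto_atTop (f := fun n ↦ (mertCoeff n : ℂ))
      (abscissa_mertCoeff_le.trans_lt (by simp))
    rwa [show mertCoeff 1 = 0 by simp [mertCoeff], Complex.ofReal_zero] at this
  have ht2 : Tendsto (fun x : ℝ ↦ riemannZeta (x + 1)) atTop (𝓝 1) := by
    have h1 := LSeries.tendsto_atTop (f := 1) (by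
      rw [LSeries.abscissaOfAbsConv_one]; exact_mod_cast EReal.coe_lt_top 1)
    have h2 := h1.comp (tendsto_atTop_add_const_right atTop (1 : ℝ) tendsto_id)
    refine h2.congr' ?_
    filter_upwards [eventually_gt_atTop 0] with x hx
    simp only [Function.comp_apply, id]
    push_cast
    exact LSeries_one_eq_riemannZeta (by simpa using hx)
  have ht : Tendsto (fun x : ℝ ↦ Complex.exp (-ℓ x) * riemannZeta (x + 1)) atTop (𝓝 1) := by
    simpa using (ht1.neg.cexp).mul ht2
  have hfin := tendsto_nhds_unique (tendsto_const_nhds.congr' (by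
    filter_upwards [eventually_gt_atTop 0] with x hx using hc x hx)) ht
  rw [← lseries_mertCoeff hz]
  rw [Complex.exp_neg, inv_mul_eq_iff_eq_mul₀ (Complex.exp_ne_zero _), mul_one] at hfin
  exact hfin.symm

end Robin

namespace Robin

open Set Filter Topology MeasureTheory ArithmeticFunction

lemma integral_log_mul_exp :
    ∫ t in Ioi (0 : ℝ), Real.log t * Real.exp (-t) = -Real.eulerMascheroniConstant := by
  have h1 := Complex.hasDerivAt_GammaIntegral (s := 1) (by simp)
  have h2 : Complex.GammaIntegral =ᶠ[𝓝 1] Complex.Gamma := by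
    filter_upwards [(isOpen_lt continuous_const Complex.continuous_re).mem_nhds
      (show (0 : ℝ) < (1 : ℂ).re by simp)] with z hz
    exact (Complex.Gamma_eq_integral hz).symm
  have h3 := h1.unique (Complex.hasDerivAt_Gamma_one.congr_of_eventuallyEq h2)
  simp only [sub_self, Complex.cpow_zero, one_mul] at h3
  have h4 : ∫ t in Ioi (0 : ℝ), ((Real.log t : ℝ) : ℂ) * ((Real.exp (-t) : ℝ) : ℂ) =
      ((∫ t in Ioi (0 : ℝ), Real.log t * Real.exp (-t) : ℝ) : ℂ) := by
    rw [← integral_complex_ofReal]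
    push_cast
    rfl
  rw [h4] at h3
  exact_mod_cast h3

lemma integrableOn_log_mul_exp :
    IntegrableOn (fun t ↦ Real.log t * Real.exp (-t)) (Ioi 0) := by
  by_contra h
  have h1 := integral_log_mul_exp
  rw [integral_undef h] at h1
  have := eulerMascheroni_gt
  norm_num at this
  linarith

lemma log_mul_exp_eq {s u : ℝ} (hs : 0 < s) (hu : 0 < u) :
    Real.log u * Real.exp (-s * u) =
      Real.log (s * u) * Real.exp (-(s * u)) - Real.log s * Real.exp (-s * u) := by
  rw [Real.log_mul hs.ne' hu.ne', neg_mul]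
  ring

lemma integrableOn_log_mul_exp_mul {s : ℝ} (hs : 0 < s) :
    IntegrableOn (fun t ↦ Real.log (s * t) * Real.exp (-(s * t))) (Ioi 0) := by
  have := (integrableOn_Ioi_comp_mul_left_iff (fun t ↦ Real.log t * Real.exp (-t)) 0 hs).2
  rw [mul_zero] at this
  exact this integrableOn_log_mul_exp

lemma lapInt_log : LapInt Real.log 0 := fun σ hσ ↦
  ((integrableOn_log_mul_exp_mul hσ).sub ((lapInt_one.const_mul (Real.log σ)) σ hσ)).congr_fun
    (fun u hu ↦ by
      simp only [Pi.sub_apply, log_mul_exp_eq hσ hu, mul_one]) measurableSet_Ioi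

lemma lap_log {s : ℝ} (hs : 0 < s) :
    lap Real.log s = ((-Real.eulerMascheroniConstant - Real.log s) / s : ℝ) := by
  rw [lap_ofReal]
  congr 1
  have h1 : ∫ u in Ioi (0 : ℝ), Real.log u * Real.exp (-s * u) =
      ∫ u in Ioi (0 : ℝ), (Real.log (s * u) * Real.exp (-(s * u)) -
        Real.log s * Real.exp (-s * u)) :=
    setIntegral_congr_fun measurableSet_Ioi fun u hu ↦ log_mul_exp_eq hs hu
  have h2 : IntegrableOn (fun u ↦ Real.log s * Real.exp (-s * u)) (Ioi 0) := by
    simpa using (lapInt_one.const_mul (Real.log s)) s hs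
  rw [h1, integral_sub (integrableOn_log_mul_exp_mul hs) h2,
    integral_comp_mul_left_Ioi (fun t ↦ Real.log t * Real.exp (-t)) 0 hs, mul_zero,
    integral_log_mul_exp, integral_const_mul]
  have h3 : ∫ u in Ioi (0 : ℝ), Real.exp (-s * u) = 1 / s := by
    rw [integral_exp_mul_Ioi (by linarith)]
    simp [neg_div_neg_eq]
  rw [h3, smul_eq_mul]
  field_simp

/-- The value of `(s - 1) ζ(s)` on the real axis, shifted. -/
noncomputable def zetaR (s : ℝ) : ℝ := (riemannZeta₁ (s + 1)).re

lemma zetaR_spec {s : ℝ} (hs : -1 < s) : 0 < zetaR s ∧ riemannZeta₁ (s + 1) = zetaR s := by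
  obtain ⟨r, hr, h⟩ := exists_riemannZeta₁_real (by linarith : 0 < s + 1)
  push_cast at h
  rw [zetaR, h]
  exact ⟨hr, by simp⟩

lemma zetaR_zero : zetaR 0 = 1 := by simp [zetaR, riemannZeta₁_one]

lemma continuous_zetaR : Continuous zetaR := by
  have := differentiable_riemannZeta₁.continuous
  exact Complex.continuous_re.comp (this.comp (by fun_prop))

/-- The remainder in Mertens' theorem. -/
noncomputable def mertRem (u : ℝ) : ℝ := mert u - Real.eulerMascheroniConstant - Real.log u

lemma lapInt_const (c : ℝ) : LapInt (fun _ ↦ c) 0 := by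
  simpa using lapInt_one.const_mul c

lemma lapInt_mertRem : LapInt mertRem 0 :=
  (lapInt_mert.sub (lapInt_const Real.eulerMascheroniConstant)).sub lapInt_log

lemma lap_mertRem {s : ℝ} (hs : 0 < s) : lap mertRem s = (Real.log (zetaR s) / s : ℝ) := by
  have hre : (0 : ℝ) < (s : ℂ).re := hs
  have hs0 : (s : ℂ) ≠ 0 := by exact_mod_cast hs.ne'
  obtain ⟨m, hm⟩ : ∃ m : ℝ, lap mert s = m := ⟨_, lap_ofReal mert s⟩
  have h1 := exp_mul_lap_mert hre
  have h2 := (zetaR_spec (by linarith : -1 < s)).2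
  rw [riemannZeta₁_eq_mul (by simpa using hs0), ← h1, hm, add_sub_cancel_right] at h2
  have h3 : s * Real.exp (s * m) = zetaR s := by exact_mod_cast h2
  have h4 : Real.log (zetaR s) = Real.log s + s * m := by
    rw [← h3, Real.log_mul hs.ne' (Real.exp_ne_zero _), Real.log_exp]
  have h5 : lap (fun _ ↦ Real.eulerMascheroniConstant) s = Real.eulerMascheroniConstant / s := by
    have := lap_const_mul (fun _ ↦ 1) Real.eulerMascheroniConstant s
    rw [lap_one hre] at this
    simpa [div_eq_mul_inv] using this
  have h6 : lap mertRem s = lap mert s - lap (fun _ ↦ Real.eulerMascheroniConstant) s -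
      lap Real.log s := by
    rw [← lap_sub lapInt_mert (lapInt_const _) hre, ← lap_sub _ lapInt_log hre]
    · rfl
    · exact lapInt_mert.sub (lapInt_const _)
  rw [h6, h5, hm, lap_log hs, h4]
  push_cast
  field_simp
  ring

/-- An Abelian theorem for Laplace transforms. -/
lemma tendsto_mul_integral_of_tendsto {a : ℝ → ℝ} (ha : LapInt a 0) {L : ℝ}
    (hL : Tendsto a atTop (𝓝 L)) :
    Tendsto (fun s : ℝ ↦ s * ∫ u in Ioi 0, a u * Real.exp (-s * u)) (𝓝[>] 0) (𝓝 L) := by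
  have hb : LapInt (fun u ↦ a u - L) 0 := ha.sub (lapInt_const L)
  have he : ∀ s : ℝ, 0 < s → IntegrableOn (fun u ↦ Real.exp (-s * u)) (Ioi 0) := fun s hs ↦ by
    simpa using lapInt_one s hs
  have hie : ∀ s : ℝ, 0 < s → ∫ u in Ioi (0 : ℝ), Real.exp (-s * u) = 1 / s := fun s hs ↦ by
    rw [integral_exp_mul_Ioi (by linarith)]
    simp [neg_div_neg_eq]
  rw [Metric.tendsto_nhdsWithin_nhds]
  intro ε hε
  obtain ⟨T, hT⟩ := eventually_atTop.1 (Metric.tendsto_nhds.1 hL (ε / 2) (half_pos hε))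
  set T' : ℝ := max T 1 with hT'
  have hT1 : 0 < T' := lt_of_lt_of_le one_pos (le_max_right _ _)
  have hDi : IntegrableOn (fun u ↦ |a u - L|) (Ioc 0 T') := by
    have h1 : IntegrableOn (fun u ↦ (a u - L) * Real.exp (-1 * u)) (Ioc 0 T') :=
      (hb 1 one_pos).mono_set Ioc_subset_Ioi_self
    have h2 : IntegrableOn (fun u ↦ (a u - L) * Real.exp (-1 * u) * Real.exp u) (Ioc 0 T') := by
      have h1' : IntervalIntegrable (fun u ↦ (a u - L) * Real.exp (-1 * u)) volume 0 T' := by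
        rwa [intervalIntegrable_iff_integrableOn_Ioc_of_le hT1.le]
      have := h1'.mul_continuousOn (g := fun u ↦ Real.exp u) Real.continuous_exp.continuousOn
      rwa [intervalIntegrable_iff_integrableOn_Ioc_of_le hT1.le] at this
    refine (h2.congr_fun (fun u _ ↦ ?_) measurableSet_Ioc : IntegrableOn (fun u ↦ a u - L) _).abs
    simp only
    rw [mul_assoc, ← Real.exp_add]
    simp
  set D := ∫ u in Ioc 0 T', |a u - L| with hD
  have hD0 : 0 ≤ D := integral_nonneg fun _ ↦ abs_nonneg _
  refine ⟨ε / 2 / (D + 1), by positivity, fun s hs hsd ↦ ?_⟩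
  have hs : 0 < s := hs
  rw [Real.dist_eq, sub_zero, abs_of_pos hs, lt_div_iff₀ (by positivity)] at hsd
  have h1 : s * (∫ u in Ioi 0, a u * Real.exp (-s * u)) - L =
      s * ∫ u in Ioi 0, (a u - L) * Real.exp (-s * u) := by
    have : ∫ u in Ioi 0, (a u - L) * Real.exp (-s * u) =
        (∫ u in Ioi 0, a u * Real.exp (-s * u)) - L * (1 / s) := by
      rw [← hie s hs, ← integral_const_mul, ← integral_sub (ha s hs) ((he s hs).const_mul L)]
      congr 1
      funext u
      ring
    rw [this]
    field_simp
  have h2 : |∫ u in Ioi 0, (a u - L) * Real.exp (-s * u)| ≤ D + ε / 2 * (1 / s) := by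
    have hsplit : Ioi (0 : ℝ) = Ioc 0 T' ∪ Ioi T' := (Ioc_union_Ioi_eq_Ioi hT1.le).symm
    have hab : IntegrableOn (fun u ↦ |(a u - L) * Real.exp (-s * u)|) (Ioi 0) := (hb s hs).abs
    refine (abs_integral_le_integral_abs).trans ?_
    rw [hsplit] at hab ⊢
    rw [setIntegral_union (Ioc_disjoint_Ioi le_rfl) measurableSet_Ioi hab.left_of_union
      hab.right_of_union]
    refine add_le_add (setIntegral_mono_on hab.left_of_union hDi measurableSet_Ioc fun u hu ↦ ?_) ?_
    · rw [abs_mul, Real.abs_exp]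
      refine mul_le_of_le_one_right (abs_nonneg _) (Real.exp_le_one_iff.2 ?_)
      nlinarith [hu.1]
    · have hsub : Ioi T' ⊆ Ioi 0 := Ioi_subset_Ioi hT1.le
      have hc : IntegrableOn (fun u ↦ ε / 2 * Real.exp (-s * u)) (Ioi 0) := (he s hs).const_mul _
      calc _ ≤ ∫ u in Ioi T', ε / 2 * Real.exp (-s * u) := by
            refine setIntegral_mono_on hab.right_of_union
              (hc.mono_set hsub) measurableSet_Ioi fun u hu ↦ ?_
            rw [abs_mul, Real.abs_exp]
            have hu : T' < u := hu
            have := hT u ((le_max_left _ _).trans hu.le)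
            rw [Real.dist_eq] at this
            gcongr
        _ ≤ ∫ u in Ioi 0, ε / 2 * Real.exp (-s * u) :=
            setIntegral_mono_set ((he s hs).const_mul _)
              (Eventually.of_forall fun u ↦ by positivity) hsub.eventuallyLE
        _ = _ := by rw [integral_const_mul, hie s hs]
  rw [Real.dist_eq, h1, abs_mul, abs_of_pos hs]
  calc _ ≤ s * (D + ε / 2 * (1 / s)) := by gcongr
    _ = s * D + ε / 2 := by field_simp
    _ < ε := by nlinarith

/-- Mertens' theorem, once the existence of the limit is known. -/
lemma eq_zero_of_tendsto_mertRem {L : ℝ} (hL : Tendsto mertRem atTop (𝓝 L)) : L = 0 := by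
  have h1 := tendsto_mul_integral_of_tendsto lapInt_mertRem hL
  have h2 : Tendsto (fun s ↦ Real.log (zetaR s)) (𝓝[>] 0) (𝓝 0) := by
    have : ContinuousAt (fun s ↦ Real.log (zetaR s)) 0 :=
      continuous_zetaR.continuousAt.log (by rw [zetaR_zero]; exact one_ne_zero)
    have h := this.tendsto
    rw [zetaR_zero, Real.log_one] at h
    exact h.mono_left nhdsWithin_le_nhds
  refine tendsto_nhds_unique h1 (h2.congr' ?_)
  filter_upwards [self_mem_nhdsWithin] with s hs
  have hs : 0 < s := hs
  have h3 := lap_mertRem hs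
  rw [lap_ofReal, Complex.ofReal_inj] at h3
  rw [h3]
  field_simp

end Robin

namespace Robin

open Set Filter Topology MeasureTheory

lemma log_two_pi_lt : Real.log (2 * Real.pi) < 1.84 := by
  rw [Real.log_lt_iff_lt_exp (by positivity)]
  have h := Real.quadratic_le_exp_of_nonneg (by norm_num : (0 : ℝ) ≤ 0.84)
  have h1 := Real.exp_one_gt_d9
  have hp := Real.pi_lt_d6
  have hx : Real.exp 0.46 ^ 4 = Real.exp 1.84 := by rw [← Real.exp_nat_mul]; norm_num
  have h2 : 1.584 ≤ Real.exp 0.46 := by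
    refine le_trans ?_ (Real.sum_le_exp_of_nonneg (by norm_num) 6)
    norm_num [Finset.sum_range_succ, Nat.factorial]
  have h3 : (1.584 : ℝ) ^ 4 ≤ Real.exp 0.46 ^ 4 := by gcongr
  rw [hx] at h3
  norm_num at h3 ⊢
  linarith

lemma neg_le_gamTail {u : ℝ} : -(1.84 * Real.exp (-u)) ≤ gamTail u := by
  have := tail_sum_nonneg u
  have h := log_two_pi_lt
  have := mul_le_mul_of_nonneg_right h.le (Real.exp_pos (-u)).le
  unfold gamTail
  linarith

lemma gamTail_nonpos {u : ℝ} (hu : 0 ≤ u) : gamTail u ≤ 0 := by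
  have h : ∑' k : ℕ, tailCoeff k * Real.exp (-(2 * k + 3) * u) ≤
      ∑' k : ℕ, tailCoeff k * Real.exp (-u) := by
    refine (summable_gamTail hu).tsum_le_tsum (fun k ↦ ?_) (hasSum_tailCoeff.summable.mul_right _)
    refine mul_le_mul_of_nonneg_left (Real.exp_le_exp.2 ?_) (tailCoeff_pos k).le
    have : (0 : ℝ) ≤ k := k.cast_nonneg
    nlinarith
  rw [tsum_mul_right, hasSum_tailCoeff.tsum_eq] at h
  have h1 : 1 - Real.log 2 ≤ Real.log (2 * Real.pi) := by
    have := Real.log_two_gt_d9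
    have := Real.log_le_log (by norm_num) (by linarith [Real.pi_gt_three] : (2 : ℝ) ≤ 2 * Real.pi)
    linarith
  have := mul_le_mul_of_nonneg_right h1 (Real.exp_pos (-u)).le
  unfold gamTail
  linarith

lemma psiPrim_le (hRH : RiemannHypothesis) {u : ℝ} (hu : 0 < u) : psiPrim u ≤ 0.0928 * Real.exp (-u / 2) := by
  have h := (abs_le.1 (abs_zeroSum_le hRH hu)).2
  have := gamTail_nonpos hu.le
  have := mul_le_mul_of_nonneg_right four_mul_xiConst_lt.le (Real.exp_pos (-u / 2)).le
  unfold zeroSum at h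
  linarith

lemma le_psiPrim (hRH : RiemannHypothesis) {u : ℝ} (hu : 0 < u) :
    -(0.0928 * Real.exp (-u / 2) + 1.84 * Real.exp (-u)) ≤ psiPrim u := by
  have h := (abs_le.1 (abs_zeroSum_le hRH hu)).1
  have := neg_le_gamTail (u := u)
  have := mul_le_mul_of_nonneg_right four_mul_xiConst_lt.le (Real.exp_pos (-u / 2)).le
  unfold zeroSum at h
  linarith

lemma abs_psiPrim_le (hRH : RiemannHypothesis) {u : ℝ} (hu : 0 < u) : |psiPrim u| ≤ 2 * Real.exp (-u / 2) := by
  have h1 := psiPrim_le hRH hu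
  have h2 := le_psiPrim hRH hu
  have h3 : Real.exp (-u) ≤ Real.exp (-u / 2) := Real.exp_le_exp.2 (by linarith)
  have := Real.exp_pos (-u / 2)
  rw [abs_le]
  constructor <;> linarith

lemma tendsto_mertErr (hRH : RiemannHypothesis) :
    Tendsto mertErr atTop (𝓝 Real.eulerMascheroniConstant) := by
  have hexp : Tendsto (fun w : ℝ ↦ 2 * Real.exp (-w / 2)) atTop (𝓝 0) := by
    have : Tendsto (fun w : ℝ ↦ 2 * Real.exp (-(w / 2))) atTop (𝓝 (2 * 0)) :=
      (Real.tendsto_exp_neg_atTop_nhds_zero.comp (tendsto_id.atTop_div_const two_pos)).const_mul 2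
    simpa [neg_div] using this
  have hpsi : Tendsto psiPrim atTop (𝓝 0) := by
    refine squeeze_zero_norm' ?_ hexp
    filter_upwards [eventually_gt_atTop 0] with w hw using abs_psiPrim_le hRH hw
  have ha : Tendsto (fun w : ℝ ↦ 1 / w + 1 / w ^ 2) atTop (𝓝 0) := by
    have h1 := tendsto_inv_atTop_zero (𝕜 := ℝ)
    simpa using h1.add (h1.pow 2)
  have h_int : IntegrableOn (fun v ↦ psiPrim v * (1 / v ^ 2 + 2 / v ^ 3)) (Ioi 1) := by
    have hi : IntegrableOn (fun v : ℝ ↦ 6 * Real.exp (-(1 / 2) * v)) (Ioi 1) :=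
      (integrableOn_exp_mul_Ioi (by norm_num) 1).const_mul 6
    refine hi.mono' ?_ ?_
    · exact (continuous_psiPrim.measurable.mul (by fun_prop)).aestronglyMeasurable
    · refine (ae_restrict_iff' measurableSet_Ioi).2 (Eventually.of_forall fun v hv ↦ ?_)
      have hv : 1 < v := hv
      have h1 := abs_psiPrim_le hRH (by linarith : 0 < v)
      have h2 : 1 / v ^ 2 + 2 / v ^ 3 ≤ 3 := by
        have h3 : 1 / v ^ 2 ≤ 1 := (div_le_one (by positivity)).2 (one_le_pow₀ hv.le)
        have h4 : 2 / v ^ 3 ≤ 2 := div_le_self (by norm_num) (one_le_pow₀ hv.le)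
        linarith
      rw [norm_mul, Real.norm_eq_abs, Real.norm_of_nonneg (by positivity)]
      calc _ ≤ 2 * Real.exp (-v / 2) * 3 := by gcongr
        _ = _ := by ring_nf
  obtain ⟨L, hL⟩ : ∃ L, Tendsto mertErr atTop (𝓝 L) := by
    have h := ((hpsi.mul ha).add
      (intervalIntegral_tendsto_integral_Ioi 1 h_int tendsto_id)).const_sub
        (mertErr 1 + psiPrim 1 * (1 / 1 + 1 / 1 ^ 2))
    refine ⟨_, h.congr' ?_⟩
    filter_upwards [eventually_ge_atTop 1] with w hw
    have := mertErr_sub one_pos hw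
    simp only [id]
    linarith
  have hN : Tendsto (fun u ↦ (psiNorm u - 1) / u) atTop (𝓝 0) := by
    refine squeeze_zero_norm' (a := fun u ↦ (Real.log 4 + 5) / u) ?_
      (tendsto_const_nhds.div_atTop tendsto_id)
    filter_upwards [eventually_gt_atTop 0] with u hu
    have h1 := psiNorm_nonneg u
    have h2 := psiNorm_le u
    have h3 : 0 ≤ Real.log 4 := Real.log_nonneg (by norm_num)
    rw [norm_div, Real.norm_of_nonneg hu.le]
    gcongr
    rw [Real.norm_eq_abs, abs_le]
    constructor <;> linarith
  have hR : Tendsto mertRem atTop (𝓝 (L + 0 - Real.eulerMascheroniConstant)) := by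
    refine ((hL.add hN).sub_const _).congr fun u ↦ ?_
    unfold mertErr mertRem
    ring
  have := eq_zero_of_tendsto_mertRem hR
  rwa [show L = Real.eulerMascheroniConstant by linarith] at hL

lemma mertErr_le (hRH : RiemannHypothesis) {u : ℝ} (hu : 0 < u) :
    mertErr u ≤ Real.eulerMascheroniConstant + Real.exp (-u / 2) / u *
      (0.0928 * (1 + 3 / u + 4 / u ^ 2) + 1.84 * Real.exp (-u / 2) * (1 + 1 / u)) := by
  have hexp : Tendsto (fun w : ℝ ↦ 2 * Real.exp (-w / 2)) atTop (𝓝 0) := by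
    have : Tendsto (fun w : ℝ ↦ 2 * Real.exp (-(w / 2))) atTop (𝓝 (2 * 0)) :=
      (Real.tendsto_exp_neg_atTop_nhds_zero.comp (tendsto_id.atTop_div_const two_pos)).const_mul 2
    simpa [neg_div] using this
  have ha : Tendsto (fun w : ℝ ↦ 1 / w + 1 / w ^ 2) atTop (𝓝 0) := by
    have h1 := tendsto_inv_atTop_zero (𝕜 := ℝ)
    simpa using h1.add (h1.pow 2)
  have hev : ∀ᶠ w in atTop, mertErr u ≤ mertErr w + 2 * Real.exp (-w / 2) * (1 / w + 1 / w ^ 2) +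
      Real.exp (-u / 2) / u * (0.0928 * (1 + 3 / u + 4 / u ^ 2) +
        1.84 * Real.exp (-u / 2) * (1 + 1 / u)) := by
    filter_upwards [eventually_ge_atTop u] with w huw
    have hw := hu.trans_le huw
    have h1 := mertErr_sub hu huw
    have h2 : ∫ v in u..w, psiPrim v * (1 / v ^ 2 + 2 / v ^ 3) ≤
        0.0928 * (2 * Real.exp (-u / 2)) * (1 / u ^ 2 + 2 / u ^ 3) := by
      have hcont : ContinuousOn (fun v ↦ psiPrim v * (1 / v ^ 2 + 2 / v ^ 3)) (uIcc u w) := by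
        rw [uIcc_of_le huw]
        refine continuous_psiPrim.continuousOn.mul
          ((continuousOn_const.div (by fun_prop) fun v hv ↦ ?_).add
            (continuousOn_const.div (by fun_prop) fun v hv ↦ ?_))
        all_goals exact pow_ne_zero _ (hu.trans_le hv.1).ne'
      calc _ ≤ ∫ v in u..w, 0.0928 * (1 / u ^ 2 + 2 / u ^ 3) * Real.exp (-v / 2) := by
            refine intervalIntegral.integral_mono_on huw hcont.intervalIntegrable
              (Continuous.intervalIntegrable (by fun_prop) _ _) fun v hv ↦ ?_
            have hv0 := hu.trans_le hv.1
            have huv := hv.1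
            calc _ ≤ 0.0928 * Real.exp (-v / 2) * (1 / v ^ 2 + 2 / v ^ 3) :=
                  mul_le_mul_of_nonneg_right (psiPrim_le hRH hv0) (by positivity)
              _ ≤ 0.0928 * Real.exp (-v / 2) * (1 / u ^ 2 + 2 / u ^ 3) := by gcongr
              _ = _ := by ring
        _ = 0.0928 * (1 / u ^ 2 + 2 / u ^ 3) * (2 * Real.exp (-u / 2) - 2 * Real.exp (-w / 2)) := by
            rw [intervalIntegral.integral_const_mul]
            congr 1
            rw [intervalIntegral.integral_eq_sub_of_hasDerivAt
              (f := fun v ↦ -2 * Real.exp (-v / 2)) (fun v _ ↦ ?_)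
              (Continuous.intervalIntegrable (by fun_prop) _ _)]
            · ring
            · exact ((((hasDerivAt_id v).neg.div_const 2).exp).const_mul (-2)).congr_deriv
                (by simp [neg_div]; ring)
        _ ≤ 0.0928 * (1 / u ^ 2 + 2 / u ^ 3) * (2 * Real.exp (-u / 2)) := by
            gcongr
            linarith [Real.exp_pos (-w / 2)]
        _ = _ := by ring
    have h3 : psiPrim w * (1 / w + 1 / w ^ 2) ≤ 2 * Real.exp (-w / 2) * (1 / w + 1 / w ^ 2) :=
      mul_le_mul_of_nonneg_right ((le_abs_self _).trans (abs_psiPrim_le hRH hw)) (by positivity)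
    have h4 : -(0.0928 * Real.exp (-u / 2) + 1.84 * Real.exp (-u)) * (1 / u + 1 / u ^ 2) ≤
        psiPrim u * (1 / u + 1 / u ^ 2) :=
      mul_le_mul_of_nonneg_right (le_psiPrim hRH hu) (by positivity)
    have h5 : Real.exp (-u) = Real.exp (-u / 2) * Real.exp (-u / 2) := by
      rw [← Real.exp_add]; ring_nf
    have h6 : Real.exp (-u / 2) / u * (0.0928 * (1 + 3 / u + 4 / u ^ 2) +
        1.84 * Real.exp (-u / 2) * (1 + 1 / u)) =
        (0.0928 * Real.exp (-u / 2) + 1.84 * Real.exp (-u)) * (1 / u + 1 / u ^ 2) +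
        0.0928 * (2 * Real.exp (-u / 2)) * (1 / u ^ 2 + 2 / u ^ 3) := by
      rw [h5]; field_simp; ring
    rw [h6]
    linarith
  have hup : Tendsto (fun w ↦ mertErr w + 2 * Real.exp (-w / 2) * (1 / w + 1 / w ^ 2) +
      Real.exp (-u / 2) / u * (0.0928 * (1 + 3 / u + 4 / u ^ 2) +
        1.84 * Real.exp (-u / 2) * (1 + 1 / u))) atTop
      (𝓝 (Real.eulerMascheroniConstant + 0 * 0 + Real.exp (-u / 2) / u *
        (0.0928 * (1 + 3 / u + 4 / u ^ 2) + 1.84 * Real.exp (-u / 2) * (1 + 1 / u)))) :=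
    ((tendsto_mertErr hRH).add (hexp.mul ha)).add_const _
  have := ge_of_tendsto hup hev
  simpa using this

end Robin

namespace Robin

open ArithmeticFunction

/-- The sum `1 + p⁻¹ + ⋯ + p⁻ᵏ`. -/
noncomputable def geomInv (p k : ℕ) : ℝ := ∑ i ∈ Finset.range (k + 1), ((p : ℝ)⁻¹) ^ i

lemma one_le_geomInv (p k : ℕ) : 1 ≤ geomInv p k := by
  unfold geomInv
  rw [Finset.sum_range_succ']
  have : 0 ≤ ∑ i ∈ Finset.range k, ((p : ℝ)⁻¹) ^ (i + 1) := Finset.sum_nonneg fun i _ ↦ by positivity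
  simpa using this

lemma geomInv_zero (p : ℕ) : geomInv p 0 = 1 := by simp [geomInv]

lemma geomInv_succ (p k : ℕ) : geomInv p (k + 1) = geomInv p k + ((p : ℝ)⁻¹) ^ (k + 1) :=
  Finset.sum_range_succ _ _

/-- The contribution of `p ^ k` to `log (σ n / n) - ε log n`. -/
noncomputable def localF (ε : ℝ) (p k : ℕ) : ℝ := Real.log (geomInv p k) - ε * (k * Real.log p)

lemma localF_zero (ε : ℝ) (p : ℕ) : localF ε p 0 = 0 := by simp [localF, geomInv_zero]

lemma sigma_div_eq {n : ℕ} (hn : n ≠ 0) :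
    (sigma 1 n : ℝ) / n = ∏ p ∈ n.primeFactors, geomInv p (n.factorization p) := by
  have h1 : (n : ℝ) = ∏ p ∈ n.primeFactors, (p : ℝ) ^ n.factorization p := by
    conv_lhs => rw [← Nat.prod_factorization_pow_eq_self hn]
    rw [Finsupp.prod]
    push_cast
    rfl
  rw [sigma_eq_prod_primeFactors_sum_range_factorization_pow_mul hn]
  conv_lhs => rw [h1]
  push_cast
  rw [← Finset.prod_div_distrib]
  refine Finset.prod_congr rfl fun p hp ↦ ?_
  have hp0 : (p : ℝ) ≠ 0 := by exact_mod_cast (Nat.prime_of_mem_primeFactors hp).ne_zero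
  rw [geomInv, div_eq_iff (pow_ne_zero _ hp0), Finset.sum_mul, ← Finset.sum_range_reflect]
  refine Finset.sum_congr rfl fun i hi ↦ ?_
  have hi := Finset.mem_range.1 hi
  obtain ⟨a, ha⟩ := Nat.exists_eq_add_of_le (Nat.le_of_lt_succ hi)
  rw [show n.factorization p + 1 - 1 - i = a by omega, ha, pow_add, mul_one, inv_pow,
    inv_mul_cancel_left₀ (pow_ne_zero _ hp0)]

lemma log_sigma_sub {n : ℕ} (hn : n ≠ 0) (ε : ℝ) :
    Real.log ((sigma 1 n : ℝ) / n) - ε * Real.log n =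
      ∑ p ∈ n.primeFactors, localF ε p (n.factorization p) := by
  have h1 : Real.log n = ∑ p ∈ n.primeFactors, n.factorization p * Real.log p := by
    conv_lhs => rw [← Nat.prod_factorization_pow_eq_self hn, Finsupp.prod]
    push_cast
    rw [Real.log_prod fun p hp ↦ pow_ne_zero _ (by
      exact_mod_cast (Nat.prime_of_mem_primeFactors hp).ne_zero)]
    exact Finset.sum_congr rfl fun p _ ↦ Real.log_pow _ _
  rw [sigma_div_eq hn, Real.log_prod fun p _ ↦ (by linarith [one_le_geomInv p (n.factorization p)]),
    h1, Finset.mul_sum, ← Finset.sum_sub_distrib]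
  rfl

lemma log_sigma_le_of_localF_le {ε : ℝ} {T : Finset ℕ} {m : ℕ → ℝ} (hm : ∀ p ∈ T, 0 ≤ m p)
    (h : ∀ p ∈ T, p.Prime → ∀ k, localF ε p k ≤ m p)
    (h' : ∀ p ∉ T, p.Prime → ∀ k, localF ε p k ≤ 0) {n : ℕ} (hn : n ≠ 0) :
    Real.log ((sigma 1 n : ℝ) / n) ≤ ε * Real.log n + ∑ p ∈ T, m p := by
  have h1 : ∑ p ∈ n.primeFactors, localF ε p (n.factorization p) ≤
      ∑ p ∈ n.primeFactors, if p ∈ T then m p else 0 := by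
    refine Finset.sum_le_sum fun p hp ↦ ?_
    have hp := Nat.prime_of_mem_primeFactors hp
    split_ifs with hT
    · exact h p hT hp _
    · exact h' p hT hp _
  have h2 : ∑ p ∈ n.primeFactors, (if p ∈ T then m p else 0) ≤ ∑ p ∈ T, m p := by
    rw [← Finset.sum_filter]
    exact Finset.sum_le_sum_of_subset_of_nonneg
      (fun p hp ↦ (Finset.mem_filter.1 hp).2) fun p hp _ ↦ hm p hp
  linarith [log_sigma_sub hn ε]

/-- The successive quotients of `geomInv p` decrease. -/
lemma geomInv_div_anti {p : ℕ} (hp : 1 ≤ p) {j k : ℕ} (h : j ≤ k) :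
    geomInv p (k + 1) / geomInv p k ≤ geomInv p (j + 1) / geomInv p j := by
  refine antitone_nat_of_succ_le (f := fun k ↦ geomInv p (k + 1) / geomInv p k) (fun k ↦ ?_) h
  have h0 := one_le_geomInv p k
  have h1 := one_le_geomInv p (k + 1)
  have hp' : (0 : ℝ) < (p : ℝ)⁻¹ := by positivity
  have hp1 : (p : ℝ)⁻¹ ≤ 1 := inv_le_one_of_one_le₀ (by exact_mod_cast hp)
  rw [div_le_div_iff₀ (by linarith) (by linarith), geomInv_succ p (k + 1), geomInv_succ p k]
  have h2 : ((p : ℝ)⁻¹) ^ (k + 1 + 1) ≤ ((p : ℝ)⁻¹) ^ (k + 1) :=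
    pow_le_pow_of_le_one hp'.le hp1 (by omega)
  have h3 : 0 < ((p : ℝ)⁻¹) ^ (k + 1) := by positivity
  nlinarith

lemma localF_succ (ε : ℝ) (p k : ℕ) :
    localF ε p (k + 1) =
      localF ε p k + (Real.log (geomInv p (k + 1) / geomInv p k) - ε * Real.log p) := by
  rw [Real.log_div (by linarith [one_le_geomInv p (k + 1)]) (by linarith [one_le_geomInv p k])]
  simp only [localF]
  push_cast
  ring

lemma localF_le_of_ge {ε : ℝ} {p k : ℕ} (hp : 1 ≤ p)
    (h : Real.log (geomInv p (k + 1) / geomInv p k) ≤ ε * Real.log p) {j : ℕ} (hj : k ≤ j) :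
    localF ε p j ≤ localF ε p k := by
  induction j, hj using Nat.le_induction with
  | base => exact le_rfl
  | succ j hj ih =>
    rw [localF_succ]
    have := Real.log_le_log (div_pos (by linarith [one_le_geomInv p (j + 1)])
      (by linarith [one_le_geomInv p j])) (geomInv_div_anti hp hj)
    linarith

lemma localF_le_of_le {ε : ℝ} {p k : ℕ} (hp : 1 ≤ p)
    (h : ε * Real.log p ≤ Real.log (geomInv p (k + 1) / geomInv p k)) {j : ℕ} (hj : j ≤ k + 1) :
    localF ε p j ≤ localF ε p (k + 1) := by
  induction hj using Nat.decreasingInduction with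
  | self => exact le_rfl
  | of_succ j hj ih =>
    rw [localF_succ] at ih
    have := Real.log_le_log (div_pos (by linarith [one_le_geomInv p (k + 1)])
      (by linarith [one_le_geomInv p k])) (geomInv_div_anti hp (Nat.le_of_lt_succ hj))
    linarith

end Robin

namespace Robin

open ArithmeticFunction

lemma log_geomInv_le {p : ℕ} (hp : 2 ≤ p) (k : ℕ) :
    Real.log (geomInv p k) ≤ ∑ j ∈ Finset.range k, ((p : ℝ)⁻¹) ^ (j + 1) / (j + 1) := by
  rcases Nat.eq_zero_or_pos k with rfl | hk
  · simp [geomInv_zero]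
  set y := (p : ℝ)⁻¹ with hy
  have hp' : (2 : ℝ) ≤ p := by exact_mod_cast hp
  have hy0 : 0 < y := by positivity
  have hy2 : y ≤ 1 / 2 := by
    rw [hy, one_div]
    exact inv_anti₀ two_pos hp'
  have hyk : y ^ (k + 1) < 1 := pow_lt_one₀ hy0.le (by linarith) (by omega)
  have h1 : geomInv p k = (1 - y ^ (k + 1)) / (1 - y) := by
    rw [geomInv, geom_sum_eq (by linarith : (p : ℝ)⁻¹ ≠ 1), ← hy,
      ← neg_sub 1 (y ^ (k + 1)), ← neg_sub 1 y, neg_div_neg_eq]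
  have hs := Real.hasSum_pow_div_log_of_abs_lt_one (x := y) (by rw [abs_of_pos hy0]; linarith)
  have h2 := hs.summable.sum_add_tsum_nat_add k
  rw [hs.tsum_eq] at h2
  have hg : HasSum (fun i : ℕ ↦ y ^ (k + 1) / 2 * y ^ i) (y ^ (k + 1) / 2 * (1 - y)⁻¹) :=
    (hasSum_geometric_of_lt_one hy0.le (by linarith)).mul_left _
  have h3 : ∑' i : ℕ, y ^ (i + k + 1) / (((i + k : ℕ) : ℝ) + 1) ≤ y ^ (k + 1) / 2 * (1 - y)⁻¹ := by
    rw [← hg.tsum_eq]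
    refine ((summable_nat_add_iff k).2 hs.summable).tsum_le_tsum (fun i ↦ ?_) hg.summable
    have hk' : (1 : ℝ) ≤ k := by exact_mod_cast hk
    have hi : (0 : ℝ) ≤ i := i.cast_nonneg
    rw [show i + k + 1 = (k + 1) + i by ring, pow_add, div_mul_eq_mul_div]
    push_cast
    exact div_le_div_of_nonneg_left (by positivity) two_pos (by linarith)
  have h4 : y ^ (k + 1) / 2 * (1 - y)⁻¹ ≤ y ^ (k + 1) := by
    rw [← div_eq_mul_inv, div_le_iff₀ (by linarith)]
    nlinarith [pow_pos hy0 (k + 1)]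
  have h5 := Real.log_le_sub_one_of_pos (by linarith : 0 < 1 - y ^ (k + 1))
  rw [h1, Real.log_div (by linarith) (by linarith)]
  linarith

/-- The `j`-th term of the upper bound for `localF`. -/
noncomputable def localT (ε : ℝ) (p j : ℕ) : ℝ := 1 / (j * (p : ℝ) ^ j) - ε * Real.log p

lemma localF_le_sum {p : ℕ} (hp : 2 ≤ p) (ε : ℝ) (k : ℕ) :
    localF ε p k ≤ ∑ j ∈ Finset.Icc 1 k, localT ε p j := by
  have h := log_geomInv_le hp k
  have h1 : ∑ j ∈ Finset.Icc 1 k, localT ε p j =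
      ∑ j ∈ Finset.range k, ((p : ℝ)⁻¹) ^ (j + 1) / (j + 1) - ε * (k * Real.log p) := by
    have h2 := Finset.sum_Ico_add' (fun j : ℕ ↦ ((p : ℝ)⁻¹) ^ j / j) 0 k 1
    push_cast at h2
    rw [Finset.range_eq_Ico, h2]
    simp only [localT]
    rw [Finset.sum_sub_distrib, Finset.sum_const, Nat.card_Icc]
    congr 1
    · refine Finset.sum_congr (by ext; simp) fun j _ ↦ ?_
      rw [inv_pow]
      field_simp
    · simp
      ring
  rw [h1, localF]
  linarith

lemma localT_nonneg {x : ℝ} (hx : 1 < x) {p j : ℕ} (hp : 2 ≤ p) (hj : 1 ≤ j) (h : (p : ℝ) ^ j ≤ x) :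
    0 ≤ localT (1 / (x * Real.log x)) p j := by
  have hp' : (2 : ℝ) ≤ p := by exact_mod_cast hp
  have hj' : (1 : ℝ) ≤ j := by exact_mod_cast hj
  have hlx := Real.log_pos hx
  have h1 : j * Real.log p ≤ Real.log x := by
    rw [← Real.log_pow]
    exact Real.log_le_log (by positivity) h
  have h2 : 0 < (p : ℝ) ^ j := by positivity
  rw [localT, sub_nonneg, one_div_mul_eq_div, div_le_div_iff₀ (by positivity) (by positivity)]
  calc Real.log p * (j * (p : ℝ) ^ j) = (j * Real.log p) * (p : ℝ) ^ j := by ring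
    _ ≤ Real.log x * x := by gcongr
    _ = _ := by ring

lemma localT_nonpos {x : ℝ} (hx : 1 < x) {p j : ℕ} (hp : 2 ≤ p) (hj : 1 ≤ j) (h : x ≤ (p : ℝ) ^ j) :
    localT (1 / (x * Real.log x)) p j ≤ 0 := by
  have hp' : (2 : ℝ) ≤ p := by exact_mod_cast hp
  have hj' : (1 : ℝ) ≤ j := by exact_mod_cast hj
  have hlx := Real.log_pos hx
  have h1 : Real.log x ≤ j * Real.log p := by
    rw [← Real.log_pow]
    exact Real.log_le_log (by linarith) h
  have h2 : 0 < (p : ℝ) ^ j := by positivity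
  rw [localT, sub_nonpos, one_div_mul_eq_div, div_le_div_iff₀ (by positivity) (by positivity)]
  calc 1 * (x * Real.log x) ≤ (p : ℝ) ^ j * (j * Real.log p) := by rw [one_mul]; gcongr
    _ = _ := by ring

lemma sum_localT_le {x : ℝ} (hx : 1 < x) {p : ℕ} (hp : 2 ≤ p) (k : ℕ) :
    ∑ j ∈ Finset.Icc 1 k, localT (1 / (x * Real.log x)) p j ≤
      ∑ j ∈ Finset.Icc 1 (Nat.log p ⌊x⌋₊), localT (1 / (x * Real.log x)) p j := by
  have hfl : ⌊x⌋₊ ≠ 0 := (Nat.floor_pos.2 hx.le).ne'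
  rw [← Finset.sum_filter_add_sum_filter_not (Finset.Icc 1 k) (fun j ↦ j ≤ Nat.log p ⌊x⌋₊)]
  have h1 : ∑ j ∈ Finset.Icc 1 k with ¬ j ≤ Nat.log p ⌊x⌋₊, localT (1 / (x * Real.log x)) p j ≤ 0 := by
    refine Finset.sum_nonpos fun j hj ↦ ?_
    rw [Finset.mem_filter, Finset.mem_Icc] at hj
    refine localT_nonpos hx hp hj.1.1 ?_
    have := Nat.lt_pow_of_log_lt (by omega) (not_le.1 hj.2)
    have := (Nat.floor_lt (by linarith)).1 this
    push_cast at this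
    exact this.le
  have h2 : ∑ j ∈ Finset.Icc 1 k with j ≤ Nat.log p ⌊x⌋₊, localT (1 / (x * Real.log x)) p j ≤
      ∑ j ∈ Finset.Icc 1 (Nat.log p ⌊x⌋₊), localT (1 / (x * Real.log x)) p j := by
    refine Finset.sum_le_sum_of_subset_of_nonneg (fun j hj ↦ ?_) fun j hj _ ↦ ?_
    · rw [Finset.mem_filter, Finset.mem_Icc] at hj
      exact Finset.mem_Icc.2 ⟨hj.1.1, hj.2⟩
    · rw [Finset.mem_Icc] at hj
      refine localT_nonneg hx hp hj.1 ?_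
      have := (Nat.le_floor_iff (by linarith)).1 (Nat.pow_le_of_le_log hfl hj.2)
      exact_mod_cast this
  linarith

/-- A sum of `Λ` over an interval, written as a sum over primes and exponents. -/
lemma sum_vonMangoldt_mul (g : ℕ → ℝ) (n : ℕ) :
    ∑ m ∈ Finset.Icc 1 n, vonMangoldt m * g m =
      ∑ p ∈ Finset.Icc 1 n with p.Prime, ∑ j ∈ Finset.Icc 1 (Nat.log p n), Real.log p * g (p ^ j) := by
  calc _ = ∑ m ∈ ((Finset.Icc 1 n).filter Nat.Prime).biUnion
        fun p ↦ Finset.image (p ^ ·) (Finset.Icc 1 (p.log n)), vonMangoldt m * g m := by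
        refine (Finset.sum_subset (fun q hq ↦ ?_) fun x hx ↦ ?_).symm
        · simp only [Finset.mem_biUnion, Finset.mem_filter, Finset.mem_Icc, Finset.mem_image] at hq ⊢
          obtain ⟨p, hp, k, ⟨_, hk⟩, rfl⟩ := hq
          exact ⟨Nat.pos_of_ne_zero (pow_ne_zero _ hp.2.ne_zero),
            Nat.pow_le_of_le_log (by omega) hk⟩
        · intro hx'
          rw [mul_eq_zero]
          left
          revert hx'
          simp only [Finset.mem_biUnion, Finset.mem_filter, Finset.mem_Icc, Finset.mem_image,
            not_exists, not_and, and_imp, vonMangoldt_eq_zero_iff, isPrimePow_nat_iff]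
          contrapose!
          rintro ⟨p, k, hp, hk, rfl⟩
          simp only [Finset.mem_Icc] at hx
          have hpn : p ≤ n := (Nat.le_of_dvd (by lia) (dvd_pow_self p hk.ne')).trans hx.2
          exact ⟨p, ⟨hp.one_le, hpn, hp, ⟨k, ⟨by lia, Nat.le_log_of_pow_le hp.one_lt hx.2, rfl⟩⟩⟩⟩
    _ = ∑ p ∈ Finset.Icc 1 n with p.Prime,
        ∑ q ∈ Finset.image (fun k ↦ p ^ k) (Finset.Icc 1 (p.log n)), vonMangoldt q * g q := by
        rw [Finset.sum_biUnion <| by rw [Finset.pairwiseDisjoint_iff]; grind [Nat.Prime.pow_inj']]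
    _ = _ := by
        refine Finset.sum_congr rfl fun p hp ↦ ?_
        have hp := (Finset.mem_filter.1 hp).2
        rw [Finset.sum_image fun a _ b _ hab ↦ Nat.pow_right_injective hp.two_le hab]
        refine Finset.sum_congr rfl fun k hk ↦ ?_
        rw [vonMangoldt_apply_pow (by grind), vonMangoldt_apply_prime hp]

lemma sum_sum_localT (x ε : ℝ) :
    ∑ p ∈ Finset.Icc 1 ⌊x⌋₊ with p.Prime, ∑ j ∈ Finset.Icc 1 (Nat.log p ⌊x⌋₊), localT ε p j =
      mertSum x - ε * Chebyshev.psi x := by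
  have h1 : mertSum x - ε * Chebyshev.psi x =
      ∑ m ∈ Finset.Icc 1 ⌊x⌋₊, vonMangoldt m * (1 / (m * Real.log m) - ε) := by
    have h2 : Chebyshev.psi x = ∑ m ∈ Finset.Icc 1 ⌊x⌋₊, vonMangoldt m := by
      rw [Chebyshev.psi]
      rfl
    rw [mertSum, h2, Finset.mul_sum, ← Finset.sum_sub_distrib]
    exact Finset.sum_congr rfl fun m _ ↦ by ring
  rw [h1, sum_vonMangoldt_mul]
  refine Finset.sum_congr rfl fun p hp ↦ Finset.sum_congr rfl fun j hj ↦ ?_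
  have hp := (Finset.mem_filter.1 hp).2
  have hlp := Real.log_pos (by exact_mod_cast hp.one_lt : (1 : ℝ) < p)
  push_cast
  rw [Real.log_pow, localT, mul_sub, mul_comm (Real.log p) ε]
  congr 1
  field_simp

lemma log_one_add_le {y : ℝ} (hy : 0 ≤ y) (hy1 : y ≤ 1) :
    Real.log (1 + y) ≤ y - y ^ 2 / 2 + y ^ 3 / 3 := by
  set q := 1 - y / 2 + y ^ 2 / 3 with hq
  have hq1 : 1 - y / 2 ≤ q := by nlinarith
  have hq3 : 1 - 3 / 2 * y ≤ q ^ 3 := by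
    have : (1 - y / 2) ^ 3 ≤ q ^ 3 := pow_le_pow_left₀ (by linarith) hq1 3
    nlinarith [mul_nonneg hy hy, mul_nonneg (mul_nonneg hy hy) (sub_nonneg.2 hy1)]
  rw [Real.log_le_iff_le_exp (by linarith), show y - y ^ 2 / 2 + y ^ 3 / 3 = y * q by rw [hq]; ring]
  refine le_trans ?_ (Real.sum_le_exp_of_nonneg (by nlinarith) 4)
  norm_num [Finset.sum_range_succ, Nat.factorial]
  have h1 : 0 ≤ -1 / 2 + y / 3 + q ^ 2 / 2 + y * q ^ 3 / 6 := by
    have h2 : q ^ 2 / 2 = 1 / 2 - y / 2 + 11 / 24 * y ^ 2 - y ^ 3 / 6 + y ^ 4 / 18 := by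
      rw [hq]; ring
    have h3 := mul_le_mul_of_nonneg_left hq3 hy
    have h4 : 0 ≤ y ^ 2 * (5 / 24 - y / 6) := mul_nonneg (sq_nonneg y) (by linarith)
    have h5 : 0 ≤ y ^ 4 := by positivity
    linarith
  have h6 : y * q + (y * q) ^ 2 / 2 + (y * q) ^ 3 / 6 - y =
      y ^ 2 * (-1 / 2 + y / 3 + q ^ 2 / 2 + y * q ^ 3 / 6) := by
    have : y * q - y = y ^ 2 * (-1 / 2 + y / 3) := by rw [hq]; ring
    linear_combination this
  have := mul_nonneg (sq_nonneg y) h1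
  linarith

lemma localF_le_sub {x : ℝ} (hx : 1 < x) {p : ℕ} (hp : 2 ≤ p) (h1 : 2 * p ≤ x)
    (h2 : 2 * x ≤ (p : ℝ) ^ 2) (k : ℕ) :
    localF (1 / (x * Real.log x)) p k ≤ localT (1 / (x * Real.log x)) p 1 -
      (1 / (2 * (p : ℝ) ^ 2) - 1 / (3 * (p : ℝ) ^ 3)) := by
  have hp' : (2 : ℝ) ≤ p := by exact_mod_cast hp
  have hlx := Real.log_pos hx
  have hlp : 0 < Real.log p := Real.log_pos (by linarith)
  set ε := 1 / (x * Real.log x) with hε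
  have hε1 : ε * Real.log p ≤ 1 / (2 * p) := by
    have : Real.log p ≤ Real.log x := Real.log_le_log (by linarith) (by linarith)
    rw [hε, one_div_mul_eq_div, div_le_div_iff₀ (by positivity) (by positivity)]
    nlinarith
  have hε2 : 1 / (p : ℝ) ^ 2 ≤ ε * Real.log p := by
    have h3 : Real.log x ≤ 2 * Real.log p := by
      have : Real.log ((p : ℝ) ^ 2) = 2 * Real.log p := by rw [Real.log_pow]; norm_num
      rw [← this]
      exact Real.log_le_log (by linarith) (by linarith)
    rw [hε, one_div_mul_eq_div, div_le_div_iff₀ (by positivity) (by positivity)]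
    nlinarith
  have h0 : localT ε p 1 = 1 / p - ε * Real.log p := by simp [localT]
  have hF1 : localF ε p 1 ≤ localT ε p 1 - (1 / (2 * (p : ℝ) ^ 2) - 1 / (3 * (p : ℝ) ^ 3)) := by
    have hg : geomInv p 1 = 1 + (p : ℝ)⁻¹ := by
      rw [geomInv_succ, geomInv_zero]; simp
    have hy : 0 < (p : ℝ)⁻¹ := by positivity
    have hy2 : (p : ℝ)⁻¹ ≤ 1 / 2 := by
      rw [one_div]
      exact inv_anti₀ two_pos hp'
    have hlog : Real.log (1 + (p : ℝ)⁻¹) ≤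
        (p : ℝ)⁻¹ - (p : ℝ)⁻¹ ^ 2 / 2 + (p : ℝ)⁻¹ ^ 3 / 3 :=
      log_one_add_le hy.le (by linarith)
    rw [localF, hg, h0]
    have e1 : 1 / (2 * (p : ℝ) ^ 2) = (p : ℝ)⁻¹ ^ 2 / 2 := by field_simp
    have e2 : 1 / (3 * (p : ℝ) ^ 3) = (p : ℝ)⁻¹ ^ 3 / 3 := by field_simp
    rw [e1, e2, one_div]
    push_cast
    linarith
  rcases Nat.eq_zero_or_pos k with rfl | hk
  · rw [localF_zero, h0]
    have e1 : 1 / (2 * (p : ℝ)) + 1 / (2 * p) = 1 / p := by field_simp; norm_num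
    have e2 : 1 / (2 * (p : ℝ) ^ 2) ≤ 1 / (2 * p) :=
      one_div_le_one_div_of_le (by positivity) (by nlinarith)
    have e3 : 0 ≤ 1 / (3 * (p : ℝ) ^ 3) := by positivity
    linarith
  · refine (localF_le_of_ge (by omega) ?_ hk).trans hF1
    refine le_trans ?_ hε2
    have hg := one_le_geomInv p 1
    rw [geomInv_succ, add_div, div_self (by linarith)]
    refine (Real.log_le_sub_one_of_pos (by positivity)).trans ?_
    rw [add_sub_cancel_left, one_div, ← inv_pow]
    exact div_le_self (by positivity) hg

/-- The bound for `log (σ n / n)` given by weak duality with parameter `1 / (x log x)`, improved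
by the contribution of a set `G` of primes between `√(2x)` and `x / 2`. -/
lemma log_sigma_le {x : ℝ} (hx : 1 < x) {G : Finset ℕ}
    (hG : ∀ p ∈ G, p.Prime ∧ 2 * p ≤ x ∧ 2 * x ≤ (p : ℝ) ^ 2) {n : ℕ} (hn : n ≠ 0) :
    Real.log ((sigma 1 n : ℝ) / n) ≤ 1 / (x * Real.log x) * Real.log n +
      (mertSum x - 1 / (x * Real.log x) * Chebyshev.psi x) -
      ∑ p ∈ G, (1 / (2 * (p : ℝ) ^ 2) - 1 / (3 * (p : ℝ) ^ 3)) := by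
  set ε := 1 / (x * Real.log x) with hε
  set T := (Finset.Icc 1 ⌊x⌋₊).filter Nat.Prime with hT
  set U : ℕ → ℝ := fun p ↦ ∑ j ∈ Finset.Icc 1 (Nat.log p ⌊x⌋₊), localT ε p j with hU
  set m : ℕ → ℝ := fun p ↦
    U p - if p ∈ G then 1 / (2 * (p : ℝ) ^ 2) - 1 / (3 * (p : ℝ) ^ 3) else 0 with hm
  have hm1 : ∀ p, p.Prime → ∀ k, localF ε p k ≤ m p := by
    intro p hp k
    by_cases hpG : p ∈ G
    · obtain ⟨-, h1, h2⟩ := hG p hpG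
      have hp' : (2 : ℝ) ≤ p := by exact_mod_cast hp.two_le
      have hlog : Nat.log p ⌊x⌋₊ = 1 := by
        rw [Nat.log_eq_one_iff']
        refine ⟨(Nat.le_floor_iff (by linarith)).2 (by linarith), (Nat.floor_lt (by linarith)).2 ?_⟩
        push_cast
        nlinarith
      have := localF_le_sub hx hp.two_le h1 h2 k
      simp only [hm, hU, if_pos hpG, hlog, Finset.Icc_self, Finset.sum_singleton]
      exact this
    · have := (localF_le_sum hp.two_le ε k).trans (sum_localT_le hx hp.two_le k)
      simp only [hm, hU, if_neg hpG, sub_zero]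
      exact this
  have hm0 : ∀ p, p.Prime → 0 ≤ m p := fun p hp ↦ by simpa [localF_zero] using hm1 p hp 0
  have h1 := log_sigma_le_of_localF_le (ε := ε) (T := T) (m := m)
    (fun p hp ↦ hm0 p (Finset.mem_filter.1 hp).2) (fun p _ hp ↦ hm1 p hp) (fun p hpT hp k ↦ ?_) hn
  · have hGT : G ⊆ T := fun p hp ↦ by
      obtain ⟨hp, h1, -⟩ := hG p hp
      rw [hT, Finset.mem_filter, Finset.mem_Icc]
      refine ⟨⟨hp.one_le, (Nat.le_floor_iff (by linarith)).2 ?_⟩, hp⟩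
      have : (0 : ℝ) ≤ p := p.cast_nonneg
      linarith
    have h2 : ∑ p ∈ T, m p = (mertSum x - ε * Chebyshev.psi x) -
        ∑ p ∈ G, (1 / (2 * (p : ℝ) ^ 2) - 1 / (3 * (p : ℝ) ^ 3)) := by
      rw [← sum_sum_localT, hm, Finset.sum_sub_distrib, Finset.sum_ite_mem,
        Finset.inter_eq_right.2 hGT]
    linarith
  · have hp1 : ⌊x⌋₊ < p := by
      by_contra hlt
      exact hpT (Finset.mem_filter.2 ⟨Finset.mem_Icc.2 ⟨hp.one_le, by omega⟩, hp⟩)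
    have := (localF_le_sum hp.two_le ε k).trans (sum_localT_le hx hp.two_le k)
    simpa [Nat.log_of_lt hp1] using this

end Robin

namespace Robin

open ArithmeticFunction

/-- Robin's inequality for `n`. -/
def RobinIneq (n : ℕ) : Prop :=
  (sigma 1 n : ℝ) < Real.exp Real.eulerMascheroniConstant * n * Real.log (Real.log n)

lemma robinIneq_of_log_lt {n : ℕ} (hn : 1 < Real.log n)
    (h : Real.log ((sigma 1 n : ℝ) / n) <
      Real.eulerMascheroniConstant + Real.log (Real.log (Real.log n))) : RobinIneq n := by
  have hn0 : n ≠ 0 := by rintro rfl; norm_num at hn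
  have hn' : (0 : ℝ) < n := by positivity
  have hs : (0 : ℝ) < sigma 1 n := by exact_mod_cast sigma_pos 1 n hn0
  have := Real.exp_lt_exp.2 h
  rw [Real.exp_log (by positivity), Real.exp_add, Real.exp_log (Real.log_pos hn),
    div_lt_iff₀ hn'] at this
  unfold RobinIneq
  linarith

/-- The gain needed for Robin's inequality at `n = exp (exp u)`. -/
noncomputable def needGain (u : ℝ) : ℝ := Real.exp (-u / 2) / u *
  (0.0928 * (1 + 3 / u + 4 / u ^ 2) + 1.84 * Real.exp (-u / 2) * (1 + 1 / u))

lemma robinIneq_of_needGain_lt (hRH : RiemannHypothesis) {n : ℕ} {u : ℝ} (hu : 0 < u)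
    (hnu : Real.log n = Real.exp u) {G : Finset ℕ}
    (hG : ∀ p ∈ G, p.Prime ∧ 2 * p ≤ Real.exp u ∧ 2 * Real.exp u ≤ (p : ℝ) ^ 2)
    (hg : needGain u < ∑ p ∈ G, (1 / (2 * (p : ℝ) ^ 2) - 1 / (3 * (p : ℝ) ^ 3))) :
    RobinIneq n := by
  have hx : 1 < Real.exp u := Real.one_lt_exp_iff.2 hu
  have hn0 : n ≠ 0 := by rintro rfl; norm_num at hnu; linarith
  refine robinIneq_of_log_lt (hnu ▸ hx) ?_
  have h1 := log_sigma_le hx hG hn0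
  have h2 := mertErr_le hRH hu
  have h3 : mertErr u = mertSum (Real.exp u) - Real.log u -
      (Chebyshev.psi (Real.exp u) / Real.exp u - 1) / u := by
    rw [mertErr, mert, psiNorm, Real.exp_neg, div_eq_mul_inv (Chebyshev.psi _)]
  rw [hnu, Real.log_exp] at *
  have h4 : 1 / (Real.exp u * u) * Real.exp u + (mertSum (Real.exp u) -
      1 / (Real.exp u * u) * Chebyshev.psi (Real.exp u)) = mertErr u + Real.log u := by
    rw [h3]
    have := (Real.exp_pos u).ne'
    field_simp
    ring
  unfold needGain at hg
  linarith

end Robin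

namespace Robin

open Set Filter Topology MeasureTheory ArithmeticFunction

/-- `θ(eᵘ) e⁻ᵘ` -/
noncomputable def thetaNorm (u : ℝ) : ℝ := Chebyshev.theta (Real.exp u) * Real.exp (-u)

lemma exp_neg_le_of {a v c : ℝ} (n : ℕ) (ha : 0 ≤ a) (hav : a ≤ v) (hc : 0 ≤ c)
    (h : 1 ≤ c * ∑ i ∈ Finset.range n, a ^ i / i.factorial) : Real.exp (-v) ≤ c := by
  have h1 := Real.sum_le_exp_of_nonneg ha n
  rw [Real.exp_neg, inv_le_iff_one_le_mul₀' (Real.exp_pos v), mul_comm]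
  calc 1 ≤ c * ∑ i ∈ Finset.range n, a ^ i / i.factorial := h
    _ ≤ c * Real.exp a := by gcongr
    _ ≤ c * Real.exp v := by gcongr

lemma integral_ite_exp (c a b : ℝ) :
    IntervalIntegrable (fun v ↦ if c ≤ v then Real.exp (-v) else 0) volume a b ∧
    ∫ v in a..b, (if c ≤ v then Real.exp (-v) else 0) =
      Real.exp (-max c a) - Real.exp (-max c b) := by
  have hi : IntervalIntegrable (fun v ↦ if c ≤ v then Real.exp (-v) else 0) volume a b := by
    have h1 : IntervalIntegrable (fun v ↦ Real.exp (-v)) volume a b :=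
      Continuous.intervalIntegrable (by fun_prop) _ _
    rw [intervalIntegrable_iff] at h1 ⊢
    exact h1.indicator (measurableSet_Ici (a := c))
  refine ⟨hi, ?_⟩
  rw [intervalIntegral.integral_eq_sub_of_hasDeriv_right (f := fun v ↦ -Real.exp (-max c v))
    (by fun_prop) (fun v _ ↦ ?_) hi]
  · ring
  · split_ifs with h
    · have : HasDerivWithinAt (fun v ↦ -Real.exp (-v)) (Real.exp (-v)) (Ioi v) v :=
        ((hasDerivAt_id v).neg.exp.neg.congr_deriv (by simp)).hasDerivWithinAt
      refine this.congr (fun w hw ↦ ?_) (by rw [max_eq_right h])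
      rw [max_eq_right (h.trans (le_of_lt hw))]
    · push Not at h
      refine ((hasDerivAt_const v (-Real.exp (-c))).congr_of_eventuallyEq ?_).hasDerivWithinAt
      filter_upwards [gt_mem_nhds h] with w hw
      rw [max_eq_left (le_of_lt hw)]

lemma thetaNorm_eq {b v : ℝ} (hv : v ≤ b) : thetaNorm v =
    ∑ p ∈ (Finset.Ioc 0 ⌊Real.exp b⌋₊).filter Nat.Prime,
      Real.log p * (if Real.log p ≤ v then Real.exp (-v) else 0) := by
  have h1 : Chebyshev.theta (Real.exp v) =
      ∑ p ∈ (Finset.Ioc 0 ⌊Real.exp b⌋₊).filter Nat.Prime,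
        if Real.log p ≤ v then Real.log p else 0 := by
    rw [Chebyshev.theta, ← Finset.sum_filter, Finset.filter_filter]
    refine Finset.sum_congr ?_ fun _ _ ↦ rfl
    ext p
    simp only [Finset.mem_filter, Finset.mem_Ioc]
    constructor
    · rintro ⟨⟨h0, h1⟩, hp⟩
      refine ⟨⟨h0, h1.trans (Nat.floor_mono (Real.exp_le_exp.2 hv))⟩, hp, ?_⟩
      have := (Nat.le_floor_iff (Real.exp_pos v).le).1 h1
      exact (Real.log_le_iff_le_exp (by exact_mod_cast h0)).2 this
    · rintro ⟨⟨h0, -⟩, hp, h1⟩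
      refine ⟨⟨h0, (Nat.le_floor_iff (Real.exp_pos v).le).2 ?_⟩, hp⟩
      exact (Real.log_le_iff_le_exp (by exact_mod_cast h0)).1 h1
  rw [thetaNorm, h1, Finset.sum_mul]
  exact Finset.sum_congr rfl fun p _ ↦ by split_ifs <;> simp

lemma integral_thetaNorm {a b c : ℝ} (hab : a ≤ b) (hbc : b ≤ c) :
    IntervalIntegrable thetaNorm volume a b ∧ ∫ v in a..b, thetaNorm v =
    ∑ p ∈ (Finset.Ioc 0 ⌊Real.exp c⌋₊).filter Nat.Prime,
      Real.log p * (Real.exp (-max (Real.log p) a) - Real.exp (-max (Real.log p) b)) := by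
  have heq : ∀ v ∈ uIcc a b, thetaNorm v = ∑ p ∈ (Finset.Ioc 0 ⌊Real.exp c⌋₊).filter Nat.Prime,
      Real.log p * (if Real.log p ≤ v then Real.exp (-v) else 0) := fun v hv ↦ by
    rw [uIcc_of_le hab] at hv
    exact thetaNorm_eq (hv.2.trans hbc)
  have hi : ∀ p ∈ (Finset.Ioc 0 ⌊Real.exp c⌋₊).filter Nat.Prime, IntervalIntegrable
      (fun v ↦ Real.log p * (if Real.log p ≤ v then Real.exp (-v) else 0)) volume a b :=
    fun p _ ↦ (integral_ite_exp _ _ _).1.const_mul _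
  constructor
  · have h1 := IntervalIntegrable.sum _ hi
    refine h1.congr fun v hv ↦ ?_
    simp only [Finset.sum_apply]
    exact (heq v (uIoc_subset_uIcc hv)).symm
  · rw [intervalIntegral.integral_congr heq, intervalIntegral.integral_finsetSum hi]
    exact Finset.sum_congr rfl fun p _ ↦ by
      rw [intervalIntegral.integral_const_mul, (integral_ite_exp _ _ _).2]

lemma tent_le {y p : ℝ} (hy : 0 < y) (hp : y < p) (hp4 : p ≤ 4 * y) :
    2 * ((max p (2 * y))⁻¹ - (max p (4 * y))⁻¹) - ((max p y)⁻¹ - (max p (2 * y))⁻¹) ≤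
      2 * y / p ^ 2 := by
  have hp0 := hy.trans hp
  rw [max_eq_right hp4, max_eq_left hp.le]
  rcases le_total p (2 * y) with h | h
  · rw [max_eq_right h]
    have : 2 * y / p ^ 2 - (2 * ((2 * y)⁻¹ - (4 * y)⁻¹) - (p⁻¹ - (2 * y)⁻¹)) =
        (2 * y - p) * (p + y) / (y * p ^ 2) := by field_simp; ring
    have : 0 ≤ (2 * y - p) * (p + y) / (y * p ^ 2) :=
      div_nonneg (mul_nonneg (by linarith) (by linarith)) (by positivity)
    linarith
  · rw [max_eq_left h]
    have : 2 * y / p ^ 2 - (2 * (p⁻¹ - (4 * y)⁻¹) - (p⁻¹ - p⁻¹)) =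
        (2 * y - p) ^ 2 / (2 * y * p ^ 2) := by field_simp; ring
    have : 0 ≤ (2 * y - p) ^ 2 / (2 * y * p ^ 2) := by positivity
    linarith

lemma integral_thetaNorm_tent_le {y : ℝ} (hy : 1 ≤ y) :
    2 * (∫ v in Real.log (2 * y)..Real.log (4 * y), thetaNorm v) -
      (∫ v in Real.log y..Real.log (2 * y), thetaNorm v) ≤
    2 * y * Real.log (4 * y) *
      ∑ p ∈ (Finset.Ioc ⌊y⌋₊ ⌊4 * y⌋₊).filter Nat.Prime, 1 / (p : ℝ) ^ 2 := by
  have hl1 : Real.log y ≤ Real.log (2 * y) := Real.log_le_log (by linarith) (by linarith)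
  have hl2 : Real.log (2 * y) ≤ Real.log (4 * y) := Real.log_le_log (by linarith) (by linarith)
  rw [(integral_thetaNorm hl2 le_rfl).2, (integral_thetaNorm hl1 hl2).2,
    Real.exp_log (by linarith), Finset.mul_sum, ← Finset.sum_sub_distrib, Finset.mul_sum]
  have hsub : (Finset.Ioc ⌊y⌋₊ ⌊4 * y⌋₊).filter Nat.Prime ⊆
      (Finset.Ioc 0 ⌊4 * y⌋₊).filter Nat.Prime :=
    Finset.filter_subset_filter _ (Finset.Ioc_subset_Ioc_left (Nat.zero_le _))
  have hmax : ∀ p : ℕ, p.Prime → ∀ z : ℝ, 0 < z →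
      Real.exp (-max (Real.log p) (Real.log z)) = (max (p : ℝ) z)⁻¹ := fun p hp z hz ↦ by
    have hp0 : (0 : ℝ) < p := by exact_mod_cast hp.pos
    rw [Real.exp_neg, Real.exp_monotone.map_max, Real.exp_log hp0, Real.exp_log hz]
  rw [← Finset.sum_subset hsub]
  · refine Finset.sum_le_sum fun p hp ↦ ?_
    rw [Finset.mem_filter, Finset.mem_Ioc] at hp
    obtain ⟨⟨h1, h2⟩, hp⟩ := hp
    have h1 := (Nat.floor_lt (by linarith)).1 h1
    have h2 := (Nat.le_floor_iff (by linarith)).1 h2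
    have hp1 : (1 : ℝ) < p := by exact_mod_cast hp.one_lt
    have hlp := Real.log_pos hp1
    have hlp2 : Real.log p ≤ Real.log (4 * y) := Real.log_le_log (by linarith) h2
    rw [hmax p hp _ (by linarith), hmax p hp _ (by linarith), hmax p hp _ (by linarith)]
    have h3 := mul_le_mul_of_nonneg_left (tent_le (by linarith) h1 h2) hlp.le
    calc _ = Real.log p * (2 * ((max (p : ℝ) (2 * y))⁻¹ - (max (p : ℝ) (4 * y))⁻¹) -
            ((max (p : ℝ) y)⁻¹ - (max (p : ℝ) (2 * y))⁻¹)) := by ring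
      _ ≤ Real.log p * (2 * y / (p : ℝ) ^ 2) := h3
      _ ≤ Real.log (4 * y) * (2 * y / (p : ℝ) ^ 2) := by gcongr
      _ = _ := by ring
  · intro p hp hp'
    rw [Finset.mem_filter, Finset.mem_Ioc] at hp hp'
    obtain ⟨⟨h1, h2⟩, hp⟩ := hp
    have h3 : (p : ℝ) ≤ y := by
      by_contra h
      exact hp' ⟨⟨(Nat.floor_lt (by linarith)).2 (not_le.1 h), h2⟩, hp⟩
    rw [hmax p hp _ (by linarith), hmax p hp _ (by linarith), hmax p hp _ (by linarith),
      max_eq_right h3, max_eq_right (by linarith), max_eq_right (by linarith)]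
    field_simp
    ring

lemma integral_psiNorm (u v : ℝ) : ∫ t in u..v, psiNorm t = v - u + psiPrim u - psiPrim v := by
  have h := psiPrim_sub u v
  rw [intervalIntegral.integral_sub (intervalIntegrable_psiNorm u v) (by simp)] at h
  simp at h
  linarith

lemma psiNorm_le_psiPrim (v : ℝ) :
    psiNorm v ≤ 2 * (Real.log 2 + psiPrim v - psiPrim (v + Real.log 2)) := by
  have hl := Real.log_pos (one_lt_two (α := ℝ))
  have h1 : ∫ t in v..v + Real.log 2, Chebyshev.psi (Real.exp v) * Real.exp (-t) ≤
      ∫ t in v..v + Real.log 2, psiNorm t := by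
    refine intervalIntegral.integral_mono_on (by linarith)
      (Continuous.intervalIntegrable (by fun_prop) _ _) (intervalIntegrable_psiNorm _ _) fun t ht ↦ ?_
    exact mul_le_mul_of_nonneg_right (Chebyshev.psi_mono (Real.exp_le_exp.2 ht.1))
      (Real.exp_pos _).le
  have h2 : ∫ t in v..v + Real.log 2, Real.exp (-t) = Real.exp (-v) / 2 := by
    rw [intervalIntegral.integral_eq_sub_of_hasDerivAt (f := fun t ↦ -Real.exp (-t))
      (fun t _ ↦ (hasDerivAt_id t).neg.exp.neg.congr_deriv (by simp))
      (Continuous.intervalIntegrable (by fun_prop) _ _), neg_add, Real.exp_add,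
      Real.exp_neg (Real.log 2), Real.exp_log two_pos]
    ring
  rw [intervalIntegral.integral_const_mul, h2, integral_psiNorm] at h1
  unfold psiNorm
  linarith

lemma psiNorm_le_of_rh (hRH : RiemannHypothesis) {v : ℝ} (hv : 0 < v) :
    psiNorm v ≤ 1.3863 + 0.3712 * Real.exp (-(v / 2)) + 1.84 * Real.exp (-v) := by
  have hl := Real.log_pos (one_lt_two (α := ℝ))
  have h0 := psiNorm_le_psiPrim v
  have h1 := psiPrim_le hRH hv
  have h2 := le_psiPrim hRH (by linarith : 0 < v + Real.log 2)
  have h3 : Real.exp (-(v + Real.log 2)) = Real.exp (-v) / 2 := by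
    rw [neg_add, Real.exp_add, Real.exp_neg (Real.log 2), Real.exp_log two_pos]
    ring
  have h4 : Real.exp (-(v + Real.log 2) / 2) ≤ Real.exp (-v / 2) := Real.exp_le_exp.2 (by linarith)
  rw [← neg_div]
  linarith [Real.log_two_lt_d9]

lemma psi_exp_sub_theta_le (hRH : RiemannHypothesis) {v : ℝ} (hv : 6.5 ≤ v) :
    psiNorm v - thetaNorm v ≤ 2.42 * Real.exp (-(v / 2)) := by
  have h := Chebyshev.psi_sub_theta_le_psi_add_psi_add_psi (Real.exp v)
  simp only [← Real.exp_mul] at h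
  have key : ∀ w : ℝ, Chebyshev.psi (Real.exp w) = psiNorm w * Real.exp w := fun w ↦ by
    rw [psiNorm, mul_assoc, ← Real.exp_add]; simp
  have b1 : psiNorm (v * 2⁻¹) ≤ 1.535 := by
    have := psiNorm_le_of_rh hRH (by linarith : 0 < v * 2⁻¹)
    have := exp_neg_le_of (a := 1.625) (v := v * 2⁻¹ / 2) (c := 0.1972) 9 (by norm_num)
      (by linarith) (by norm_num) (by norm_num [Finset.sum_range_succ, Nat.factorial])
    have := exp_neg_le_of (a := 3.25) (v := v * 2⁻¹) (c := 0.039) 12 (by norm_num)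
      (by linarith) (by norm_num) (by norm_num [Finset.sum_range_succ, Nat.factorial])
    linarith
  have b2 : psiNorm (v * 3⁻¹) ≤ 1.726 := by
    have := psiNorm_le_of_rh hRH (by linarith : 0 < v * 3⁻¹)
    have := exp_neg_le_of (a := 1.083) (v := v * 3⁻¹ / 2) (c := 0.3388) 9 (by norm_num)
      (by linarith) (by norm_num) (by norm_num [Finset.sum_range_succ, Nat.factorial])
    have := exp_neg_le_of (a := 2.166) (v := v * 3⁻¹) (c := 0.1148) 12 (by norm_num)
      (by linarith) (by norm_num) (by norm_num [Finset.sum_range_succ, Nat.factorial])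
    linarith
  have b3 : psiNorm (v * 5⁻¹) ≤ 2.083 := by
    have := psiNorm_le_of_rh hRH (by linarith : 0 < v * 5⁻¹)
    have := exp_neg_le_of (a := 0.65) (v := v * 5⁻¹ / 2) (c := 0.5222) 9 (by norm_num)
      (by linarith) (by norm_num) (by norm_num [Finset.sum_range_succ, Nat.factorial])
    have := exp_neg_le_of (a := 1.3) (v := v * 5⁻¹) (c := 0.2726) 12 (by norm_num)
      (by linarith) (by norm_num) (by norm_num [Finset.sum_range_succ, Nat.factorial])
    linarith
  have e2 := exp_neg_le_of (a := 1.083) (v := v / 6) (c := 0.3388) 9 (by norm_num)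
    (by linarith) (by norm_num) (by norm_num [Finset.sum_range_succ, Nat.factorial])
  have e3 := exp_neg_le_of (a := 1.95) (v := 3 * v / 10) (c := 0.1424) 12 (by norm_num)
    (by linarith) (by norm_num) (by norm_num [Finset.sum_range_succ, Nat.factorial])
  rw [key (v * 2⁻¹), key (v * 3⁻¹), key (v * 5⁻¹)] at h
  have h1 := mul_le_mul_of_nonneg_right h (Real.exp_pos (-v)).le
  have f1 : Real.exp (v * 2⁻¹) * Real.exp (-v) = Real.exp (-(v / 2)) := by
    rw [← Real.exp_add]; ring_nf
  have f2 : Real.exp (v * 3⁻¹) * Real.exp (-v) = Real.exp (-(v / 2)) * Real.exp (-(v / 6)) := by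
    rw [← Real.exp_add, ← Real.exp_add]; ring_nf
  have f3 : Real.exp (v * 5⁻¹) * Real.exp (-v) = Real.exp (-(v / 2)) * Real.exp (-(3 * v / 10)) := by
    rw [← Real.exp_add, ← Real.exp_add]; ring_nf
  have hz := Real.exp_pos (-(v / 2))
  calc psiNorm v - thetaNorm v = (Chebyshev.psi (Real.exp v) - Chebyshev.theta (Real.exp v)) *
        Real.exp (-v) := by unfold psiNorm thetaNorm; ring
    _ ≤ psiNorm (v * 2⁻¹) * (Real.exp (v * 2⁻¹) * Real.exp (-v)) +
        psiNorm (v * 3⁻¹) * (Real.exp (v * 3⁻¹) * Real.exp (-v)) +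
        psiNorm (v * 5⁻¹) * (Real.exp (v * 5⁻¹) * Real.exp (-v)) := by linarith
    _ ≤ 1.535 * Real.exp (-(v / 2)) + 1.726 * (Real.exp (-(v / 2)) * 0.3388) +
        2.083 * (Real.exp (-(v / 2)) * 0.1424) := by
        rw [f1, f2, f3]
        gcongr
    _ ≤ _ := by linarith

lemma le_tent_integral (hRH : RiemannHypothesis) {a : ℝ} (ha : 5.84 ≤ a) :
    0.53 ≤ 2 * (∫ t in (a + Real.log 2)..(a + 2 * Real.log 2), thetaNorm t) -
      ∫ t in a..(a + Real.log 2), thetaNorm t := by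
  have l1 := Real.log_two_gt_d9
  have l2 := Real.log_two_lt_d9
  have i1 := (integral_thetaNorm (a := a + Real.log 2) (b := a + 2 * Real.log 2)
    (c := a + 2 * Real.log 2) (by linarith) le_rfl).1
  have i2 := (integral_thetaNorm (a := a) (b := a + Real.log 2)
    (c := a + Real.log 2) (by linarith) le_rfl).1
  have le (t : ℝ) : thetaNorm t ≤ psiNorm t :=
    mul_le_mul_of_nonneg_right (Chebyshev.theta_le_psi _) (Real.exp_pos _).le
  have m2 : ∫ t in a..(a + Real.log 2), thetaNorm t ≤ ∫ t in a..(a + Real.log 2), psiNorm t :=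
    intervalIntegral.integral_mono (by linarith) i2 (intervalIntegrable_psiNorm _ _) le
  have m1 : ∫ t in (a + Real.log 2)..(a + 2 * Real.log 2), (psiNorm t - 0.0925) ≤
      ∫ t in (a + Real.log 2)..(a + 2 * Real.log 2), thetaNorm t := by
    refine intervalIntegral.integral_mono_on (by linarith)
      ((intervalIntegrable_psiNorm _ _).sub intervalIntegrable_const) i1 fun t ht ↦ ?_
    have h1 := psi_exp_sub_theta_le hRH (v := t) (by linarith [ht.1])
    have h2 := exp_neg_le_of (a := 3.266) (v := t / 2) (c := 0.0382) 14 (by norm_num)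
      (by linarith [ht.1]) (by norm_num) (by norm_num [Finset.sum_range_succ, Nat.factorial])
    linarith
  rw [intervalIntegral.integral_sub (intervalIntegrable_psiNorm _ _) intervalIntegrable_const,
    intervalIntegral.integral_const, integral_psiNorm] at m1
  rw [integral_psiNorm] at m2
  rw [smul_eq_mul] at m1
  have b1 := psiPrim_le hRH (u := a) (by linarith)
  have b2 := psiPrim_le hRH (u := a + 2 * Real.log 2) (by linarith)
  have b3 := le_psiPrim hRH (u := a + Real.log 2) (by linarith)
  have e1 := exp_neg_le_of (a := 2.92) (v := a / 2) (c := 0.0541) 14 (by norm_num)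
    (by linarith) (by norm_num) (by norm_num [Finset.sum_range_succ, Nat.factorial])
  have e2 := exp_neg_le_of (a := 2.92) (v := (a + 2 * Real.log 2) / 2) (c := 0.0541) 14
    (by norm_num) (by linarith) (by norm_num) (by norm_num [Finset.sum_range_succ, Nat.factorial])
  have e3 := exp_neg_le_of (a := 3.266) (v := (a + Real.log 2) / 2) (c := 0.0382) 14 (by norm_num)
    (by linarith) (by norm_num) (by norm_num [Finset.sum_range_succ, Nat.factorial])
  have e4 := exp_neg_le_of (a := 6.532) (v := a + Real.log 2) (c := 0.0015) 20 (by norm_num)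
    (by linarith) (by norm_num) (by norm_num [Finset.sum_range_succ, Nat.factorial])
  rw [← neg_div] at e1 e2 e3
  linarith

theorem robinIneq_of_large (hRH : RiemannHypothesis) {n : ℕ} {u : ℝ} (hu : 11 ≤ u)
    (hnu : Real.log n = Real.exp u) : RobinIneq n := by
  have l1 := Real.log_two_gt_d9
  have l2 := Real.log_two_lt_d9
  set E := Real.exp (u / 2) with hE
  have hE2 : E ^ 2 = Real.exp u := by rw [hE, ← Real.exp_nat_mul]; push_cast; ring_nf
  have hE0 : 0 < E := Real.exp_pos _
  have hEinv : Real.exp (-u / 2) = E⁻¹ := by rw [hE, ← Real.exp_neg]; ring_nf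
  have hEinv_le : E⁻¹ ≤ 0.0041 := by
    rw [← hEinv, neg_div]
    exact exp_neg_le_of (a := 5.5) 20 (by norm_num) (by linarith) (by norm_num)
      (by norm_num [Finset.sum_range_succ, Nat.factorial])
  have hE243 : 243 ≤ E := by
    by_contra! h
    have : E⁻¹ * E = 1 := inv_mul_cancel₀ hE0.ne'
    nlinarith
  set r := Real.sqrt 2 with hr
  have hr2 : r ^ 2 = 2 := Real.sq_sqrt zero_le_two
  have hr1 : 1.4142 ≤ r := Real.le_sqrt_of_sq_le (by norm_num)
  have hr3 : r ≤ 1.4143 := Real.sqrt_le_iff.2 ⟨by norm_num, by norm_num⟩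
  have hr0 : 0 < r := by linarith
  set y := r * E with hy
  have hy343 : 343 ≤ y := by nlinarith
  have hy2 : y ^ 2 = 2 * Real.exp u := by rw [hy, mul_pow, hr2, hE2]
  set a := Real.log y with ha
  have ha' : a = Real.log 2 / 2 + u / 2 := by
    rw [ha, hy, Real.log_mul hr0.ne' hE0.ne', hr, Real.log_sqrt zero_le_two, hE, Real.log_exp]
  have h2y : Real.log (2 * y) = a + Real.log 2 := by
    rw [Real.log_mul two_ne_zero (by linarith)]; ring
  have h4y : Real.log (4 * y) = a + 2 * Real.log 2 := by
    rw [Real.log_mul four_ne_zero (by linarith), show (4 : ℝ) = 2 ^ 2 by norm_num, Real.log_pow]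
    push_cast; ring
  have hW := le_tent_integral hRH (a := a) (by linarith)
  have hT := integral_thetaNorm_tent_le (y := y) (by linarith)
  rw [h2y, h4y] at hT
  set G := (Finset.Ioc ⌊y⌋₊ ⌊4 * y⌋₊).filter Nat.Prime with hG
  have hGm : ∀ p ∈ G, p.Prime ∧ y < p ∧ (p : ℝ) ≤ 4 * y := fun p hp ↦ by
    rw [hG, Finset.mem_filter, Finset.mem_Ioc] at hp
    exact ⟨hp.2, (Nat.floor_lt (by linarith)).1 hp.1.1,
      (Nat.le_floor_iff (by linarith)).1 hp.1.2⟩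
  refine robinIneq_of_needGain_lt hRH (by linarith) hnu (G := G) (fun p hp ↦ ?_) ?_
  · obtain ⟨h1, h2, h3⟩ := hGm p hp
    refine ⟨h1, by nlinarith, ?_⟩
    rw [← hy2]
    gcongr
  have hsum : 0.499 * ∑ p ∈ G, 1 / (p : ℝ) ^ 2 ≤
      ∑ p ∈ G, (1 / (2 * (p : ℝ) ^ 2) - 1 / (3 * (p : ℝ) ^ 3)) := by
    rw [Finset.mul_sum]
    refine Finset.sum_le_sum fun p hp ↦ ?_
    have hp' : (343 : ℝ) ≤ p := hy343.trans (hGm p hp).2.1.le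
    have : 0 < (p : ℝ) := by linarith
    rw [← sub_nonneg]
    have : 1 / (2 * (p : ℝ) ^ 2) - 1 / (3 * (p : ℝ) ^ 3) - 0.499 * (1 / (p : ℝ) ^ 2) =
      (0.001 * p - 1 / 3) / p ^ 3 := by field_simp; ring
    rw [this]
    exact div_nonneg (by linarith) (by positivity)
  refine lt_of_lt_of_le ?_ hsum
  set S := ∑ p ∈ G, 1 / (p : ℝ) ^ 2
  have hS : 0.53 / (2 * y * (a + 2 * Real.log 2)) ≤ S := by
    rw [div_le_iff₀ (mul_pos (by linarith) (by linarith))]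
    linarith
  refine lt_of_lt_of_le ?_ (mul_le_mul_of_nonneg_left hS (by norm_num))
  have hN : 0.0928 * (1 + 3 / u + 4 / u ^ 2) + 1.84 * E⁻¹ * (1 + 1 / u) ≤ 0.1295 := by
    have q1 : 3 / u ≤ 3 / 11 := by gcongr
    have q2 : 4 / u ^ 2 ≤ 4 / 11 ^ 2 := by gcongr
    have q3 : 1 / u ≤ 1 / 11 := by gcongr
    have q4 : 0 ≤ 1 / u := by positivity
    have : 1.84 * E⁻¹ * (1 + 1 / u) ≤ 1.84 * 0.0041 * (1 + 1 / 11) := by gcongr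
    linarith
  rw [needGain, hEinv]
  have hu0 : 0 < u := by linarith
  refine lt_of_le_of_lt (mul_le_mul_of_nonneg_left hN (by positivity)) ?_
  rw [show E⁻¹ / u * 0.1295 = 0.1295 / (E * u) by field_simp, hy,
    show 0.499 * (0.53 / (2 * (r * E) * (a + 2 * Real.log 2))) =
      0.26447 / (E * (2 * r * (a + 2 * Real.log 2))) by
        have : 0 < a + 2 * Real.log 2 := by linarith
        field_simp; norm_num]
  rw [div_lt_div_iff₀ (by positivity) (by
    have : 0 < a + 2 * Real.log 2 := by linarith
    positivity)]
  have : 0.1295 * (2 * r * (a + 2 * Real.log 2)) < 0.26447 * u := by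
    have : r * (a + 2 * Real.log 2) ≤ 1.4143 * (a + 2 * Real.log 2) :=
      mul_le_mul_of_nonneg_right hr3 (by linarith)
    linarith
  nlinarith

end Robin

namespace Robin

/-- A primality test for `p < 1444`, using the greatest common divisor with `37!`. -/
def trialPrime (p : ℕ) : Bool :=
  bif Nat.ble 38 p then
    bif Nat.ble 1444 p then false else Nat.beq (Nat.gcd p 13763753091226345046315979581580902400000000) 1
  else [2, 3, 5, 7, 11, 13, 17, 19, 23, 29, 31, 37].contains p

lemma factorial_thirty_seven : 13763753091226345046315979581580902400000000 = Nat.factorial 37 := by decide +kernel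

lemma trialPrime_of_lt {p : ℕ} (h : p < 38) : trialPrime p = true ↔ p.Prime := by
  have : ∀ p < 38, trialPrime p = true ↔ p.Prime := by decide +kernel
  exact this p h

lemma trialPrime_of_ge {p : ℕ} (h : 38 ≤ p) :
    trialPrime p = true ↔ p < 1444 ∧ Nat.Coprime p (Nat.factorial 37) := by
  have h1 : Nat.ble 38 p = true := by rwa [Nat.ble_eq]
  rw [trialPrime, h1, cond_true, factorial_thirty_seven]
  by_cases h2 : p < 1444
  · have h3 : Nat.ble 1444 p = false := by
      rw [← Bool.not_eq_true, Nat.ble_eq]; omega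
    rw [h3, cond_false, Nat.beq_eq]
    exact ⟨fun h ↦ ⟨h2, h⟩, fun h ↦ h.2⟩
  · have h3 : Nat.ble 1444 p = true := by rw [Nat.ble_eq]; omega
    rw [h3, cond_true]
    simp [h2]

lemma prime_of_trialPrime {p : ℕ} (h : trialPrime p = true) : p.Prime := by
  rcases lt_or_ge p 38 with hp | hp
  · exact (trialPrime_of_lt hp).1 h
  obtain ⟨h1, h2⟩ := (trialPrime_of_ge hp).1 h
  by_contra hnp
  have hm := Nat.minFac_sq_le_self (by omega) hnp
  have hm2 := Nat.minFac_prime (n := p) (by omega)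
  exact Nat.not_coprime_of_dvd_of_dvd hm2.one_lt (Nat.minFac_dvd p)
    (Nat.dvd_factorial hm2.pos (by nlinarith)) h2

lemma trialPrime_of_prime {p : ℕ} (hp : p.Prime) (h : p < 1444) : trialPrime p = true := by
  rcases lt_or_ge p 38 with h38 | h38
  · exact (trialPrime_of_lt h38).2 hp
  · refine (trialPrime_of_ge h38).2 ⟨h, (Nat.Prime.coprime_iff_not_dvd hp).2 fun hd ↦ ?_⟩
    have := hp.dvd_factorial.1 hd
    omega

/-- Fixed-point lower bound (unit `10⁻¹²`) for the sum of `1/(2p²) - 1/(3p³)` over primes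
in `[a, a + k)`. -/
def gainFixed (a : ℕ) : ℕ → ℕ
  | 0 => 0
  | k + 1 => gainFixed a k +
      if trialPrime (a + k) then (10 ^ 12 * (3 * (a + k) - 2)) / (6 * (a + k) ^ 3) else 0

lemma gainFixed_le (a k : ℕ) : (gainFixed a k : ℝ) / 10 ^ 12 ≤
    ∑ p ∈ (Finset.Ico a (a + k)).filter (fun p ↦ trialPrime p = true),
      (1 / (2 * (p : ℝ) ^ 2) - 1 / (3 * (p : ℝ) ^ 3)) := by
  rw [Finset.sum_filter, Finset.sum_Ico_eq_sum_range, Nat.add_sub_cancel_left]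
  induction k with
  | zero => simp [gainFixed]
  | succ k ih =>
    rw [Finset.sum_range_succ, gainFixed, Nat.cast_add, add_div]
    refine add_le_add ih ?_
    split_ifs with h
    · have h2 := (prime_of_trialPrime h).two_le
      set p := a + k
      have hp : (2 : ℝ) ≤ p := by exact_mod_cast h2
      have h3 : ((10 ^ 12 * (3 * p - 2) / (6 * p ^ 3) : ℕ) : ℝ) ≤
          (10 ^ 12 * (3 * p - 2) : ℕ) / (6 * p ^ 3 : ℕ) := Nat.cast_div_le
      rw [div_le_iff₀ (by norm_num)]
      refine h3.trans (le_of_eq ?_)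
      rw [Nat.cast_mul, Nat.cast_sub (by omega)]
      push_cast
      field_simp
      ring
    · simp

/-- The verification of a cell `log log n ∈ [i/8, (i+1)/8]` using the primes in `[a, a + k)`;
`E` bounds `10⁶ exp(-i/16)`. -/
def cellCheck : ℕ × ℕ × ℕ × ℕ → Bool
  | (i, a, k, E) => 1 ≤ i && 10 ^ (96 + 10 * i) ≤ E ^ 16 * 27182818283 ^ i &&
    2 ^ 8 * 27182818286 ^ (i + 1) ≤ a ^ 16 * 10 ^ (10 * (i + 1)) &&
    (2 * (a + k)) ^ 8 * 10 ^ (10 * i) ≤ 27182818283 ^ i &&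
    E * 8 * (928 * (i * i + 24 * i + 256) * 10 ^ 6 + 18400 * E * (i * i + 8 * i)) * 10 ^ 12 <
      gainFixed a k * 10 ^ 16 * i ^ 3

lemma lt_exp_nat (i : ℕ) : ((27182818283 : ℝ) / 10 ^ 10) ^ i ≤ Real.exp i := by
  rw [← mul_one (i : ℝ), Real.exp_nat_mul]
  gcongr
  linarith [Real.exp_one_gt_d9]

lemma exp_nat_lt (i : ℕ) : Real.exp i ≤ ((27182818286 : ℝ) / 10 ^ 10) ^ i := by
  rw [← mul_one (i : ℝ), Real.exp_nat_mul]
  gcongr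
  linarith [Real.exp_one_lt_d9]

lemma robinIneq_of_cellCheck (hRH : RiemannHypothesis) {i a k E : ℕ}
    (h : cellCheck (i, a, k, E) = true) {n : ℕ} {u : ℝ} (hu : (i : ℝ) / 8 ≤ u)
    (hu' : u ≤ ((i + 1 : ℕ) : ℝ) / 8) (hnu : Real.log n = Real.exp u) : RobinIneq n := by
  simp only [cellCheck, Bool.and_eq_true, decide_eq_true_eq] at h
  obtain ⟨⟨⟨⟨hi, hE⟩, ha⟩, hb⟩, hg⟩ := h
  have hi0 : (0 : ℝ) < i := by exact_mod_cast hi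
  have hu0 : 0 < u := by linarith [div_pos hi0 (by norm_num : (0 : ℝ) < 8)]
  have hE' : Real.exp (-u / 2) ≤ E / 10 ^ 6 := by
    refine (Real.exp_le_exp.2 (by linarith : -u / 2 ≤ -(i : ℝ) / 16)).trans ?_
    rw [← pow_le_pow_iff_left₀ (Real.exp_pos _).le (by positivity) (by norm_num : 16 ≠ 0),
      ← Real.exp_nat_mul]
    have h1 : ((16 : ℕ) : ℝ) * (-(i : ℝ) / 16) = -i := by push_cast; ring
    rw [h1, Real.exp_neg, inv_le_iff_one_le_mul₀ (Real.exp_pos _)]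
    refine le_trans ?_ (mul_le_mul_of_nonneg_left (lt_exp_nat i) (by positivity))
    rw [div_pow, div_pow, div_mul_div_comm, le_div_iff₀ (by positivity), one_mul, ← pow_mul,
      ← pow_mul, ← pow_add]
    exact_mod_cast hE
  have ha' : 2 * Real.exp u ≤ (a : ℝ) ^ 2 := by
    refine (mul_le_mul_of_nonneg_left (Real.exp_le_exp.2 hu') zero_le_two).trans ?_
    rw [← pow_le_pow_iff_left₀ (by positivity) (by positivity) (by norm_num : 8 ≠ 0), mul_pow,
      ← Real.exp_nat_mul]
    have h1 : ((8 : ℕ) : ℝ) * (((i + 1 : ℕ) : ℝ) / 8) = (i + 1 : ℕ) := by push_cast; ring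
    rw [h1]
    refine (mul_le_mul_of_nonneg_left (exp_nat_lt (i + 1)) (by positivity)).trans ?_
    rw [div_pow, ← mul_div_assoc, div_le_iff₀ (by positivity), ← pow_mul, ← pow_mul]
    exact_mod_cast ha
  have hb' : 2 * ((a : ℝ) + k) ≤ Real.exp u := by
    refine le_trans ?_ (Real.exp_le_exp.2 hu)
    rw [← pow_le_pow_iff_left₀ (by positivity) (Real.exp_pos _).le (by norm_num : 8 ≠ 0),
      ← Real.exp_nat_mul]
    have h1 : ((8 : ℕ) : ℝ) * ((i : ℝ) / 8) = i := by push_cast; ring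
    rw [h1]
    refine le_trans ?_ (lt_exp_nat i)
    rw [div_pow, le_div_iff₀ (by positivity), ← pow_mul]
    exact_mod_cast hb
  refine robinIneq_of_needGain_lt hRH hu0 hnu
    (G := (Finset.Ico a (a + k)).filter (fun p ↦ trialPrime p = true)) (fun p hp ↦ ?_)
    (lt_of_lt_of_le ?_ (gainFixed_le a k))
  · rw [Finset.mem_filter, Finset.mem_Ico] at hp
    have h1 : (a : ℝ) ≤ p := by exact_mod_cast hp.1.1
    have h2 : (p : ℝ) ≤ a + k := by exact_mod_cast hp.1.2.le
    exact ⟨prime_of_trialPrime hp.2, by linarith, ha'.trans (by gcongr)⟩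
  · have hle : needGain u ≤ (E / 10 ^ 6) / (i / 8) *
        (0.0928 * (1 + 3 / (i / 8) + 4 / (i / 8) ^ 2) + 1.84 * (E / 10 ^ 6) * (1 + 1 / (i / 8))) := by
      have : (0 : ℝ) < i / 8 := by positivity
      unfold needGain
      gcongr
    refine hle.trans_lt ?_
    have hg' : ((E * 8 * (928 * (i * i + 24 * i + 256) * 10 ^ 6 + 18400 * E * (i * i + 8 * i)) *
      10 ^ 12 : ℕ) : ℝ) < (gainFixed a k * 10 ^ 16 * i ^ 3 : ℕ) := by exact_mod_cast hg
    push_cast at hg'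
    rw [lt_div_iff₀ (by norm_num)]
    have : ((E : ℝ) / 10 ^ 6) / (i / 8) * (0.0928 * (1 + 3 / (i / 8) + 4 / (i / 8) ^ 2) +
        1.84 * (E / 10 ^ 6) * (1 + 1 / (i / 8))) * 10 ^ 12 =
        (E * 8 * (928 * (i * i + 24 * i + 256) * 10 ^ 6 + 18400 * E * (i * i + 8 * i)) *
          10 ^ 12) / (10 ^ 16 * i ^ 3) := by
      field_simp
      norm_num
      ring
    rw [this, div_lt_iff₀ (by positivity)]
    linarith

/-- Cells covering `log log n ∈ [6, 11]`. -/
def midCells : List (ℕ × ℕ × ℕ × ℕ) :=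
  [(48, 31, 83, 49788), (49, 33, 88, 46771), (50, 35, 94, 43937), (51, 37, 101, 41275), (52,
    39, 107, 38775), (53, 42, 114, 36425), (54, 44, 122, 34219), (55, 47, 129, 32145), (56,
    50, 138, 30198), (57, 54, 146, 28368), (58, 57, 156, 26650), (59, 61, 165, 25035), (60,
    65, 176, 23518), (61, 69, 188, 22093), (62, 73, 200, 20755), (63, 78, 213, 19497), (64,
    83, 226, 18316), (65, 88, 241, 17206), (66, 94, 256, 16164), (67, 100, 273, 15185), (68,
    106, 291, 14265), (69, 113, 310, 13401), (70, 120, 330, 12589), (71, 128, 351, 11826),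
    (72, 136, 374, 11109), (73, 145, 398, 10436), (74, 154, 424, 9804), (75, 164, 451, 9210),
    (76, 175, 479, 8652), (77, 186, 511, 8128), (78, 198, 543, 7636), (79, 210, 579, 7173),
    (80, 224, 616, 6738), (81, 238, 656, 6330), (82, 254, 698, 5947), (83, 270, 743, 5586),
    (84, 287, 792, 5248), (85, 306, 842, 4930), (86, 326, 896, 4631), (87, 347, 954, 4351)]

lemma midCells_check : midCells.all cellCheck = true := by decide +kernel

lemma midCells_cover : ∀ i < 88, 48 ≤ i → ∃ c ∈ midCells, c.1 = i := by decide +kernel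

theorem robinIneq_of_mid (hRH : RiemannHypothesis) {n : ℕ} {u : ℝ} (hu : 6 ≤ u) (hu' : u < 11)
    (hnu : Real.log n = Real.exp u) : RobinIneq n := by
  have h1 : 48 ≤ ⌊8 * u⌋₊ := Nat.le_floor (by push_cast; linarith)
  have h2 : ⌊8 * u⌋₊ < 88 := (Nat.floor_lt (by linarith)).2 (by push_cast; linarith)
  obtain ⟨⟨i, a, k, E⟩, hc, hi⟩ := midCells_cover _ h2 h1
  have hi' : i = ⌊8 * u⌋₊ := hi
  refine robinIneq_of_cellCheck hRH (List.all_eq_true.1 midCells_check _ hc) (u := u) ?_ ?_ hnu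
  · have := Nat.floor_le (a := 8 * u) (by linarith)
    rw [hi']
    linarith
  · have := Nat.lt_floor_add_one (8 * u)
    rw [hi']
    push_cast
    linarith

end Robin

namespace Robin

/-- The sum `1 + p + ⋯ + pᵏ`. -/
def geomNat (p : ℕ) : ℕ → ℕ
  | 0 => 1
  | k + 1 => p * geomNat p k + 1

lemma geomNat_pos (p k : ℕ) : 0 < geomNat p k := by
  cases k <;> simp [geomNat]

lemma geomInv_eq_geomNat {p : ℕ} (hp : 1 ≤ p) (k : ℕ) :
    geomInv p k = geomNat p k / (p : ℝ) ^ k := by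
  have hp0 : (p : ℝ) ≠ 0 := by positivity
  induction k with
  | zero => simp [geomInv_zero, geomNat]
  | succ k ih =>
    rw [geomInv_succ, ih, geomNat, inv_pow]
    push_cast
    field_simp
    ring

/-- `expo t p` is the number of entries of `t` that are at least `p`. -/
def expo (t : List ℕ) (p : ℕ) : ℕ := (t.filter (p ≤ ·)).length

/-- `∏ (1 + p + ⋯ + p ^ expo t p)` over the primes `p < Q`. -/
def prodSigma (t : List ℕ) : ℕ → ℕ
  | 0 => 1
  | q + 1 => prodSigma t q * if trialPrime q then geomNat q (expo t q) else 1

/-- `∏ p ^ expo t p` over the primes `p < Q`. -/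
def prodPow (t : List ℕ) : ℕ → ℕ
  | 0 => 1
  | q + 1 => prodPow t q * if trialPrime q then q ^ expo t q else 1

lemma prodSigma_pos (t : List ℕ) (Q : ℕ) : 0 < prodSigma t Q := by
  induction Q with
  | zero => simp [prodSigma]
  | succ q ih =>
    rw [prodSigma]
    split_ifs
    · exact Nat.mul_pos ih (geomNat_pos _ _)
    · simpa using ih

lemma prodPow_pos (t : List ℕ) (Q : ℕ) : 0 < prodPow t Q := by
  induction Q with
  | zero => simp [prodPow]
  | succ q ih =>
    rw [prodPow]
    split_ifs with h
    · exact Nat.mul_pos ih (Nat.pow_pos (prime_of_trialPrime h).pos)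
    · simpa using ih

lemma sum_localF_eq (t : List ℕ) (ε : ℝ) (Q : ℕ) :
    ∑ p ∈ (Finset.range Q).filter (fun p ↦ trialPrime p = true), localF ε p (expo t p) =
      Real.log (prodSigma t Q) - (1 + ε) * Real.log (prodPow t Q) := by
  rw [Finset.sum_filter]
  induction Q with
  | zero => simp [prodSigma, prodPow]
  | succ q ih =>
    have h1 : (prodSigma t q : ℝ) ≠ 0 := by exact_mod_cast (prodSigma_pos t q).ne'
    have h2 : (prodPow t q : ℝ) ≠ 0 := by exact_mod_cast (prodPow_pos t q).ne'
    rw [Finset.sum_range_succ, ih, prodSigma, prodPow]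
    split_ifs with h
    · have hq := (prime_of_trialPrime h).pos
      have hq0 : (q : ℝ) ≠ 0 := by positivity
      have h3 : (geomNat q (expo t q) : ℝ) ≠ 0 := by exact_mod_cast (geomNat_pos q _).ne'
      rw [localF, geomInv_eq_geomNat hq, Real.log_div h3 (pow_ne_zero _ hq0), Nat.cast_mul,
        Nat.cast_mul, Real.log_mul h1 h3, Nat.cast_pow, Real.log_mul h2 (pow_ne_zero _ hq0),
        Real.log_pow]
      ring
    · simp

/-- The threshold inequalities making `expo t p` the optimal exponent of `p` for `ε = 1 / b`. -/
def localCheck (b : ℕ) (t : List ℕ) (p : ℕ) : Bool :=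
  !trialPrime p || (1 ≤ expo t p &&
    p * (p * geomNat p (expo t p - 1)) ^ b ≤ geomNat p (expo t p) ^ b &&
    geomNat p (expo t p + 1) ^ b ≤ p * (p * geomNat p (expo t p)) ^ b)

lemma geomInv_ratio {p : ℕ} (hp : 1 ≤ p) (k : ℕ) :
    geomInv p (k + 1) / geomInv p k = geomNat p (k + 1) / (p * geomNat p k) := by
  have hp0 : (p : ℝ) ≠ 0 := by positivity
  have h3 : (geomNat p k : ℝ) ≠ 0 := by exact_mod_cast (geomNat_pos p _).ne'
  rw [geomInv_eq_geomNat hp, geomInv_eq_geomNat hp]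
  field_simp
  ring

lemma log_ratio_le {b p k : ℕ} (hb : 0 < b) (hp : 1 ≤ p)
    (h : geomNat p (k + 1) ^ b ≤ p * (p * geomNat p k) ^ b) :
    Real.log (geomInv p (k + 1) / geomInv p k) ≤ 1 / b * Real.log p := by
  have hp0 : (0 : ℝ) < p := by positivity
  have h3 : (0 : ℝ) < geomNat p k := by exact_mod_cast geomNat_pos p _
  have h4 : (0 : ℝ) < geomNat p (k + 1) := by exact_mod_cast geomNat_pos p _
  have hb' : (0 : ℝ) < b := by exact_mod_cast hb
  rw [geomInv_ratio hp, one_div_mul_eq_div, le_div_iff₀ hb', mul_comm, ← Real.log_pow]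
  refine Real.log_le_log (by positivity) ?_
  rw [div_pow, div_le_iff₀ (by positivity)]
  exact_mod_cast h

lemma le_log_ratio {b p k : ℕ} (hb : 0 < b) (hp : 1 ≤ p)
    (h : p * (p * geomNat p k) ^ b ≤ geomNat p (k + 1) ^ b) :
    1 / b * Real.log p ≤ Real.log (geomInv p (k + 1) / geomInv p k) := by
  have hp0 : (0 : ℝ) < p := by positivity
  have h3 : (0 : ℝ) < geomNat p k := by exact_mod_cast geomNat_pos p _
  have hb' : (0 : ℝ) < b := by exact_mod_cast hb
  rw [geomInv_ratio hp, one_div_mul_eq_div, div_le_iff₀ hb', mul_comm, ← Real.log_pow]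
  refine Real.log_le_log (by positivity) ?_
  rw [div_pow, le_div_iff₀ (by positivity)]
  exact_mod_cast h

lemma localF_le_of_localCheck {b p : ℕ} {t : List ℕ} (hb : 0 < b) (h : localCheck b t p = true)
    (hp : trialPrime p = true) (j : ℕ) : localF (1 / b) p j ≤ localF (1 / b) p (expo t p) := by
  simp only [localCheck, hp, Bool.not_true, Bool.false_or, Bool.and_eq_true,
    decide_eq_true_eq] at h
  obtain ⟨⟨h1, h2⟩, h3⟩ := h
  have hp1 := (prime_of_trialPrime hp).pos
  rcases le_total (expo t p) j with hj | hj
  · exact localF_le_of_ge hp1 (log_ratio_le hb hp1 h3) hj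
  · obtain ⟨k, hk⟩ := Nat.exists_eq_add_of_le' h1
    rw [hk] at h2 hj ⊢
    exact localF_le_of_le hp1 (le_log_ratio hb hp1 h2) hj

lemma localF_nonpos_of_le {b p Q : ℕ} (hb : 0 < b) (hQ : 1 ≤ Q)
    (h : (Q + 1) ^ b ≤ Q ^ (b + 1)) (hp : Q ≤ p) (j : ℕ) : localF (1 / b) p j ≤ 0 := by
  rw [← localF_zero (1 / b) p]
  refine localF_le_of_ge (hQ.trans hp) (log_ratio_le hb (hQ.trans hp) ?_) (Nat.zero_le j)
  have hp1 : 1 ≤ p := hQ.trans hp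
  have key : ((p : ℝ) + 1) ^ b ≤ p * (p : ℝ) ^ b := by
    have hQ0 : (0 : ℝ) < Q := by exact_mod_cast hQ
    have hp0 : (0 : ℝ) < p := by exact_mod_cast hp1
    have hle : (Q : ℝ) ≤ p := by exact_mod_cast hp
    have h1 : ((Q : ℝ) + 1) ^ b ≤ Q * (Q : ℝ) ^ b := by
      rw [← pow_succ']; exact_mod_cast h
    have h2 : (((Q : ℝ) + 1) / Q) ^ b ≤ Q := by
      rwa [div_pow, div_le_iff₀ (by positivity)]
    have h3 : ((p : ℝ) + 1) / p ≤ ((Q : ℝ) + 1) / Q := by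
      rw [div_le_div_iff₀ hp0 hQ0]; nlinarith
    have h4 : (((p : ℝ) + 1) / p) ^ b ≤ p :=
      (pow_le_pow_left₀ (by positivity) h3 b).trans (h2.trans hle)
    rwa [div_pow, div_le_iff₀ (by positivity)] at h4
  simp only [geomNat, mul_one]
  exact_mod_cast key

lemma log_sigma_le_of_check {b Q : ℕ} {t : List ℕ} (hb : 0 < b) (hQ : 1 ≤ Q) (hQ' : Q ≤ 1444)
    (h1 : (List.range Q).all (localCheck b t) = true) (h2 : (Q + 1) ^ b ≤ Q ^ (b + 1))
    {n : ℕ} (hn : n ≠ 0) :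
    Real.log ((ArithmeticFunction.sigma 1 n : ℝ) / n) ≤ 1 / b * Real.log n +
      (Real.log (prodSigma t Q) - (1 + 1 / b) * Real.log (prodPow t Q)) := by
  rw [← sum_localF_eq]
  have hloc : ∀ p ∈ (Finset.range Q).filter (fun p ↦ trialPrime p = true), ∀ j,
      localF (1 / b) p j ≤ localF (1 / b) p (expo t p) := fun p hp j ↦ by
    rw [Finset.mem_filter, Finset.mem_range] at hp
    exact localF_le_of_localCheck hb (List.all_eq_true.1 h1 p (List.mem_range.2 hp.1)) hp.2 j
  refine log_sigma_le_of_localF_le (fun p hp ↦ ?_) (fun p hp _ j ↦ hloc p hp j)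
    (fun p hp hpp j ↦ ?_) hn
  · rw [← localF_zero (1 / b) p]
    exact hloc p hp 0
  · by_cases hpQ : p < Q
    · refine absurd ?_ hp
      rw [Finset.mem_filter, Finset.mem_range]
      exact ⟨hpQ, trialPrime_of_prime hpp (by omega)⟩
    · exact localF_nonpos_of_le hb hQ h2 (not_lt.1 hpQ) j

/-- Verification at the endpoint `log n = l / D`, where `V / 2000` is a lower bound for
`log (l / D)`. -/
def endCheck (b S N l D V : ℕ) : Bool :=
  1 ≤ l && 1 ≤ D && 1 ≤ V &&
  27182818286 ^ V * D ^ 2000 ≤ l ^ 2000 * 10 ^ (10 * V) &&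
  S ^ (b * D) * 27182818286 ^ l * (2 * 10 ^ 7) ^ (b * D) <
    N ^ ((b + 1) * D) * (17808 * V) ^ (b * D) * 10 ^ (10 * l)

lemma log_const_lt : Real.log 1.7808 < Real.eulerMascheroniConstant := by
  refine lt_of_le_of_lt ?_ eulerMascheroni_gt
  rw [Real.log_le_iff_le_exp (by norm_num)]
  exact le_trans (by norm_num [Finset.sum_range_succ, Nat.factorial])
    (Real.sum_le_exp_of_nonneg (by norm_num : (0 : ℝ) ≤ 0.5771) 9)

lemma of_endCheck {b S N l D V : ℕ} (hb : 0 < b) (hS : 0 < S) (hN : 0 < N)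
    (h : endCheck b S N l D V = true) :
    0 < (V : ℝ) / 2000 ∧ 0 < (l : ℝ) / D ∧ (V : ℝ) / 2000 ≤ Real.log ((l : ℝ) / D) ∧
    1 / b * ((l : ℝ) / D) + (Real.log S - (1 + 1 / b) * Real.log N) <
      Real.log 1.7808 + Real.log ((V : ℝ) / 2000) := by
  simp only [endCheck, Bool.and_eq_true, decide_eq_true_eq] at h
  obtain ⟨⟨⟨⟨hl, hD⟩, hV⟩, hv⟩, hm⟩ := h
  have hl0 : (0 : ℝ) < l := by exact_mod_cast hl
  have hD0 : (0 : ℝ) < D := by exact_mod_cast hD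
  have hV0 : (0 : ℝ) < V := by exact_mod_cast hV
  have hS0 : (0 : ℝ) < S := by exact_mod_cast hS
  have hN0 : (0 : ℝ) < N := by exact_mod_cast hN
  have hb0 : (0 : ℝ) < b := by exact_mod_cast hb
  refine ⟨by positivity, by positivity, ?_, ?_⟩
  · have h1 : (V : ℝ) ≤ 2000 * Real.log (l / D) := by
      have : (V : ℝ) ≤ Real.log (((l : ℝ) / D) ^ 2000) := by
        rw [Real.le_log_iff_exp_le (by positivity)]
        refine (exp_nat_lt V).trans ?_
        rw [div_pow, div_pow, div_le_div_iff₀ (by positivity) (by positivity), ← pow_mul]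
        exact_mod_cast hv
      rwa [Real.log_pow] at this
    rw [div_le_iff₀ (by norm_num)]
    linarith
  · have hm' : ((S : ℝ) ^ (b * D)) * ((27182818286 : ℝ) / 10 ^ 10) ^ l <
        (N : ℝ) ^ ((b + 1) * D) * (1.7808 * (V / 2000)) ^ (b * D) := by
      rw [show (1.7808 : ℝ) * (V / 2000) = (17808 * V) / (2 * 10 ^ 7) by ring, div_pow, div_pow,
        ← mul_div_assoc, ← mul_div_assoc, div_lt_div_iff₀ (by positivity) (by positivity),
        ← pow_mul]
      exact_mod_cast hm
    have hm2 := (mul_le_mul_of_nonneg_left (exp_nat_lt l)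
      (by positivity : (0 : ℝ) ≤ (S : ℝ) ^ (b * D))).trans_lt hm'
    have hm3 := Real.log_lt_log (by positivity) hm2
    rw [Real.log_mul (by positivity) (by positivity), Real.log_mul (by positivity) (by positivity),
      Real.log_exp, Real.log_pow, Real.log_pow, Real.log_pow,
      Real.log_mul (by norm_num) (by positivity)] at hm3
    push_cast at hm3
    have hbD : 0 < (b : ℝ) * D := by positivity
    rw [← sub_pos] at hm3 ⊢
    have := div_pos hm3 hbD
    refine lt_of_lt_of_eq this ?_
    field_simp
    ring

lemma robinIneq_of_endChecks {b Q l₀ D₀ V₀ l₁ D₁ V₁ : ℕ} {t : List ℕ} (hb : 0 < b) (hQ : 1 ≤ Q)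
    (hQ' : Q ≤ 1444) (h1 : (List.range Q).all (localCheck b t) = true)
    (h2 : (Q + 1) ^ b ≤ Q ^ (b + 1))
    (hc₀ : endCheck b (prodSigma t Q) (prodPow t Q) l₀ D₀ V₀ = true)
    (hc₁ : endCheck b (prodSigma t Q) (prodPow t Q) l₁ D₁ V₁ = true)
    {n : ℕ} (hn : 1 < Real.log n) (hn₀ : (l₀ : ℝ) / D₀ ≤ Real.log n)
    (hn₁ : Real.log n ≤ (l₁ : ℝ) / D₁) : RobinIneq n := by
  have hn0 : n ≠ 0 := by rintro rfl; norm_num at hn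
  refine robinIneq_of_log_lt hn ((log_sigma_le_of_check hb hQ hQ' h1 h2 hn0).trans_lt ?_)
  obtain ⟨a1, a2, a3, a4⟩ := of_endCheck hb (prodSigma_pos t Q) (prodPow_pos t Q) hc₀
  obtain ⟨b1, b2, b3, b4⟩ := of_endCheck hb (prodSigma_pos t Q) (prodPow_pos t Q) hc₁
  set L₀ := (l₀ : ℝ) / D₀
  set L₁ := (l₁ : ℝ) / D₁
  set v₀ := (V₀ : ℝ) / 2000
  set v₁ := (V₁ : ℝ) / 2000
  set M := Real.log (prodSigma t Q) - (1 + 1 / b) * Real.log (prodPow t Q)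
  obtain ⟨α, β, hα, hβ, hαβ, hL⟩ : Real.log n ∈ segment ℝ L₀ L₁ := by
    rw [segment_eq_Icc (hn₀.trans hn₁)]; exact ⟨hn₀, hn₁⟩
  simp only [smul_eq_mul] at hL
  have c1 : α * Real.log L₀ + β * Real.log L₁ ≤ Real.log (α * L₀ + β * L₁) :=
    strictConcaveOn_log_Ioi.concaveOn.2 a2 b2 hα hβ hαβ
  have c2 : α * Real.log v₀ + β * Real.log v₁ ≤ Real.log (α * v₀ + β * v₁) :=
    strictConcaveOn_log_Ioi.concaveOn.2 a1 b1 hα hβ hαβ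
  have hpos : 0 < α * v₀ + β * v₁ := by
    have := (convex_Ioi (0 : ℝ)) (show v₀ ∈ Set.Ioi 0 from a1) (show v₁ ∈ Set.Ioi 0 from b1)
      hα hβ hαβ
    exact this
  have c3 : Real.log (α * v₀ + β * v₁) ≤ Real.log (Real.log (Real.log n)) := by
    refine Real.log_le_log hpos ?_
    rw [← hL]
    nlinarith [mul_le_mul_of_nonneg_left a3 hα, mul_le_mul_of_nonneg_left b3 hβ]
  have c4 := log_const_lt
  have hβ' : β = 1 - α := by linarith
  subst hβ'
  rw [← hL] at c3 ⊢
  rw [mul_add]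
  have d1 := mul_le_mul_of_nonneg_left a4.le hα
  have d2 := mul_le_mul_of_nonneg_left b4.le hβ
  linarith

theorem robinIneq_of_log_le {n : ℕ} (h : (4609 : ℝ) / 500 ≤ Real.log n) (h' : Real.log n ≤ 411) :
    RobinIneq n := by
  have h1 : 1 < Real.log n := lt_of_lt_of_le (by norm_num) h
  by_cases c1 : Real.log n ≤ 15
  · exact robinIneq_of_endChecks (b := 29) (Q := 13) (t := [11, 3, 2, 2])
      (l₀ := 4609) (D₀ := 500) (V₀ := 4442) (l₁ := 15) (D₁ := 1) (V₁ := 5416)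
      (by norm_num) (by norm_num) (by norm_num) (by decide +kernel) (by decide +kernel)
      (by decide +kernel) (by decide +kernel) h1 (by simpa using h) (by simpa using c1)
  push Not at c1
  by_cases c2 : Real.log n ≤ 30
  · exact robinIneq_of_endChecks (b := 66) (Q := 23) (t := [19, 5, 3, 2, 2])
      (l₀ := 15) (D₀ := 1) (V₀ := 5416) (l₁ := 30) (D₁ := 1) (V₁ := 6802)
      (by norm_num) (by norm_num) (by norm_num) (by decide +kernel) (by decide +kernel)
      (by decide +kernel) (by decide +kernel) h1 (by simpa using c1.le) (by simpa using c2)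
  push Not at c2
  by_cases c3 : Real.log n ≤ 63
  · exact robinIneq_of_endChecks (b := 166) (Q := 47) (t := [43, 7, 3, 3, 2, 2])
      (l₀ := 30) (D₀ := 1) (V₀ := 6802) (l₁ := 63) (D₁ := 1) (V₁ := 8286)
      (by norm_num) (by norm_num) (by norm_num) (by decide +kernel) (by decide +kernel)
      (by decide +kernel) (by decide +kernel) h1 (by simpa using c2.le) (by simpa using c3)
  push Not at c3
  by_cases c4 : Real.log n ≤ 128
  · exact robinIneq_of_endChecks (b := 410) (Q := 97) (t := [89, 11, 5, 3, 3, 2, 2, 2])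
      (l₀ := 63) (D₀ := 1) (V₀ := 8286) (l₁ := 128) (D₁ := 1) (V₁ := 9704)
      (by norm_num) (by norm_num) (by norm_num) (by decide +kernel) (by decide +kernel)
      (by decide +kernel) (by decide +kernel) h1 (by simpa using c3.le) (by simpa using c4)
  push Not at c4
  by_cases c5 : Real.log n ≤ 241
  · exact robinIneq_of_endChecks (b := 920) (Q := 179) (t := [173, 17, 7, 3, 3, 2, 2, 2, 2])
      (l₀ := 128) (D₀ := 1) (V₀ := 9704) (l₁ := 241) (D₁ := 1) (V₁ := 10969)
      (by norm_num) (by norm_num) (by norm_num) (by decide +kernel) (by decide +kernel)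
      (by decide +kernel) (by decide +kernel) h1 (by simpa using c4.le) (by simpa using c5)
  push Not at c5
  exact robinIneq_of_endChecks (b := 1829) (Q := 331) (t := [317, 23, 7, 5, 3, 3, 2, 2, 2, 2])
    (l₀ := 241) (D₀ := 1) (V₀ := 10969) (l₁ := 411) (D₁ := 1) (V₁ := 12037)
    (by norm_num) (by norm_num) (by norm_num) (by decide +kernel) (by decide +kernel)
    (by decide +kernel) (by decide +kernel) h1 (by simpa using c5.le) (by simpa using h')

end Robin

namespace Robin

open ArithmeticFunction

/-- The summand `d + n / d` for a divisor `d` of `n` with `d² ≤ n`, added to `s`. -/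
def pairStep (n d s : ℕ) : ℕ :=
  bif Nat.beq (Nat.mod n d) 0 then
    bif Nat.ble (Nat.mul d d) n then Nat.add s (Nat.add d (Nat.div n d)) else s
  else s

/-- The sum of `d + n / d` over the divisors `d ≤ k` of `n` with `d² ≤ n`. -/
noncomputable def pairSum (n k : ℕ) : ℕ := Nat.rec 0 (fun d s ↦ pairStep n (Nat.succ d) s) k

lemma pairStep_eq (n d s : ℕ) :
    pairStep n d s = s + if d ∣ n ∧ d * d ≤ n then d + n / d else 0 := by
  have h1 : Nat.beq (Nat.mod n d) 0 = decide (d ∣ n) := by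
    rw [Bool.eq_iff_iff, Nat.beq_eq, decide_eq_true_iff]
    exact (Nat.dvd_iff_mod_eq_zero).symm
  have h2 : Nat.ble (Nat.mul d d) n = decide (d * d ≤ n) := by
    rw [Bool.eq_iff_iff, Nat.ble_eq, decide_eq_true_iff]
    rfl
  rw [pairStep, h1, h2]
  by_cases hd : d ∣ n <;> by_cases hd' : d * d ≤ n <;> simp [hd, hd']
  rfl

lemma pairSum_eq (n k : ℕ) : pairSum n k = ∑ d ∈ Finset.range k,
    if d + 1 ∣ n ∧ (d + 1) * (d + 1) ≤ n then d + 1 + n / (d + 1) else 0 := by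
  induction k with
  | zero => simp [pairSum]
  | succ k ih =>
    rw [Finset.sum_range_succ, ← ih, ← pairStep_eq]
    rfl

lemma sigma_le_pairSum {n k : ℕ} (hn : 0 < n) (hk : n < (k + 1) ^ 2) :
    sigma 1 n ≤ pairSum n k := by
  have h1 : sigma 1 n = ∑ d ∈ n.divisors, (if d * d ≤ n then d else 0) +
      ∑ d ∈ n.divisors, (if d * d ≤ n then 0 else d) := by
    rw [← Finset.sum_add_distrib, sigma_one_apply]
    exact Finset.sum_congr rfl fun d _ ↦ by split_ifs <;> simp
  have h2 : ∑ d ∈ n.divisors, (if d * d ≤ n then 0 else d) ≤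
      ∑ d ∈ n.divisors, (if d * d ≤ n then n / d else 0) := by
    rw [← Nat.sum_div_divisors n (fun d ↦ if d * d ≤ n then 0 else d)]
    refine Finset.sum_le_sum fun d hd ↦ ?_
    by_cases hdk : d * d ≤ n
    · simp only [hdk, if_true]
      split_ifs
      · exact Nat.zero_le _
      · exact le_rfl
    · have hdn := Nat.mul_div_cancel' (Nat.dvd_of_mem_divisors hd)
      have : n / d * (n / d) ≤ n := by
        by_contra! h
        have := Nat.mul_lt_mul'' (not_le.1 hdk) h
        nlinarith
      simp [this, hdk]
  rw [pairSum_eq, h1]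
  refine (Nat.add_le_add_left h2 _).trans ?_
  rw [← Finset.sum_add_distrib]
  have h3 : ∑ d ∈ n.divisors, ((if d * d ≤ n then d else 0) + if d * d ≤ n then n / d else 0) =
      ∑ d ∈ n.divisors.filter (fun d ↦ d * d ≤ n), (d + n / d) := by
    rw [Finset.sum_filter]
    exact Finset.sum_congr rfl fun d _ ↦ by split_ifs <;> simp
  rw [h3, ← Finset.sum_filter]
  refine le_of_eq (Finset.sum_nbij' (fun d ↦ d - 1) (fun d ↦ d + 1) ?_ ?_ ?_ ?_ ?_)
  · intro d hd
    simp only [Finset.mem_filter, Nat.mem_divisors, Finset.mem_range] at hd ⊢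
    have : 0 < d := Nat.pos_of_dvd_of_pos hd.1.1 hn
    rw [Nat.sub_add_cancel this]
    have hdk : d < k + 1 := by
      by_contra! h
      nlinarith [Nat.mul_le_mul h h]
    exact ⟨by omega, hd.1.1, hd.2⟩
  · intro d hd
    simp only [Finset.mem_filter, Nat.mem_divisors, Finset.mem_range] at hd ⊢
    exact ⟨⟨hd.2.1, hn.ne'⟩, hd.2.2⟩
  · intro d hd
    simp only [Finset.mem_filter, Nat.mem_divisors] at hd
    exact Nat.sub_add_cancel (Nat.pos_of_dvd_of_pos hd.1.1 hn)
  · intro d _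
    simp
  · intro d hd
    simp only [Finset.mem_filter, Nat.mem_divisors] at hd
    have : 0 < d := Nat.pos_of_dvd_of_pos hd.1.1 hn
    simp only [Nat.sub_add_cancel this]

lemma pairSum_le : (List.range 5039).all
    (fun j ↦ 1000 * pairSum (5041 + j) 100 ≤ 3810 * (5041 + j)) = true := by
  decide +kernel

theorem robinIneq_of_lt {n : ℕ} (h : 5041 ≤ n) (h' : n < 10080) : RobinIneq n := by
  have hn : (0 : ℝ) < n := by positivity
  have h1 : (8.525 : ℝ) ≤ Real.log n := by
    have h2 : ((341 : ℕ) : ℝ) ≤ 40 * Real.log n := by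
      have : ((341 : ℕ) : ℝ) ≤ Real.log ((n : ℝ) ^ 40) := by
        rw [Real.le_log_iff_exp_le (by positivity)]
        refine (exp_nat_lt 341).trans (le_trans ?_ (pow_le_pow_left₀ (by norm_num : (0 : ℝ) ≤ 5041)
          (by exact_mod_cast h) 40))
        rw [div_pow, div_le_iff₀ (by positivity), ← pow_mul]
        have : 27182818286 ^ 341 ≤ 5041 ^ 40 * 10 ^ (10 * 341) := by decide +kernel
        exact_mod_cast this
      rwa [Real.log_pow] at this
    norm_num at h2 ⊢
    linarith
  have h3 : (2.14 : ℝ) ≤ Real.log (Real.log n) := by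
    have h2 : ((107 : ℕ) : ℝ) ≤ 50 * Real.log (Real.log n) := by
      have : ((107 : ℕ) : ℝ) ≤ Real.log (Real.log n ^ 50) := by
        rw [Real.le_log_iff_exp_le (by positivity)]
        refine (exp_nat_lt 107).trans (le_trans ?_ (pow_le_pow_left₀ (by norm_num) h1 50))
        norm_num
      rwa [Real.log_pow] at this
    norm_num at h2 ⊢
    linarith
  have h4 : 1000 * sigma 1 n ≤ 3810 * n := by
    have h5 := List.all_eq_true.1 pairSum_le (n - 5041) (List.mem_range.2 (by omega))
    simp only [decide_eq_true_eq, Nat.add_sub_cancel' h] at h5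
    exact (Nat.mul_le_mul_left _ (sigma_le_pairSum (by omega) (by omega))).trans h5
  have h5 : (1000 : ℝ) * sigma 1 n ≤ 3810 * n := by exact_mod_cast h4
  have h6 := log_const_lt
  have hs : (0 : ℝ) < sigma 1 n := by exact_mod_cast (sigma_pos 1 n (by omega))
  refine robinIneq_of_log_lt (by linarith) ?_
  have h7 : (sigma 1 n : ℝ) / n ≤ 1.7808 * 2.14 := by
    rw [div_le_iff₀ hn]
    linarith
  calc Real.log ((sigma 1 n : ℝ) / n) ≤ Real.log (1.7808 * 2.14) :=
        Real.log_le_log (by positivity) h7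
    _ = Real.log 1.7808 + Real.log 2.14 := Real.log_mul (by norm_num) (by norm_num)
    _ < _ := add_lt_add_of_lt_of_le h6 (Real.log_le_log (by norm_num) h3)

theorem robinIneq_of_rh (hRH : RiemannHypothesis) {n : ℕ} (hn : 5041 ≤ n) : RobinIneq n := by
  rcases lt_or_ge n 10080 with h | h
  · exact robinIneq_of_lt hn h
  have hpos : (0 : ℝ) < n := by positivity
  have hlog : (4609 : ℝ) / 500 ≤ Real.log n := by
    have h2 : ((4609 : ℕ) : ℝ) ≤ 500 * Real.log n := by
      have : ((4609 : ℕ) : ℝ) ≤ Real.log ((n : ℝ) ^ 500) := by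
        rw [Real.le_log_iff_exp_le (by positivity)]
        refine (exp_nat_lt 4609).trans (le_trans ?_ (pow_le_pow_left₀
          (by norm_num : (0 : ℝ) ≤ 10080) (by exact_mod_cast h) 500))
        rw [div_pow, div_le_iff₀ (by positivity), ← pow_mul]
        have : 27182818286 ^ 4609 ≤ 10080 ^ 500 * 10 ^ (10 * 4609) := by decide +kernel
        exact_mod_cast this
      rwa [Real.log_pow] at this
    norm_num at h2 ⊢
    linarith
  have hl0 : 0 < Real.log n := by linarith
  by_cases h1 : Real.log n ≤ 411
  · exact robinIneq_of_log_le hlog h1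
  push Not at h1
  have hu : Real.log n = Real.exp (Real.log (Real.log n)) := (Real.exp_log hl0).symm
  have hu6 : 6 ≤ Real.log (Real.log n) := by
    rw [Real.le_log_iff_exp_le hl0]
    have := exp_nat_lt 6
    norm_num at this
    linarith
  by_cases h11 : Real.log (Real.log n) < 11
  · exact robinIneq_of_mid hRH hu6 h11 hu
  · exact robinIneq_of_large hRH (not_lt.1 h11) hu

end Robin

namespace Robin

open Set Filter Topology MeasureTheory

lemma eventuallyEq_of_eq_on_reals {F H : ℂ → ℂ} {s : ℝ} (hF : AnalyticAt ℂ F s)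
    (hH : AnalyticAt ℂ H s) (h : ∀ᶠ t : ℝ in 𝓝 s, F t = H t) : F =ᶠ[𝓝 (s : ℂ)] H := by
  refine (hF.frequently_eq_iff_eventually_eq hH).1 ?_
  have h1 : Tendsto (fun t : ℝ ↦ (t : ℂ)) (𝓝[≠] s) (𝓝[≠] (s : ℂ)) := by
    refine tendsto_nhdsWithin_iff.2 ⟨Complex.continuous_ofReal.continuousAt.tendsto.mono_left
      nhdsWithin_le_nhds, ?_⟩
    filter_upwards [self_mem_nhdsWithin] with t ht
    simpa using ht
  exact h1.frequently (h.filter_mono nhdsWithin_le_nhds).frequently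

lemma LapInt.analyticAt {f : ℝ → ℝ} {σ : ℝ} (hf : LapInt f σ) {z : ℂ} (hz : σ < z.re) :
    AnalyticAt ℂ (lap f) z :=
  (differentiableOn_lap hf).analyticAt
    ((isOpen_lt continuous_const Complex.continuous_re).mem_nhds hz)

/-- A nonnegative function whose Laplace transform continues analytically past the abscissa. -/
lemma LapInt.sub_of_analyticAt {f : ℝ → ℝ} {σ r : ℝ} (hf : LapInt f σ)
    (hnn : ∀ u, 0 < u → 0 ≤ f u) (hr : 0 < r) {H : ℂ → ℂ}
    (hH : DifferentiableOn ℂ H (Metric.ball (σ : ℂ) r))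
    (heq : ∀ s : ℝ, σ < s → lap f s = H s) : LapInt f (σ - r / 4) := by
  set s₀ : ℝ := σ + r / 4 with hs₀
  have hs₀σ : σ < s₀ := by linarith
  have hsub : Metric.ball (s₀ : ℂ) (3 * r / 4) ⊆ Metric.ball (σ : ℂ) r := by
    refine Metric.ball_subset_ball' ?_
    rw [Complex.dist_eq, ← Complex.ofReal_sub, Complex.norm_real, Real.norm_eq_abs,
      show s₀ - σ = r / 4 by rw [hs₀]; ring, abs_of_pos (by linarith)]
    linarith
  have hHan : AnalyticAt ℂ H s₀ := (hH.mono hsub).analyticAt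
    (Metric.isOpen_ball.mem_nhds (Metric.mem_ball_self (by linarith)))
  have hev : lap f =ᶠ[𝓝 (s₀ : ℂ)] H := by
    refine eventuallyEq_of_eq_on_reals (hf.analyticAt (by simpa using hs₀σ)) hHan ?_
    filter_upwards [lt_mem_nhds hs₀σ] with t ht using heq t ht
  set z : ℂ := ((s₀ - r / 2 : ℝ) : ℂ) with hz
  have hzs : z - s₀ = ((-(r / 2) : ℝ) : ℂ) := by rw [hz]; push_cast; ring
  have hzmem : z ∈ Metric.ball (s₀ : ℂ) (3 * r / 4) := by
    rw [Metric.mem_ball, dist_eq_norm, hzs, Complex.norm_real, Real.norm_eq_abs, abs_neg,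
      abs_of_pos (by linarith)]
    linarith
  have hsum := (Complex.hasSum_taylorSeries_on_ball (hH.mono hsub) hzmem).summable
  set g : ℕ → ℝ → ℝ := fun n u ↦ (r / 2) ^ n / n.factorial * (u ^ n * f u) * Real.exp (-s₀ * u)
    with hg
  have hgint : ∀ n, IntegrableOn (g n) (Ioi 0) := fun n ↦
    ((hf.pow_mul n).const_mul ((r / 2) ^ n / n.factorial)) s₀ hs₀σ
  have hgnn : ∀ n u, 0 < u → 0 ≤ g n u := fun n u hu ↦ by
    have := hnn u hu
    simp only [hg]
    positivity
  have hterm : ∀ n : ℕ, ((n.factorial : ℂ))⁻¹ • (z - s₀) ^ n • iteratedDeriv n H s₀ =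
      ((∫ u in Ioi 0, g n u : ℝ) : ℂ) := fun n ↦ by
    rw [← (hev.iteratedDeriv_eq n), iteratedDeriv_lap hf n (by simpa using hs₀σ), hzs, lap_ofReal]
    simp only [hg, mul_assoc]
    rw [integral_const_mul]
    push_cast
    simp only [smul_eq_mul]
    rw [← mul_assoc ((-((r : ℂ) / 2)) ^ n), ← mul_pow]
    simp only [mul_neg, mul_one, neg_neg]
    ring
  have hsum' : Summable fun n ↦ ∫ u in Ioi 0, g n u := by
    rw [← Complex.summable_ofReal]
    exact hsum.congr fun n ↦ hterm n
  have hlim : ∀ u, 0 < u → ENNReal.ofReal (f u * Real.exp (-(s₀ - r / 2) * u)) =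
      ∑' n, ENNReal.ofReal (g n u) := fun u hu ↦ by
    have h1 : HasSum (fun n ↦ g n u) (f u * Real.exp (-(s₀ - r / 2) * u)) := by
      have := (NormedSpace.expSeries_div_hasSum_exp (r / 2 * u)).mul_left
        (f u * Real.exp (-s₀ * u))
      rw [← Real.exp_eq_exp_ℝ] at this
      have e1 : f u * Real.exp (-(s₀ - r / 2) * u) =
          f u * Real.exp (-s₀ * u) * Real.exp (r / 2 * u) := by
        rw [mul_assoc, ← Real.exp_add]
        ring_nf
      have e2 : (fun n ↦ g n u) =
          fun n : ℕ ↦ f u * Real.exp (-s₀ * u) * ((r / 2 * u) ^ n / n.factorial) := by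
        ext n
        simp only [hg]
        rw [mul_pow]
        ring
      rw [e1, e2]
      exact this
    rw [← h1.tsum_eq, ENNReal.ofReal_tsum_of_nonneg (fun n ↦ hgnn n u hu) h1.summable]
  have hfin : IntegrableOn (fun u ↦ f u * Real.exp (-(s₀ - r / 2) * u)) (Ioi 0) := by
    have hm : AEStronglyMeasurable f (volume.restrict (Ioi 0)) :=
      IntegrableOn.aesm_of_mul_exp (hf s₀ hs₀σ)
    refine ⟨hm.mul (by fun_prop), ?_⟩
    rw [hasFiniteIntegral_iff_ofReal]
    · rw [setLIntegral_congr_fun measurableSet_Ioi (fun u hu ↦ hlim u hu),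
        lintegral_tsum fun n ↦ (hgint n).aemeasurable.ennreal_ofReal]
      have : ∀ n, ∫⁻ u in Ioi 0, ENNReal.ofReal (g n u) =
          ENNReal.ofReal (∫ u in Ioi 0, g n u) := fun n ↦
        (ofReal_integral_eq_lintegral_ofReal (hgint n)
          ((ae_restrict_iff' measurableSet_Ioi).2 (.of_forall fun u hu ↦ hgnn n u hu))).symm
      simp_rw [this]
      exact hsum'.tsum_ofReal_lt_top
    · refine (ae_restrict_iff' measurableSet_Ioi).2 (.of_forall fun u hu ↦ ?_)
      exact mul_nonneg (hnn u hu) (Real.exp_pos _).le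
  intro σ' hσ'
  refine Integrable.mono hfin ?_ ?_
  · exact (IntegrableOn.aesm_of_mul_exp hfin).mul (by fun_prop)
  · refine (ae_restrict_iff' measurableSet_Ioi).2 (.of_forall fun u (hu : 0 < u) ↦ ?_)
    rw [norm_mul, norm_mul, Real.norm_eq_abs (Real.exp _), Real.norm_eq_abs (Real.exp _),
      Real.abs_exp, Real.abs_exp]
    refine mul_le_mul_of_nonneg_left (Real.exp_le_exp.2 ?_) (norm_nonneg _)
    have : s₀ - r / 2 < σ' := by rw [hs₀]; linarith
    nlinarith

theorem LapInt.of_analyticAt {f : ℝ → ℝ} {σ₀ σ₁ : ℝ} (hσ : σ₀ ≤ σ₁) (hf : LapInt f σ₁)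
    (hnn : ∀ u, 0 < u → 0 ≤ f u) {H : ℂ → ℂ} (hH : ∀ s : ℝ, σ₀ < s → AnalyticAt ℂ H s)
    (heq : ∀ s : ℝ, σ₁ < s → lap f s = H s) : LapInt f σ₀ := by
  set S : Set ℝ := {σ | σ₀ ≤ σ ∧ LapInt f σ} with hS
  have hS1 : σ₁ ∈ S := ⟨hσ, hf⟩
  have hbdd : BddBelow S := ⟨σ₀, fun σ h ↦ h.1⟩
  set τ := sInf S with hτ
  have hτ0 : σ₀ ≤ τ := le_csInf ⟨_, hS1⟩ fun σ h ↦ h.1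
  have hτ1 : τ ≤ σ₁ := csInf_le hbdd hS1
  have hLτ : LapInt f τ := fun σ hσ ↦ by
    obtain ⟨ρ, hρ, hρσ⟩ := exists_lt_of_csInf_lt ⟨_, hS1⟩ hσ
    exact hρ.2 σ hρσ
  rcases hτ0.eq_or_lt with h | h
  · rwa [h]
  exfalso
  have heq' : ∀ s : ℝ, τ < s → lap f s = H s := by
    have e1 : AnalyticOnNhd ℝ (fun s : ℝ ↦ lap f s) (Ioi τ) := fun s hs ↦
      ((hLτ.analyticAt (z := s) (by simpa using hs)).restrictScalars (𝕜 := ℝ)).comp_of_eq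
        (Complex.ofRealCLM.analyticAt s) rfl
    have e2 : AnalyticOnNhd ℝ (fun s : ℝ ↦ H s) (Ioi τ) := fun s hs ↦
      ((hH s (h.trans hs)).restrictScalars (𝕜 := ℝ)).comp_of_eq
        (Complex.ofRealCLM.analyticAt s) rfl
    have := e1.eqOn_of_preconnected_of_eventuallyEq e2 isPreconnected_Ioi
      (z₀ := σ₁ + 1) (show τ < σ₁ + 1 by linarith) (by
        filter_upwards [lt_mem_nhds (by linarith : σ₁ < σ₁ + 1)] with s hs using heq s hs)
    exact fun s hs ↦ this hs
  obtain ⟨r, hr, hball⟩ := Metric.eventually_nhds_iff_ball.1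
    (hH τ h).eventually_analyticAt
  have := hLτ.sub_of_analyticAt hnn hr
    (fun z hz ↦ (hball z hz).differentiableAt.differentiableWithinAt) heq'
  have h3 : max σ₀ (τ - r / 4) ∈ S := ⟨le_max_left _ _, this.mono (le_max_right _ _)⟩
  have h4 := csInf_le hbdd h3
  have h5 : max σ₀ (τ - r / 4) < τ := max_lt h (by linarith)
  linarith

end Robin

namespace Robin

open ArithmeticFunction

lemma le_log_geomInv {p : ℕ} (hp : 2 ≤ p) (k : ℕ) :
    ∑ j ∈ Finset.range k, ((p : ℝ)⁻¹) ^ (j + 1) / (j + 1) - 2 * ((p : ℝ)⁻¹) ^ (k + 1) ≤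
      Real.log (geomInv p k) := by
  set y := (p : ℝ)⁻¹ with hy
  have hp' : (2 : ℝ) ≤ p := by exact_mod_cast hp
  have hy0 : 0 < y := by positivity
  have hy2 : y ≤ 1 / 2 := by
    rw [hy, one_div]
    exact inv_anti₀ two_pos hp'
  have hyk : y ^ (k + 1) ≤ 1 / 2 := (pow_le_of_le_one hy0.le (by linarith) (by omega)).trans hy2
  have hyk0 : 0 < y ^ (k + 1) := by positivity
  have h1 : geomInv p k = (1 - y ^ (k + 1)) / (1 - y) := by
    rw [geomInv, geom_sum_eq (by linarith : (p : ℝ)⁻¹ ≠ 1), ← hy,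
      ← neg_sub 1 (y ^ (k + 1)), ← neg_sub 1 y, neg_div_neg_eq]
  have hs := Real.hasSum_pow_div_log_of_abs_lt_one (x := y) (by rw [abs_of_pos hy0]; linarith)
  have h2 := sum_le_hasSum (Finset.range k) (fun i _ ↦ by positivity) hs
  have h3 := Real.one_sub_inv_le_log_of_pos (by linarith : 0 < 1 - y ^ (k + 1))
  have h4 : (1 - y ^ (k + 1))⁻¹ ≤ 1 + 2 * y ^ (k + 1) := by
    rw [inv_le_iff_one_le_mul₀ (by linarith)]
    nlinarith
  rw [h1, Real.log_div (by linarith) (by linarith)]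
  linarith

lemma mertSum_natCast (N : ℕ) : mertSum N = ∑ p ∈ Finset.Icc 1 N with p.Prime,
    ∑ j ∈ Finset.range (Nat.log p N), ((p : ℝ)⁻¹) ^ (j + 1) / (j + 1) := by
  have h := sum_vonMangoldt_mul (fun m ↦ 1 / (m * Real.log m)) N
  simp only [mul_one_div] at h
  rw [mertSum, Nat.floor_natCast, h]
  refine Finset.sum_congr rfl fun p hp ↦ ?_
  have hp := (Finset.mem_filter.1 hp).2
  rw [← Finset.Ico_succ_right_eq_Icc, Finset.sum_Ico_eq_sum_range]
  refine Finset.sum_congr (by simp) fun j _ ↦ ?_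
  have hl : Real.log p ≠ 0 := (Real.log_pos (by exact_mod_cast hp.one_lt)).ne'
  have hp0 : (p : ℝ) ≠ 0 := by exact_mod_cast hp.ne_zero
  rw [add_comm 1 j]
  push_cast
  rw [Real.log_pow]
  push_cast
  rw [inv_pow]
  field_simp

lemma sum_inv_pow_log_le {N : ℕ} (hN : 1 ≤ N) :
    ∑ p ∈ Finset.Icc 1 N with p.Prime, ((p : ℝ)⁻¹) ^ (Nat.log p N + 1) ≤ 3 / √N := by
  have hN' : (0 : ℝ) < N := by positivity
  set m := Nat.sqrt N with hm
  have hm1 : 1 ≤ m := Nat.sqrt_pos.2 hN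
  have hmN : m ≤ N := Nat.sqrt_le_self N
  have hle : ∀ p : ℕ, p.Prime → p ≤ N → ((p : ℝ)⁻¹) ^ (Nat.log p N + 1) ≤
      if p ≤ m then (N : ℝ)⁻¹ else ((p : ℝ) ^ 2)⁻¹ := fun p hp hpN ↦ by
    have hp0 : (0 : ℝ) < p := by exact_mod_cast hp.pos
    rw [inv_pow]
    split_ifs
    · refine inv_anti₀ hN' ?_
      exact_mod_cast (Nat.lt_pow_succ_log_self hp.one_lt N).le
    · refine inv_anti₀ (by positivity) (pow_le_pow_right₀ (by exact_mod_cast hp.one_le) ?_)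
      have := Nat.log_pos hp.one_lt hpN
      omega
  have hsq : (0 : ℝ) < √N := Real.sqrt_pos.2 hN'
  have hms : (m : ℝ) ≤ √N := Real.nat_sqrt_le_real_sqrt
  have hms' : √N ≤ m + 1 := Real.real_sqrt_le_nat_sqrt_succ
  have hm1' : (1 : ℝ) ≤ m := by exact_mod_cast hm1
  have hNs : √N * √N = (N : ℝ) := Real.mul_self_sqrt hN'.le
  calc _ ≤ ∑ p ∈ Finset.Icc 1 N with p.Prime, if p ≤ m then (N : ℝ)⁻¹ else ((p : ℝ) ^ 2)⁻¹ :=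
        Finset.sum_le_sum fun p hp ↦ by
          rw [Finset.mem_filter, Finset.mem_Icc] at hp
          exact hle p hp.2 hp.1.2
    _ ≤ ∑ p ∈ Finset.Ioc 0 N, if p ≤ m then (N : ℝ)⁻¹ else ((p : ℝ) ^ 2)⁻¹ :=
        Finset.sum_le_sum_of_subset_of_nonneg (Finset.filter_subset _ _) fun p _ _ ↦ by positivity
    _ = ∑ p ∈ Finset.Ioc 0 m, (N : ℝ)⁻¹ + ∑ p ∈ Finset.Ioc m N, ((p : ℝ) ^ 2)⁻¹ := by
        rw [← Finset.sum_Ioc_consecutive _ (Nat.zero_le m) hmN]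
        congr 1
        · exact Finset.sum_congr rfl fun p hp ↦ if_pos (Finset.mem_Ioc.1 hp).2
        · exact Finset.sum_congr rfl fun p hp ↦ if_neg (Finset.mem_Ioc.1 hp).1.not_ge
    _ ≤ m * (N : ℝ)⁻¹ + (m : ℝ)⁻¹ := by
        have h1 := sum_Ioc_inv_sq_le_sub (α := ℝ) (by omega : m ≠ 0) hmN
        have h2 : (0 : ℝ) ≤ (N : ℝ)⁻¹ := by positivity
        rw [Finset.sum_const, Nat.card_Ioc, nsmul_eq_mul, Nat.sub_zero]
        linarith
    _ ≤ 1 / √N + 2 / √N := by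
        refine add_le_add ?_ ?_
        · rw [← div_eq_mul_inv, div_le_div_iff₀ hN' hsq]
          nlinarith
        · rw [← one_div, div_le_div_iff₀ (by linarith) hsq]
          linarith
    _ = 3 / √N := by ring

/-- A lower bound for `σ n / n` along the least common multiples of initial segments. -/
lemma le_log_sigma_lcmUpto {N : ℕ} (hN : 1 ≤ N) :
    mertSum N - 6 / √N ≤ Real.log ((sigma 1 (Nat.lcmUpto N) : ℝ) / Nat.lcmUpto N) := by
  have h0 : (Finset.Icc 1 N).filter Nat.Prime = Nat.primesLE N := by
    ext p
    have : p.Prime → 1 ≤ p := fun h ↦ h.one_le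
    simp only [Finset.mem_filter, Finset.mem_Icc, Nat.mem_primesLE]
    tauto
  rw [sigma_div_eq (Nat.lcmUpto_ne_zero N), Nat.primeFactors_lcmUpto, ← h0,
    Real.log_prod fun p _ ↦ (zero_lt_one.trans_le (one_le_geomInv p _)).ne', mertSum_natCast]
  have h1 := sum_inv_pow_log_le hN
  have h2 : ∑ p ∈ Finset.Icc 1 N with p.Prime,
      (∑ j ∈ Finset.range (Nat.log p N), ((p : ℝ)⁻¹) ^ (j + 1) / (j + 1) -
        2 * ((p : ℝ)⁻¹) ^ (Nat.log p N + 1)) ≤ ∑ p ∈ Finset.Icc 1 N with p.Prime,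
      Real.log (geomInv p ((Nat.lcmUpto N).factorization p)) :=
    Finset.sum_le_sum fun p hp ↦ by
      have hp := (Finset.mem_filter.1 hp).2
      rw [Nat.factorization_lcmUpto N hp]
      exact le_log_geomInv hp.two_le _
  rw [Finset.sum_sub_distrib, ← Finset.mul_sum] at h2
  have h3 : 6 / √(N : ℝ) = 2 * (3 / √N) := by ring
  linarith

end Robin

namespace Robin

open ArithmeticFunction

/-- The function whose nonnegativity encodes Robin's inequality along `lcmUpto`. -/
noncomputable def robinGap (u : ℝ) : ℝ :=
  10000 * ((1 + u) * Real.exp (-(1 / 2) * u)) + (psiNorm u - 1) - u * mertRem u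

lemma log_lt_of_robinIneq {n : ℕ} (hn : 1 < Real.log n) (h : RobinIneq n) :
    Real.log ((sigma 1 n : ℝ) / n) <
      Real.eulerMascheroniConstant + Real.log (Real.log (Real.log n)) := by
  have hn0 : n ≠ 0 := by rintro rfl; norm_num at hn
  have hn' : (0 : ℝ) < n := by positivity
  have hs : (0 : ℝ) < sigma 1 n := by exact_mod_cast sigma_pos 1 n hn0
  rw [Real.log_lt_iff_lt_exp (by positivity), Real.exp_add, Real.exp_log (Real.log_pos hn),
    div_lt_iff₀ hn']
  unfold RobinIneq at h
  linarith

lemma robinGap_nonneg_of_large (h : ∀ n : ℕ, 5041 ≤ n → RobinIneq n) {u : ℝ}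
    (hu : 5041 ≤ Real.exp u) : 0 ≤ robinGap u := by
  have hu0 : 0 < u := Real.exp_lt_exp.1 (by rw [Real.exp_zero]; linarith)
  set N := ⌊Real.exp u⌋₊ with hN
  have hN1 : 5041 ≤ N := Nat.le_floor (by exact_mod_cast hu)
  have hNx : Real.exp u < N + 1 := Nat.lt_floor_add_one _
  have hN1' : (5041 : ℝ) ≤ N := by exact_mod_cast hN1
  have hdvd : N ∣ Nat.lcmUpto N :=
    Finset.dvd_lcm (f := id) (Finset.mem_Icc.2 ⟨le_trans (by norm_num) hN1, le_rfl⟩)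
  have hn := hN1.trans (Nat.le_of_dvd (Nat.lcmUpto_pos N) hdvd)
  have hlog : Real.log (Nat.lcmUpto N) = psiNorm u * Real.exp u := by
    rw [← Chebyshev.psi_eq_log_lcmUpto, psiNorm, mul_assoc, ← Real.exp_add, neg_add_cancel,
      Real.exp_zero, mul_one, Chebyshev.psi_eq_psi_coe_floor (Real.exp u)]
  have hlog1 : 1 < Real.log (Nat.lcmUpto N) := by
    rw [Real.lt_log_iff_exp_lt (by exact_mod_cast Nat.lcmUpto_pos N)]
    have : (5041 : ℝ) ≤ Nat.lcmUpto N := by exact_mod_cast hn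
    linarith [Real.exp_one_lt_d9]
  have hpn : 0 < psiNorm u := by
    by_contra! h0
    have := mul_nonpos_of_nonpos_of_nonneg h0 (Real.exp_pos u).le
    linarith
  have h1 := log_lt_of_robinIneq hlog1 (h _ hn)
  have h2 := le_log_sigma_lcmUpto (by omega : 1 ≤ N)
  have hm : mertSum N = mert u := by rw [mert, mertSum, mertSum, Nat.floor_natCast]
  have hll : 0 < Real.log (Real.log (Nat.lcmUpto N)) := Real.log_pos hlog1
  have h3 : Real.log (Real.log (Nat.lcmUpto N)) ≤ u + (psiNorm u - 1) := by
    rw [hlog, Real.log_mul hpn.ne' (Real.exp_pos u).ne', Real.log_exp]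
    linarith [Real.log_le_sub_one_of_pos hpn]
  have h4 : u * (Real.log (Real.log (Real.log (Nat.lcmUpto N))) - Real.log u) ≤ psiNorm u - 1 := by
    rw [← Real.log_div hll.ne' hu0.ne']
    have := Real.log_le_sub_one_of_pos (div_pos hll hu0)
    calc _ ≤ u * (Real.log (Real.log (Nat.lcmUpto N)) / u - 1) := by gcongr
      _ = Real.log (Real.log (Nat.lcmUpto N)) - u := by field_simp
      _ ≤ _ := by linarith
  have h5 : 6 / √(N : ℝ) ≤ 12 * Real.exp (-(1 / 2) * u) := by
    have : Real.exp (1 / 2 * u) ≤ 2 * √N := by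
      refine (sq_le_sq₀ (Real.exp_pos _).le (by positivity)).1 ?_
      rw [mul_pow, Real.sq_sqrt N.cast_nonneg, ← Real.exp_nat_mul]
      push_cast
      rw [show 2 * (1 / 2 * u) = u by ring]
      linarith
    have hs : 0 < √(N : ℝ) := Real.sqrt_pos.2 (by linarith)
    have he := Real.exp_pos (-(1 / 2) * u)
    rw [div_le_iff₀ hs]
    have : Real.exp (-(1 / 2) * u) * Real.exp (1 / 2 * u) = 1 := by
      rw [← Real.exp_add]; simp
    nlinarith
  rw [hm] at h2
  have h6 : u * mertRem u ≤ 12 * (u * Real.exp (-(1 / 2) * u)) + (psiNorm u - 1) := by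
    have : mertRem u ≤ 12 * Real.exp (-(1 / 2) * u) +
        (Real.log (Real.log (Real.log (Nat.lcmUpto N))) - Real.log u) := by
      rw [mertRem]; linarith
    nlinarith
  have h7 : 0 < Real.exp (-(1 / 2) * u) := Real.exp_pos _
  have h8 : 0 < u * Real.exp (-(1 / 2) * u) := by positivity
  rw [robinGap]
  nlinarith

lemma robinGap_nonneg_of_small {u : ℝ} (hu0 : 0 < u) (hu : Real.exp u < 5041) :
    0 ≤ robinGap u := by
  have hu9 : u < 9 := by
    refine Real.exp_lt_exp.1 (hu.trans ?_)
    rw [show (9 : ℝ) = (9 : ℕ) * 1 by norm_num, Real.exp_nat_mul]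
    refine lt_of_lt_of_le (by norm_num : (5041 : ℝ) < 2.7 ^ 9) ?_
    have := Real.exp_one_gt_d9
    gcongr
    linarith
  have h1 : 1 / 71 ≤ Real.exp (-(1 / 2) * u) := by
    have h2 : Real.exp (1 / 2 * u) ≤ 71 := by
      refine le_of_sq_le_sq ?_ (by norm_num)
      rw [← Real.exp_nat_mul]
      push_cast
      rw [show 2 * (1 / 2 * u) = u by ring]
      linarith
    rw [show -(1 / 2) * u = -(1 / 2 * u) by ring, Real.exp_neg, ← one_div]
    exact one_div_le_one_div_of_le (Real.exp_pos _) h2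
  have h3 := mert_le hu0.le
  have h4 := Real.one_sub_inv_le_log_of_pos hu0
  have h5 : u - 1 ≤ u * Real.log u := by
    have := mul_le_mul_of_nonneg_left h4 hu0.le
    rwa [mul_sub, mul_inv_cancel₀ hu0.ne', mul_one] at this
  have h6 : u * mert u ≤ 90 := by nlinarith [mert_nonneg u]
  have h7 : 0 < u * Real.eulerMascheroniConstant :=
    mul_pos hu0 (by linarith [Real.one_half_lt_eulerMascheroniConstant])
  have h8 := psiNorm_nonneg u
  rw [robinGap, mertRem]
  nlinarith

lemma robinGap_nonneg (h : ∀ n : ℕ, 5041 ≤ n → RobinIneq n) {u : ℝ} (hu : 0 < u) :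
    0 ≤ robinGap u :=
  (le_or_gt 5041 (Real.exp u)).elim (robinGap_nonneg_of_large h) (robinGap_nonneg_of_small hu)

end Robin

namespace Robin

open Set Filter Topology MeasureTheory

/-- The explicit part of the Laplace transform of `robinGap`. -/
noncomputable def gapPole (z : ℂ) : ℂ := 10000 * (1 / (z + 1 / 2) + 1 / (z + 1 / 2) ^ 2)

lemma lapInt_robinGap : LapInt robinGap 0 := by
  have h1 : LapInt (fun u ↦ Real.exp (-(1 / 2) * u) * (1 + u * 1)) (0 - 1 / 2) :=
    (lapInt_one.add lapInt_one.mul_id).exp_mul (1 / 2)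
  have h2 := ((((h1.mono (by norm_num : (0 : ℝ) - 1 / 2 ≤ 0)).const_mul 10000).add
    (lapInt_psiNorm.sub lapInt_one)).sub lapInt_mertRem.mul_id)
  exact h2.congr fun u _ ↦ by rw [robinGap]; ring

lemma lap_id_mul {a : ℝ → ℝ} {σ₀ : ℝ} (ha : LapInt a σ₀) {z : ℂ} (hz : σ₀ < z.re) :
    lap (fun u ↦ u * a u) z = -deriv (lap a) z := by
  rw [(hasDerivAt_lap ha hz).deriv, neg_neg]

lemma lap_id_mul_one {z : ℂ} (hz : 0 < z.re) : lap (fun u ↦ u * 1) z = 1 / z ^ 2 := by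
  have hz0 : z ≠ 0 := by rintro rfl; simp at hz
  have h : lap (fun _ ↦ 1) =ᶠ[𝓝 z] fun w ↦ w⁻¹ := by
    filter_upwards [(isOpen_lt continuous_const Complex.continuous_re).mem_nhds hz] with w hw
    rw [lap_one hw, one_div]
  rw [lap_id_mul lapInt_one hz, h.deriv_eq, deriv_inv, neg_neg, one_div]

lemma exp_mul_lap_mertRem {s : ℝ} (hs : 0 < s) :
    (fun z ↦ Complex.exp (z * lap mertRem z)) =ᶠ[𝓝 (s : ℂ)] fun z ↦ riemannZeta₁ (z + 1) := by
  refine eventuallyEq_of_eq_on_reals ?_ ?_ ?_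
  · exact (analyticAt_id.mul (lapInt_mertRem.analyticAt (by simpa using hs))).cexp
  · exact (differentiable_riemannZeta₁.comp (differentiable_id.add_const 1)).analyticAt _
  · filter_upwards [lt_mem_nhds hs] with t ht
    obtain ⟨h1, h2⟩ := zetaR_spec (by linarith : -1 < t)
    rw [lap_mertRem ht, h2, ← Complex.ofReal_mul, mul_div_cancel₀ _ ht.ne', ← Complex.ofReal_exp,
      Real.exp_log h1]

lemma lap_psiNorm_sub {s : ℝ} (hs : 0 < s) : lap psiNorm s - 1 / s =
    -(lap mertRem s + s * deriv (lap mertRem) s + 1) / (s + 1) := by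
  have hs' : 0 < (s : ℂ).re := by simpa using hs
  have hs0 : (s : ℂ) ≠ 0 := by exact_mod_cast hs.ne'
  have hs1 : (s : ℂ) + 1 ≠ 0 := by exact_mod_cast (by linarith : s + 1 ≠ 0)
  have hG := (lapInt_mertRem.analyticAt hs').differentiableAt.hasDerivAt
  have hev := exp_mul_lap_mertRem hs
  have h1 := ((hasDerivAt_id (s : ℂ)).mul hG).cexp
  have h2 : riemannZeta =ᶠ[𝓝 ((s : ℂ) + 1)]
      fun z ↦ Complex.exp ((z - 1) * lap mertRem (z - 1)) / (z - 1) := by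
    have hc : Tendsto (fun z : ℂ ↦ z - 1) (𝓝 ((s : ℂ) + 1)) (𝓝 (s : ℂ)) := by
      have : ContinuousAt (fun z : ℂ ↦ z - 1) ((s : ℂ) + 1) := by fun_prop
      simpa [ContinuousAt] using this
    filter_upwards [hc.eventually hev, hc.eventually_ne hs0] with z hz hz0
    simp only [sub_add_cancel] at hz
    rw [hz, riemannZeta₁_eq_mul (sub_ne_zero.1 hz0), mul_div_cancel_left₀ _ hz0]
  have h3 : HasDerivAt (fun z ↦ Complex.exp ((z - 1) * lap mertRem (z - 1)) / (z - 1))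
      ((Complex.exp (s * lap mertRem s) * (lap mertRem s + s * deriv (lap mertRem) s) * s -
        Complex.exp (s * lap mertRem s)) / s ^ 2) ((s : ℂ) + 1) := by
    have h4 : HasDerivAt (fun z ↦ Complex.exp (z * lap mertRem z) / z)
        ((Complex.exp (s * lap mertRem s) * (lap mertRem s + s * deriv (lap mertRem) s) * s -
          Complex.exp (s * lap mertRem s)) / s ^ 2) ((s : ℂ) + 1 - 1) := by
      rw [add_sub_cancel_right]
      refine (h1.div (hasDerivAt_id _) hs0).congr_deriv ?_
      simp
    exact h4.comp_sub_const ((s : ℂ) + 1) 1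
  rw [lap_psiNorm hs', h2.deriv_eq, h3.deriv, h2.self_of_nhds]
  simp only [add_sub_cancel_right]
  have := Complex.exp_ne_zero (s * lap mertRem s)
  field_simp
  ring

lemma lap_robinGap {s : ℝ} (hs : 0 < s) : lap robinGap s = gapPole s +
    (deriv (lap mertRem) s - lap mertRem s - 1) / (s + 1) := by
  have hs' : 0 < (s : ℂ).re := by simpa using hs
  have hs1 : (s : ℂ) + 1 ≠ 0 := by exact_mod_cast (by linarith : s + 1 ≠ 0)
  have hL := lapInt_one.add lapInt_one.mul_id
  have h1 : LapInt (fun u ↦ Real.exp (-(1 / 2) * u) * (1 + u * 1)) (0 - 1 / 2) :=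
    hL.exp_mul (1 / 2)
  have h1 := (h1.mono (by norm_num : (0 : ℝ) - 1 / 2 ≤ 0)).const_mul 10000
  have hs2 : 0 < ((s : ℂ) + (1 / 2 : ℝ)).re := by
    rw [← Complex.ofReal_add, Complex.ofReal_re]; linarith
  have h2 : lap robinGap s = lap (fun u ↦ 10000 * (Real.exp (-(1 / 2) * u) * (1 + u * 1)) +
      (psiNorm u - 1) - u * mertRem u) s := lap_congr (fun u _ ↦ by rw [robinGap]; ring) _
  rw [h2, lap_sub (h1.add (lapInt_psiNorm.sub lapInt_one)) lapInt_mertRem.mul_id hs',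
    lap_add h1 (lapInt_psiNorm.sub lapInt_one) hs', lap_sub lapInt_psiNorm lapInt_one hs',
    lap_one hs', lap_psiNorm_sub hs, lap_id_mul lapInt_mertRem hs', lap_const_mul,
    lap_exp_mul (fun u ↦ 1 + u * 1), lap_add lapInt_one lapInt_one.mul_id hs2, lap_one hs2,
    lap_id_mul_one hs2, gapPole]
  push_cast
  have : deriv (lap mertRem) s = deriv (lap mertRem) s * (s + 1) / (s + 1) := by
    rw [mul_div_cancel_right₀ _ hs1]
  rw [add_sub_assoc]
  congr 1
  rw [eq_div_iff hs1, sub_mul, div_mul_cancel₀ _ hs1]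
  ring

/-- The analytic continuation of the Laplace transform of `mertRem` along the real axis. -/
noncomputable def lapRem : ℂ → ℂ := dslope (fun z ↦ Complex.log (riemannZeta₁ (z + 1))) 0

lemma analyticAt_lapRem {s : ℝ} (hs : -1 < s) : AnalyticAt ℂ lapRem s := by
  set Z : ℂ → ℂ := fun z ↦ riemannZeta₁ (z + 1) with hZ
  have hZd : Differentiable ℂ Z := differentiable_riemannZeta₁.comp (differentiable_id.add_const 1)
  have hU : IsOpen (Z ⁻¹' Complex.slitPlane) := Complex.isOpen_slitPlane.preimage hZd.continuous
  have hmem : ∀ t : ℝ, -1 < t → (t : ℂ) ∈ Z ⁻¹' Complex.slitPlane := fun t ht ↦ by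
    obtain ⟨h1, h2⟩ := zetaR_spec ht
    rw [mem_preimage, hZ]
    simp only [h2]
    exact Complex.ofReal_mem_slitPlane.2 h1
  have h0 : Z ⁻¹' Complex.slitPlane ∈ 𝓝 (0 : ℂ) :=
    hU.mem_nhds (by simpa using hmem 0 (by norm_num))
  have h1 : DifferentiableOn ℂ (fun z ↦ Complex.log (Z z)) (Z ⁻¹' Complex.slitPlane) :=
    fun z hz ↦ ((hZd z).clog hz).differentiableWithinAt
  exact ((Complex.differentiableOn_dslope h0).2 h1).analyticAt (hU.mem_nhds (hmem s hs))

lemma lap_mertRem_eq_lapRem {s : ℝ} (hs : 0 < s) : lap mertRem s = lapRem s := by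
  obtain ⟨h1, h2⟩ := zetaR_spec (by linarith : -1 < s)
  rw [lapRem, dslope_of_ne _ (by exact_mod_cast hs.ne'), slope_def_field, h2, zero_add,
    riemannZeta₁_one, Complex.log_one, sub_zero, sub_zero, lap_mertRem hs, Complex.ofReal_div,
    Complex.ofReal_log h1.le]

lemma lapInt_robinGap_neg (h : ∀ n : ℕ, 5041 ≤ n → RobinIneq n) :
    LapInt robinGap (-(1 / 2)) := by
  refine LapInt.of_analyticAt (by norm_num) lapInt_robinGap (fun u hu ↦ robinGap_nonneg h hu)
    (H := fun z ↦ gapPole z + (deriv lapRem z - lapRem z - 1) / (z + 1)) (fun s hs ↦ ?_)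
    fun s hs ↦ ?_
  · have hA := analyticAt_lapRem (by linarith : -1 < s)
    have h1 : (s : ℂ) + 1 / 2 ≠ 0 := by
      have : s + 1 / 2 ≠ 0 := by linarith
      have := Complex.ofReal_ne_zero.2 this
      push_cast at this
      exact this
    have h2 : (s : ℂ) + 1 ≠ 0 := by exact_mod_cast (by linarith : s + 1 ≠ 0)
    have h3 : AnalyticAt ℂ gapPole s := by
      have : AnalyticAt ℂ (fun z : ℂ ↦ z + 1 / 2) s := by fun_prop
      exact analyticAt_const.mul ((analyticAt_const.div this h1).add
        (analyticAt_const.div (this.pow 2) (pow_ne_zero 2 h1)))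
    exact h3.add (((hA.deriv.sub hA).sub analyticAt_const).div
      (analyticAt_id.add analyticAt_const) h2)
  · have hev : lap mertRem =ᶠ[𝓝 (s : ℂ)] lapRem :=
      eventuallyEq_of_eq_on_reals (lapInt_mertRem.analyticAt (by simpa using hs))
        (analyticAt_lapRem (by linarith))
        (by filter_upwards [lt_mem_nhds hs] with t ht using lap_mertRem_eq_lapRem ht)
    rw [lap_robinGap hs, hev.deriv_eq, hev.self_of_nhds]

lemma riemannZeta₁_ne_zero_of_robin (h : ∀ n : ℕ, 5041 ≤ n → RobinIneq n) {z₀ : ℂ}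
    (hz₀ : -(1 / 2) < z₀.re) : riemannZeta₁ (z₀ + 1) ≠ 0 := by
  have hL := lapInt_robinGap_neg h
  obtain ⟨c, hc1, hc⟩ : ∃ c : ℝ, 1 < c ∧ z₀ ∈ Metric.ball (c : ℂ) (c + 1 / 2) := by
    obtain ⟨c, hc⟩ := exists_gt (max 1 (Complex.normSq z₀ / (1 + 2 * z₀.re)))
    have hc1 : 1 < c := (le_max_left _ _).trans_lt hc
    have hc2 := (div_lt_iff₀ (by linarith)).1 ((le_max_right _ _).trans_lt hc)
    refine ⟨c, hc1, ?_⟩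
    rw [Metric.mem_ball, Complex.dist_eq, ← sq_lt_sq₀ (norm_nonneg _) (by linarith),
      ← Complex.normSq_eq_norm_sq]
    rw [Complex.normSq_apply] at *
    simp only [Complex.sub_re, Complex.sub_im, Complex.ofReal_re, Complex.ofReal_im]
    nlinarith
  set B := Metric.ball (c : ℂ) (c + 1 / 2) with hB
  have hBre : ∀ z ∈ B, -(1 / 2) < z.re := fun z hz ↦ by
    have h1 := (Complex.abs_re_le_norm (z - c)).trans_lt (mem_ball_iff_norm.1 hz)
    rw [Complex.sub_re, Complex.ofReal_re] at h1
    linarith [(abs_lt.1 h1).1]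
  have h1B : (1 : ℂ) ∈ B := by
    rw [hB, Metric.mem_ball, Complex.dist_eq, ← Complex.ofReal_one, ← Complex.ofReal_sub,
      Complex.norm_real, Real.norm_eq_abs, abs_lt]
    constructor <;> linarith
  set R : ℂ → ℂ := fun z ↦ (z + 1) * (lap robinGap z - gapPole z) + 1 with hR
  have hRd : DifferentiableOn ℂ R B := fun z hz ↦ by
    have hz := hBre z hz
    have h1 : z + 1 / 2 ≠ 0 := fun h0 ↦ by
      have := congrArg Complex.re h0
      simp at this
      linarith
    have h2 : DifferentiableAt ℂ gapPole z := by
      have : DifferentiableAt ℂ (fun z : ℂ ↦ z + 1 / 2) z := by fun_prop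
      exact ((((differentiableAt_const 1).div this h1)).add
        ((differentiableAt_const 1).div (this.pow 2) (pow_ne_zero 2 h1))).const_mul 10000
    have h3 := (hL.analyticAt hz).differentiableAt
    exact (((differentiableAt_id.add_const 1).mul (h3.sub h2)).add_const 1).differentiableWithinAt
  have hER : DifferentiableOn ℂ (fun z ↦ Complex.exp (-z) * R z) B :=
    (by fun_prop : Differentiable ℂ fun z : ℂ ↦ Complex.exp (-z)).differentiableOn.mul hRd
  obtain ⟨w₀, hw₀⟩ := hER.isExactOn_ball
  set w : ℂ → ℂ := fun z ↦ w₀ z + (Complex.exp (-1) * lap mertRem 1 - w₀ 1) with hw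
  have hwd : ∀ z ∈ B, HasDerivAt w (Complex.exp (-z) * R z) z := fun z hz ↦
    (hw₀ z hz).add_const _
  have hGR : ∀ᶠ z in 𝓝 (1 : ℂ), deriv (lap mertRem) z - lap mertRem z = R z := by
    have hA : AnalyticAt ℂ (lap mertRem) ((1 : ℝ) : ℂ) := lapInt_mertRem.analyticAt (by simp)
    have := eventuallyEq_of_eq_on_reals (s := 1) (hA.deriv.sub hA)
      (hRd.analyticAt (Metric.isOpen_ball.mem_nhds (by rwa [Complex.ofReal_one]))) (by
        filter_upwards [lt_mem_nhds one_pos] with t ht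
        have ht1 : (t : ℂ) + 1 ≠ 0 := by exact_mod_cast (by linarith : t + 1 ≠ 0)
        simp only [Pi.sub_apply, hR]
        rw [lap_robinGap ht, add_sub_cancel_left, mul_div_cancel₀ _ ht1]
        ring)
    rw [Complex.ofReal_one] at this
    exact this
  have hwG : ∀ᶠ z in 𝓝 (1 : ℂ), w z = Complex.exp (-z) * lap mertRem z := by
    have hre : ∀ᶠ z in 𝓝 (1 : ℂ), 0 < z.re :=
      (isOpen_lt continuous_const Complex.continuous_re).mem_nhds (by simp)
    obtain ⟨r, hr, hball⟩ := Metric.eventually_nhds_iff_ball.1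
      ((hGR.and hre).and (Metric.isOpen_ball.mem_nhds h1B))
    have hd1 : ∀ z ∈ Metric.ball (1 : ℂ) r, HasDerivAt w (Complex.exp (-z) * R z) z :=
      fun z hz ↦ hwd z (hball z hz).2
    have hd2 : ∀ z ∈ Metric.ball (1 : ℂ) r, HasDerivAt (fun z ↦ Complex.exp (-z) * lap mertRem z)
        (Complex.exp (-z) * R z) z := fun z hz ↦ by
      obtain ⟨⟨h1, h2⟩, -⟩ := hball z hz
      have hG := (lapInt_mertRem.analyticAt h2).differentiableAt.hasDerivAt
      refine ((hasDerivAt_neg z).cexp.mul hG).congr_deriv ?_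
      rw [← h1]
      ring
    have := Metric.isOpen_ball.eqOn_of_deriv_eq (Metric.isPreconnected_ball)
      (fun z hz ↦ (hd1 z hz).differentiableAt.differentiableWithinAt)
      (fun z hz ↦ (hd2 z hz).differentiableAt.differentiableWithinAt)
      (fun z hz ↦ by rw [(hd1 z hz).deriv, (hd2 z hz).deriv])
      (Metric.mem_ball_self hr) (by simp [hw])
    filter_upwards [Metric.ball_mem_nhds _ hr] with z hz using this hz
  have hfin : EqOn (fun z ↦ Complex.exp (z * (Complex.exp z * w z)))
      (fun z ↦ riemannZeta₁ (z + 1)) B := by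
    have hw_d : DifferentiableOn ℂ w B := fun z hz ↦
      (hwd z hz).differentiableAt.differentiableWithinAt
    refine AnalyticOnNhd.eqOn_of_preconnected_of_eventuallyEq (z₀ := 1)
      (DifferentiableOn.analyticOnNhd ?_ Metric.isOpen_ball)
      (DifferentiableOn.analyticOnNhd ?_ Metric.isOpen_ball) Metric.isPreconnected_ball h1B ?_
    · fun_prop
    · exact (differentiable_riemannZeta₁.comp (differentiable_id.add_const 1)).differentiableOn
    · have := exp_mul_lap_mertRem one_pos
      rw [Complex.ofReal_one] at this
      filter_upwards [hwG, this] with z h1 h2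
      rw [h1, ← mul_assoc (Complex.exp z), ← Complex.exp_add, add_neg_cancel, Complex.exp_zero,
        one_mul, h2]
  have := hfin hc
  simp only at this
  rw [← this]
  exact Complex.exp_ne_zero _

end Robin

namespace Robin

lemma riemannZeta_ne_zero_of_robin (h : ∀ n : ℕ, 5041 ≤ n → RobinIneq n) {s : ℂ}
    (hs : 1 / 2 < s.re) (hs1 : s ≠ 1) : riemannZeta s ≠ 0 := fun h0 ↦ by
  refine riemannZeta₁_ne_zero_of_robin h (z₀ := s - 1) ?_ ?_
  · rw [Complex.sub_re, Complex.one_re]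
    linarith
  · rw [sub_add_cancel, riemannZeta₁_eq_mul hs1, h0, mul_zero]

/-- A zero in the left half-plane is trivial or reflects to a zero in the right half-plane. -/
lemma exists_eq_or_riemannZeta_one_sub_eq_zero {s : ℂ} (h0 : riemannZeta s = 0)
    (hs : s.re < 1 / 2) : (∃ n : ℕ, s = -2 * (n + 1)) ∨ riemannZeta (1 - s) = 0 := by
  have h1 : ∀ n : ℕ, 1 - s ≠ -n := fun n hn ↦ by
    have := congrArg Complex.re hn
    simp only [Complex.sub_re, Complex.one_re, Complex.neg_re, Complex.natCast_re] at this
    have : (0 : ℝ) ≤ n := n.cast_nonneg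
    linarith
  have hs0 : s ≠ 0 := by
    rintro rfl
    rw [riemannZeta_zero] at h0
    norm_num at h0
  have h2 := riemannZeta_one_sub h1 (by simpa using hs0)
  rw [sub_sub_cancel, h0] at h2
  have hG : Complex.Gamma (1 - s) ≠ 0 := Complex.Gamma_ne_zero h1
  have hp : (2 * (Real.pi : ℂ)) ^ (-(1 - s)) ≠ 0 := by
    rw [Ne, Complex.cpow_eq_zero_iff]
    simp [Real.pi_ne_zero]
  rcases mul_eq_zero.1 h2.symm with h3 | h3
  · left
    have h4 : Complex.cos (Real.pi * (1 - s) / 2) = 0 := by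
      rcases mul_eq_zero.1 h3 with h5 | h5
      · exact absurd h5 (mul_ne_zero (mul_ne_zero two_ne_zero hp) hG)
      · exact h5
    obtain ⟨k, hk⟩ := Complex.cos_eq_zero_iff.1 h4
    have hpi : (Real.pi : ℂ) ≠ 0 := Complex.ofReal_ne_zero.2 Real.pi_ne_zero
    have h6 : s = -2 * (k : ℂ) := by
      have : (Real.pi : ℂ) * (1 - s) = Real.pi * (2 * k + 1) := by linear_combination 2 * hk
      linear_combination -(mul_left_cancel₀ hpi this)
    have hk0 : 0 < k := by
      have h7 : s.re = -2 * (k : ℝ) := by rw [h6]; simp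
      have h8 : k ≠ 0 := by rintro rfl; simp at h6; exact hs0 h6
      have h9 : (-1 : ℝ) < k := by rw [h7] at hs; linarith
      have : (-1 : ℤ) < k := by exact_mod_cast h9
      omega
    obtain ⟨n, hn⟩ := Int.eq_ofNat_of_zero_le (by omega : 0 ≤ k - 1)
    refine ⟨n, ?_⟩
    rw [h6, show k = (n : ℤ) + 1 by omega]
    push_cast
    ring
  · exact Or.inr h3

lemma rh_of_robinIneq (h : ∀ n : ℕ, 5041 ≤ n → RobinIneq n) : RiemannHypothesis := by
  intro s h0 htriv hs1
  have h1 : s.re ≤ 1 / 2 := by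
    by_contra! hlt
    exact riemannZeta_ne_zero_of_robin h hlt hs1 h0
  refine h1.antisymm ?_
  by_contra! hlt
  rcases exists_eq_or_riemannZeta_one_sub_eq_zero h0 hlt with h2 | h2
  · exact htriv h2
  · refine riemannZeta_ne_zero_of_robin h ?_ ?_ h2
    · rw [Complex.sub_re, Complex.one_re]
      linarith
    · intro h3
      have hs0 : s = 0 := by linear_combination -h3
      rw [hs0, riemannZeta_zero] at h0
      norm_num at h0

end Robin

/-- Robin's criterion (1984): the Riemann hypothesis holds if and only if
`σ(n) < e^γ n log log n` for every integer `n ≥ 5041`. -/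
theorem robin_criterion :
    RiemannHypothesis ↔
      ∀ n : ℕ, 5041 ≤ n →
        (ArithmeticFunction.sigma 1 n : ℝ) <
          Real.exp Real.eulerMascheroniConstant * n * Real.log (Real.log n) :=
  ⟨fun hRH _ hn ↦ Robin.robinIneq_of_rh hRH hn, fun h ↦ Robin.rh_of_robinIneq h⟩
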